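/- arXiv:1303.0895 — 7 statements merged into one kernel-verified Lean document; each statement's English description precedes it below -/
import Mathlib

section
/- Let n ≥ 1 and let σ : S^{2n} → ℝ^{2n+1} be a continuous oriented Kakeya line configuration. Then there exists a real number R ≥ 1 such that the R-elongation of the associated oriented Kakeya needle set, namely ⋃_{x ∈ S^{2n}} {σ(x) + t·x : t ∈ ℝ, |t| ≤ R/2}, has positive Lebesgue measure. -/
open MeasureTheory

open Module Polynomial Metric Set Topology

open scoped NNReal

/-- No nonzero real multiple of `√(1 + t²) ^ N` with `N` odd agrees with a polynomial near `0`. -/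
theorem Polynomial.not_odd_of_eval_eq_sqrt_pow {N : ℕ} (q : ℝ[X]) {V ε : ℝ} (hV : V ≠ 0)
    (hε : 0 < ε) (hq : ∀ t ∈ Ico 0 ε, q.eval t = √(1 + t ^ 2) ^ N * V) : ¬ Odd N := by
  intro hN
  have hsq : q ^ 2 = C (V ^ 2) * (1 + X ^ 2) ^ N := by
    refine eq_of_infinite_eval_eq _ _ ((Ico_infinite hε).mono fun t ht => ?_)
    have h : √(1 + t ^ 2) ^ 2 = 1 + t ^ 2 := Real.sq_sqrt (by positivity)
    simp only [mem_ofPred_eq, eval_pow, eval_mul, eval_C, eval_add, eval_one, eval_X]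
    rw [hq t ht, mul_pow, ← pow_mul, mul_comm N, pow_mul, h, mul_comm]
  have hdeg : q.natDegree = N := by
    have h := congrArg natDegree hsq
    have h2 : (1 + X ^ 2 : ℝ[X]).natDegree = 2 := by compute_degree!
    rw [natDegree_pow, natDegree_C_mul (pow_ne_zero 2 hV), natDegree_pow, h2] at h
    omega
  have hrefl : (q.comp (-X)) ^ 2 = q ^ 2 := by
    rw [← pow_comp, hsq]
    simp
  have hq0 : q.eval 0 ^ 2 = V ^ 2 := by
    rw [← eval_pow, hsq]
    simp
  rcases sq_eq_sq_iff_eq_or_eq_neg.1 hrefl with h | h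
  · have hne : q.leadingCoeff ≠ 0 := by
      rw [leadingCoeff_ne_zero]
      rintro rfl
      exact hV (by simpa using hq0.symm)
    have hlc := congrArg leadingCoeff h
    rw [comp_neg_X_leadingCoeff_eq, hdeg, hN.neg_one_pow] at hlc
    exact hne (by linarith)
  · have h0 := congrArg (eval 0) h
    simp only [eval_comp, eval_neg, eval_X, neg_zero] at h0
    have : q.eval 0 = 0 := by linarith
    rw [this] at hq0
    exact hV (by simpa using hq0.symm)

/-- Normalization of vectors is Lipschitz at `x` with constant `2 / ‖x‖`. -/
theorem norm_mul_norm_normalize_sub_le {E : Type*} [NormedAddCommGroup E] [NormedSpace ℝ E]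
    {x y : E} (hx : x ≠ 0) (hy : y ≠ 0) :
    ‖x‖ * ‖‖x‖⁻¹ • x - ‖y‖⁻¹ • y‖ ≤ 2 * ‖x - y‖ := by
  have hx' : ‖x‖ ≠ 0 := norm_ne_zero_iff.2 hx
  have hy' : ‖y‖ ≠ 0 := norm_ne_zero_iff.2 hy
  have h1 : ‖x‖ • (‖x‖⁻¹ • x - ‖y‖⁻¹ • y) = (x - y) + (‖y‖ - ‖x‖) • (‖y‖⁻¹ • y) := by
    rw [sub_smul, smul_sub, smul_smul, smul_smul, smul_smul, mul_inv_cancel₀ hx',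
      mul_inv_cancel₀ hy', one_smul, one_smul]
    abel
  calc ‖x‖ * ‖‖x‖⁻¹ • x - ‖y‖⁻¹ • y‖ = ‖‖x‖ • (‖x‖⁻¹ • x - ‖y‖⁻¹ • y)‖ := by
        rw [norm_smul, norm_norm]
    _ ≤ ‖x - y‖ + ‖(‖y‖ - ‖x‖) • (‖y‖⁻¹ • y)‖ := h1 ▸ norm_add_le _ _
    _ ≤ ‖x - y‖ + ‖x - y‖ := by
        gcongr
        rw [norm_smul, norm_smul, norm_inv, norm_norm, inv_mul_cancel₀ hy', mul_one,
          norm_sub_rev x y]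
        exact abs_norm_sub_norm_le y x
    _ = 2 * ‖x - y‖ := by ring

/-- The degree one homogeneous extension of a bounded Lipschitz map on the sphere is Lipschitz. -/
theorem LipschitzOnWith.norm_smul_normalize {E F : Type*} [NormedAddCommGroup E] [NormedSpace ℝ E]
    [NormedAddCommGroup F] [NormedSpace ℝ F] {h : E → F} {K B : ℝ≥0}
    (hK : LipschitzOnWith K h (sphere 0 1)) (hB : ∀ x ∈ sphere (0 : E) 1, ‖h x‖ ≤ B) :
    LipschitzWith (2 * K + B) fun x => ‖x‖ • h (‖x‖⁻¹ • x) := by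
  have hmem : ∀ {x : E}, x ≠ 0 → ‖x‖⁻¹ • x ∈ sphere (0 : E) 1 := fun {x} hx => by
    simp [norm_smul, norm_ne_zero_iff.2 hx]
  refine LipschitzWith.of_dist_le_mul fun x y => ?_
  rw [dist_eq_norm, dist_eq_norm]
  push_cast
  have hcoef : (B : ℝ) ≤ 2 * K + B := by linarith [K.coe_nonneg]
  rcases eq_or_ne x 0 with rfl | hx
  · rcases eq_or_ne y 0 with rfl | hy
    · simp
    · simp only [norm_zero, zero_smul, zero_sub, norm_neg, norm_smul, norm_norm]
      rw [mul_comm]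
      gcongr
      exact (hB _ (hmem hy)).trans hcoef
  rcases eq_or_ne y 0 with rfl | hy
  · simp only [norm_zero, zero_smul, sub_zero, norm_smul, norm_norm]
    rw [mul_comm]
    gcongr
    exact (hB _ (hmem hx)).trans hcoef
  have h1 : ‖x‖ • h (‖x‖⁻¹ • x) - ‖y‖ • h (‖y‖⁻¹ • y)
      = ‖x‖ • (h (‖x‖⁻¹ • x) - h (‖y‖⁻¹ • y)) + (‖x‖ - ‖y‖) • h (‖y‖⁻¹ • y) := by
    rw [smul_sub, sub_smul]
    abel
  calc _ ≤ ‖x‖ * ‖h (‖x‖⁻¹ • x) - h (‖y‖⁻¹ • y)‖ + |‖x‖ - ‖y‖| * ‖h (‖y‖⁻¹ • y)‖ := by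
        rw [h1]
        refine (norm_add_le _ _).trans_eq ?_
        rw [norm_smul, norm_smul, norm_norm, Real.norm_eq_abs]
    _ ≤ ‖x‖ * (K * ‖‖x‖⁻¹ • x - ‖y‖⁻¹ • y‖) + ‖x - y‖ * B := by
        gcongr
        · exact hK.norm_sub_le (hmem hx) (hmem hy)
        · exact abs_norm_sub_norm_le x y
        · exact hB _ (hmem hy)
    _ = K * (‖x‖ * ‖‖x‖⁻¹ • x - ‖y‖⁻¹ • y‖) + ‖x - y‖ * B := by ring
    _ ≤ K * (2 * ‖x - y‖) + ‖x - y‖ * B := by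
        grw [norm_mul_norm_normalize_sub_le hx hy]
    _ = (2 * K + B) * ‖x - y‖ := by ring

section FiniteDimensional

variable {E : Type*} [NormedAddCommGroup E]

section NormedSpace

variable [NormedSpace ℝ E]

theorem ContinuousLinearMap.exists_polynomial_eval_eq_det_id_add_smul [FiniteDimensional ℝ E]
    (A : E →L[ℝ] E) :
    ∃ p : ℝ[X], p.natDegree ≤ finrank ℝ E ∧
      ∀ t : ℝ, p.eval t = (ContinuousLinearMap.id ℝ E + t • A).det := by
  let b := finBasis ℝ E
  let M := LinearMap.toMatrix b b (A : E →ₗ[ℝ] E)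
  refine ⟨((X : ℝ[X]) • M.map C + (1 : Matrix _ _ ℝ).map C).det, ?_, fun t => ?_⟩
  · simpa using natDegree_det_X_add_C_le M 1
  · rw [ContinuousLinearMap.det, ← LinearMap.det_toMatrix b, ← coe_evalRingHom, RingHom.map_det]
    congr 1
    ext i j
    rcases eq_or_ne i j with rfl | hij
    · simp [M, LinearMap.toMatrix_apply]
      ring
    · simp [M, LinearMap.toMatrix_apply, hij]
      ring

theorem ContinuousLinearMap.det_id_add_smul_pos [FiniteDimensional ℝ E] (A : E →L[ℝ] E) {t : ℝ}
    (ht : |t| * ‖A‖ < 1) : 0 < (ContinuousLinearMap.id ℝ E + t • A).det := by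
  obtain ⟨p, -, hp⟩ := A.exists_polynomial_eval_eq_det_id_add_smul
  have hne : ∀ s ∈ uIcc 0 t, p.eval s ≠ 0 := by
    intro s hs hzero
    rw [hp] at hzero
    obtain ⟨v, hv, hv0⟩ :=
      (Submodule.ne_bot_iff _).1 (LinearMap.bot_lt_ker_of_det_eq_zero hzero).ne'
    have hv' : v + s • A v = 0 := by simpa using hv
    have hst : |s| ≤ |t| := by simpa using abs_sub_left_of_mem_uIcc hs
    have h1 : ‖v‖ ≤ |t| * ‖A‖ * ‖v‖ := calc
      ‖v‖ = |s| * ‖A v‖ := by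
        rw [← Real.norm_eq_abs, ← norm_smul, ← norm_neg (s • A v),
          ← eq_neg_of_add_eq_zero_left hv']
      _ ≤ |t| * (‖A‖ * ‖v‖) := by
        gcongr
        exact A.le_opNorm v
      _ = _ := by ring
    nlinarith [norm_pos_iff.2 hv0]
  rw [← hp]
  by_contra! hneg
  have h0 : p.eval 0 = 1 := by
    rw [hp]
    simp [ContinuousLinearMap.det]
  obtain ⟨s, hs, hs0⟩ := intermediate_value_uIcc (f := fun s => p.eval s) (a := 0) (b := t)
    p.continuous.continuousOn (show (0 : ℝ) ∈ uIcc (p.eval 0) (p.eval t) by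
      rw [h0]; exact mem_uIcc.2 (Or.inr ⟨hneg, zero_le_one⟩))
  exact hne s hs hs0

/-- A small Lipschitz perturbation of the identity is bijective. -/
theorem LipschitzWith.bijective_add_smul [CompleteSpace E] {u : E → E} {K : ℝ≥0}
    (hu : LipschitzWith K u) {t : ℝ} (ht : |t| * K < 1) :
    Function.Bijective fun x => x + t • u x := by
  have happ : ApproximatesLinearOn (fun x => x + t • u x)
      (ContinuousLinearEquiv.refl ℝ E : E →L[ℝ] E) univ (‖t‖₊ * K) := by
    intro x _ y _
    have h : x + t • u x - (y + t • u y) - (x - y) = t • (u x - u y) := by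
      rw [smul_sub]; abel
    simp only [ContinuousLinearEquiv.coe_refl, ContinuousLinearMap.coe_id', id_eq]
    rw [h, norm_smul]
    push_cast
    rw [mul_assoc]
    gcongr
    exact hu.norm_sub_le x y
  have hc : Subsingleton E ∨
      ‖t‖₊ * K < ‖((ContinuousLinearEquiv.refl ℝ E).symm : E →L[ℝ] E)‖₊⁻¹ := by
    rcases subsingleton_or_nontrivial E with h | h
    · exact Or.inl h
    · right
      have : ‖((ContinuousLinearEquiv.refl ℝ E).symm : E →L[ℝ] E)‖₊ = 1 := by
        ext; simp
      rw [this, inv_one, ← NNReal.coe_lt_coe]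
      simpa using ht
  exact ⟨injOn_univ.1 (happ.injOn hc), happ.surjective hc⟩

end NormedSpace

variable [InnerProductSpace ℝ E] [FiniteDimensional ℝ E]

/-- The Jacobian of `x ↦ x + t • u x` integrates over the punctured unit ball to the volume of a
ball of radius `√(1 + t²)`, when `u` is a norm-preserving Lipschitz field of orthogonal vectors. -/
theorem integral_det_id_add_smul_fderiv [MeasurableSpace E] [BorelSpace E] [Nontrivial E]
    (μ : Measure E) [μ.IsAddHaarMeasure] {u : E → E} {K : ℝ≥0}
    (hu : LipschitzWith K u) (hdiff : ∀ x ≠ 0, DifferentiableAt ℝ u x)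
    (hnorm : ∀ x, ‖u x‖ = ‖x‖) (horth : ∀ x, inner ℝ x (u x) = 0) {t : ℝ} (ht : |t| * K < 1) :
    IntegrableOn (fun x => (ContinuousLinearMap.id ℝ E + t • fderiv ℝ u x).det)
        (ball 0 1 \ {0}) μ ∧
      ∫ x in ball 0 1 \ {0}, (ContinuousLinearMap.id ℝ E + t • fderiv ℝ u x).det ∂μ =
        √(1 + t ^ 2) ^ finrank ℝ E * μ.real (ball 0 1) := by
  set f : E → E := fun x => x + t • u x with hf
  set s : Set E := ball 0 1 \ {0} with hs
  have hbij : Function.Bijective f := hu.bijective_add_smul ht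
  have hr : 0 < √(1 + t ^ 2) := by positivity
  have hfnorm : ∀ x, ‖f x‖ = √(1 + t ^ 2) * ‖x‖ := by
    intro x
    rw [← sq_eq_sq₀ (by positivity) (by positivity), mul_pow, Real.sq_sqrt (by positivity), hf,
      norm_add_sq_real, inner_smul_right, horth, norm_smul, hnorm, mul_pow, Real.norm_eq_abs,
      sq_abs]
    ring
  have himage : f '' s = ball 0 √(1 + t ^ 2) \ {0} := by
    ext y
    obtain ⟨x, rfl⟩ := hbij.2 y
    rw [hbij.1.mem_set_image, hs, mem_sdiff, mem_sdiff, mem_ball_zero_iff, mem_ball_zero_iff,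
      mem_singleton_iff, mem_singleton_iff, ← norm_eq_zero, ← norm_eq_zero (a := f x), hfnorm]
    simp [hr.ne', hr]
  have hmeas : MeasurableSet s := measurableSet_ball.diff (measurableSet_singleton 0)
  have hderiv : ∀ x ∈ s,
      HasFDerivWithinAt f (ContinuousLinearMap.id ℝ E + t • fderiv ℝ u x) s x := fun x hx =>
    ((hasFDerivAt_id x).add ((hdiff x hx.2).hasFDerivAt.const_smul t)).hasFDerivWithinAt
  have hpos : ∀ x ∈ s, 0 < (ContinuousLinearMap.id ℝ E + t • fderiv ℝ u x).det := by
    refine fun x hx => ContinuousLinearMap.det_id_add_smul_pos _ (lt_of_le_of_lt ?_ ht)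
    gcongr
    exact (hdiff x hx.2).hasFDerivAt.le_of_lipschitz hu
  have habs : EqOn (fun x => |(ContinuousLinearMap.id ℝ E + t • fderiv ℝ u x).det| • (1 : ℝ))
      (fun x => (ContinuousLinearMap.id ℝ E + t • fderiv ℝ u x).det) s := fun x hx => by
    simp [abs_of_pos (hpos x hx)]
  constructor
  · rw [← integrableOn_congr_fun habs hmeas]
    refine (integrableOn_image_iff_integrableOn_abs_det_fderiv_smul μ hmeas hderiv
      hbij.1.injOn fun _ => (1 : ℝ)).1 ?_
    rw [himage]
    exact integrableOn_const ((measure_mono sdiff_subset).trans_lt measure_ball_lt_top).ne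
  · rw [← setIntegral_congr_fun hmeas habs,
      ← integral_image_eq_integral_abs_det_fderiv_smul μ hmeas hderiv hbij.1.injOn fun _ => (1 : ℝ),
      himage, setIntegral_const, smul_eq_mul, mul_one, measureReal_def,
      measure_sdiff_null (measure_singleton 0), Measure.addHaar_ball μ 0 hr.le, ENNReal.toReal_mul,
      ENNReal.toReal_ofReal (by positivity), measureReal_def]

/-- A space carrying a norm-preserving Lipschitz field of orthogonal vectors, differentiable away
from the origin, does not have odd dimension. -/
theorem not_odd_finrank_of_lipschitzWith_orthogonal_field {u : E → E} {K : ℝ≥0}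
    (hu : LipschitzWith K u) (hdiff : ∀ x ≠ 0, DifferentiableAt ℝ u x)
    (hnorm : ∀ x, ‖u x‖ = ‖x‖) (horth : ∀ x, inner ℝ x (u x) = 0) :
    ¬ Odd (finrank ℝ E) := by
  intro hodd
  have : Nontrivial E := nontrivial_of_finrank_pos hodd.pos
  borelize E
  let μ : Measure E := Measure.addHaar
  set N := finrank ℝ E
  let D : ℝ → E → ℝ := fun t x => (ContinuousLinearMap.id ℝ E + t • fderiv ℝ u x).det
  set ε : ℝ := (K + 1 : ℝ)⁻¹ with hε
  have hε0 : 0 < ε := by positivity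
  have hsmall : ∀ t ∈ Ico 0 ε, |t| * K < 1 := by
    intro t ht
    rw [abs_of_nonneg ht.1]
    have h1 : t * (K + 1) < 1 := by
      have := mul_lt_mul_of_pos_right ht.2 (show (0 : ℝ) < K + 1 by positivity)
      rwa [hε, inv_mul_cancel₀ (by positivity)] at this
    nlinarith [ht.1]
  have key := fun t ht => integral_det_id_add_smul_fderiv μ hu hdiff hnorm horth (hsmall t ht)
  let node : ℕ → ℝ := fun i => ε * (i / (N + 1))
  have hnode : Set.InjOn node (Finset.range (N + 1)) := by
    intro i _ j _ hij
    have h1 : (i : ℝ) / (N + 1) = j / (N + 1) := mul_left_cancel₀ hε0.ne' hij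
    have h2 : (N + 1 : ℝ) ≠ 0 := by positivity
    exact_mod_cast (div_left_inj' h2).1 h1
  have hnode_mem : ∀ i ∈ Finset.range (N + 1), node i ∈ Ico 0 ε := by
    intro i hi
    refine ⟨by positivity, mul_lt_of_lt_one_right hε0 ?_⟩
    rw [div_lt_one (by positivity)]
    exact_mod_cast Finset.mem_range.1 hi
  have hinterp : ∀ t x, D t x =
      ∑ i ∈ Finset.range (N + 1),
        D (node i) x * (Lagrange.basis (Finset.range (N + 1)) node i).eval t := by
    intro t x
    obtain ⟨p, hpdeg, hp⟩ := (fderiv ℝ u x).exists_polynomial_eval_eq_det_id_add_smul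
    have hlt : p.degree < (Finset.range (N + 1)).card := by
      rw [Finset.card_range]
      exact degree_le_natDegree.trans_lt (by exact_mod_cast Nat.lt_succ_of_le hpdeg)
    change (ContinuousLinearMap.id ℝ E + t • fderiv ℝ u x).det = _
    rw [← hp, Lagrange.eq_interpolate hnode hlt, Lagrange.interpolate_apply, eval_finsetSum]
    refine Finset.sum_congr rfl fun i _ => ?_
    rw [eval_mul, eval_C, hp]
  refine Polynomial.not_odd_of_eval_eq_sqrt_pow (N := N) (V := μ.real (ball 0 1)) (ε := ε)
    (∑ i ∈ Finset.range (N + 1), C (∫ x in ball 0 1 \ {0}, D (node i) x ∂μ) *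
      Lagrange.basis (Finset.range (N + 1)) node i)
    ?_ hε0 (fun t ht => ?_) hodd
  · exact (ENNReal.toReal_pos (measure_ball_pos μ _ one_pos).ne' measure_ball_lt_top.ne).ne'
  · rw [← (key t ht).2]
    change _ = ∫ x in ball 0 1 \ {0}, D t x ∂μ
    simp_rw [hinterp t]
    rw [integral_finsetSum _ fun i hi => (key _ (hnode_mem i hi)).1.mul_const _, eval_finsetSum]
    refine Finset.sum_congr rfl fun i _ => ?_
    rw [integral_mul_const, eval_mul, eval_C]

/-- There is no `C¹` unit tangent field on the unit sphere of an odd-dimensional space. -/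
theorem not_odd_finrank_of_contDiffAt_unit_tangent_field {h : E → E}
    (hdiff : ∀ x ∈ sphere (0 : E) 1, ContDiffAt ℝ 1 h x)
    (hnorm : ∀ x ∈ sphere (0 : E) 1, ‖h x‖ = 1)
    (horth : ∀ x ∈ sphere (0 : E) 1, inner ℝ x (h x) = 0) :
    ¬ Odd (finrank ℝ E) := by
  have hmem : ∀ {x : E}, x ≠ 0 → ‖x‖⁻¹ • x ∈ sphere (0 : E) 1 := fun {x} hx => by
    simp [norm_smul, norm_ne_zero_iff.2 hx]
  obtain ⟨K, hK⟩ : ∃ K, LipschitzOnWith K h (sphere 0 1) := by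
    refine LocallyLipschitzOn.exists_lipschitzOnWith_of_compact (isCompact_sphere 0 1) ?_
    intro x hx
    obtain ⟨K, t, ht, hKt⟩ := (hdiff x hx).exists_lipschitzOnWith
    exact ⟨K, t, mem_nhdsWithin_of_mem_nhds ht, hKt⟩
  refine not_odd_finrank_of_lipschitzWith_orthogonal_field
    (hK.norm_smul_normalize (B := 1) fun x hx => by simp [hnorm x hx]) (fun x hx => ?_)
    (fun x => ?_) (fun x => ?_)
  · have h1 : DifferentiableAt ℝ (fun x : E => ‖x‖) x := differentiableAt_id.norm ℝ hx
    have h2 : DifferentiableAt ℝ (fun x : E => ‖x‖⁻¹ • x) x :=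
      (h1.inv (norm_ne_zero_iff.2 hx)).smul differentiableAt_id
    exact h1.smul (DifferentiableAt.comp x (f := fun x : E => ‖x‖⁻¹ • x)
      ((hdiff _ (hmem hx)).differentiableAt one_ne_zero) h2)
  · rcases eq_or_ne x 0 with rfl | hx
    · simp
    · simp [norm_smul, hnorm _ (hmem hx)]
  · rcases eq_or_ne x 0 with rfl | hx
    · simp
    · have h1 := horth _ (hmem hx)
      rw [real_inner_smul_left] at h1
      rw [inner_smul_right, (mul_eq_zero.1 h1).resolve_left (by simpa using hx), mul_zero]

/-- **Hairy ball theorem**: a continuous tangent field on the unit sphere of an odd-dimensional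
Euclidean space vanishes somewhere. -/
theorem exists_eq_zero_of_continuous_tangent_field (hodd : Odd (finrank ℝ E))
    {v : sphere (0 : E) 1 → E} (hv : Continuous v)
    (horth : ∀ x : sphere (0 : E) 1, inner ℝ (x : E) (v x) = 0) :
    ∃ x, v x = 0 := by
  by_contra! hne
  have : Nontrivial E := nontrivial_of_finrank_pos hodd.pos
  have : Nonempty (sphere (0 : E) 1) := (NormedSpace.sphere_nonempty.2 zero_le_one).to_subtype
  have : CompactSpace (sphere (0 : E) 1) := isCompact_iff_compactSpace.1 (isCompact_sphere 0 1)
  obtain ⟨x₀, -, hx₀⟩ := isCompact_univ.exists_isMinOn univ_nonempty hv.norm.continuousOn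
  obtain ⟨V, hV⟩ := ContinuousMap.exists_restrict_eq (isClosed_sphere (x := (0 : E)) (ε := 1))
    ⟨v, hv⟩
  obtain ⟨g, hg, hgV, -⟩ := V.continuous.exists_contDiff_approx 1
    (ε := fun _ => ‖v x₀‖) continuous_const fun _ => norm_pos_iff.2 (hne x₀)
  let w : E → E := fun x => g x - (inner ℝ x (g x) : ℝ) • x
  have hw : ContDiff ℝ 1 w := hg.sub ((contDiff_id.inner ℝ hg).smul contDiff_id)
  have hw0 : ∀ x ∈ sphere (0 : E) 1, w x ≠ 0 := by
    intro x hx hzero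
    have hVx : V x = v ⟨x, hx⟩ := DFunLike.congr_fun hV ⟨x, hx⟩
    have hgx : g x = (inner ℝ x (g x) : ℝ) • x := sub_eq_zero.1 hzero
    have h1 : ‖v ⟨x, hx⟩‖ ≤ ‖g x - V x‖ := by
      rw [← sq_le_sq₀ (norm_nonneg _) (norm_nonneg _), hVx, norm_sub_sq_real, hgx,
        real_inner_smul_left, horth ⟨x, hx⟩]
      nlinarith [sq_nonneg ‖(inner ℝ x (g x) : ℝ) • x‖]
    have h2 : ‖g x - V x‖ < ‖v x₀‖ := by simpa [dist_eq_norm] using hgV x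
    exact absurd (hx₀ (mem_univ ⟨x, hx⟩)) (not_le.2 (h1.trans_lt h2))
  refine not_odd_finrank_of_contDiffAt_unit_tangent_field (h := fun x => ‖w x‖⁻¹ • w x)
    (fun x hx => ?_) (fun x hx => ?_) (fun x hx => ?_) hodd
  · exact ((hw.contDiffAt.norm ℝ (hw0 x hx)).inv (norm_ne_zero_iff.2 (hw0 x hx))).smul
      hw.contDiffAt
  · simp [norm_smul, norm_ne_zero_iff.2 (hw0 x hx)]
  · have hx1 : ‖x‖ = 1 := by simpa using hx
    rw [inner_smul_right, inner_sub_right, inner_smul_right, real_inner_self_eq_norm_sq, hx1]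
    simp

/-- The lines through `σ x` with direction `x` cover an odd-dimensional space. -/
theorem exists_eq_add_smul_of_continuous_sphere (hodd : Odd (finrank ℝ E))
    {σ : sphere (0 : E) 1 → E} (hσ : Continuous σ) (p : E) :
    ∃ (x : sphere (0 : E) 1) (t : ℝ), p = σ x + t • (x : E) := by
  obtain ⟨x, hx⟩ := exists_eq_zero_of_continuous_tangent_field hodd
    (v := fun x => (p - σ x) - (inner ℝ (x : E) (p - σ x) : ℝ) • (x : E)) (by fun_prop)
    fun x => by
      rw [inner_sub_right, inner_smul_right, real_inner_self_eq_norm_sq, norm_eq_of_mem_sphere]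
      simp
  exact ⟨x, inner ℝ (x : E) (p - σ x), by rw [← sub_eq_zero.1 hx]; abel⟩

end FiniteDimensional

/-- For a continuous oriented Kakeya line configuration in `ℝ^{2n+1}`, some `R`-elongation of the
associated oriented Kakeya needle set has positive Lebesgue measure. -/
theorem exists_oriented_elongation_pos_measure (n : ℕ) (hn : 1 ≤ n)
    (σ : Metric.sphere (0 : EuclideanSpace ℝ (Fin (2 * n + 1))) 1 →
      EuclideanSpace ℝ (Fin (2 * n + 1)))
    (hσ : Continuous σ) :
    ∃ R : ℝ, 1 ≤ R ∧
      0 < volume (⋃ x : Metric.sphere (0 : EuclideanSpace ℝ (Fin (2 * n + 1))) 1,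
        {y : EuclideanSpace ℝ (Fin (2 * n + 1)) |
          ∃ t : ℝ, |t| ≤ R / 2 ∧
            y = σ x + t • (x : EuclideanSpace ℝ (Fin (2 * n + 1)))}) := by
  have hodd : Odd (finrank ℝ (EuclideanSpace ℝ (Fin (2 * n + 1)))) := by simp
  obtain ⟨M, hM⟩ := (isCompact_range hσ).isBounded.exists_norm_le
  refine ⟨max 1 (2 * (1 + M)), le_max_left _ _,
    (measure_ball_pos volume (0 : EuclideanSpace ℝ (Fin (2 * n + 1))) one_pos).trans_le
      (measure_mono fun p hp => ?_)⟩
  obtain ⟨x, t, hpt⟩ := exists_eq_add_smul_of_continuous_sphere hodd hσ p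
  refine mem_iUnion.2 ⟨x, t, ?_, hpt⟩
  have h1 : |t| = ‖p - σ x‖ := by
    rw [hpt, add_sub_cancel_left, norm_smul, norm_eq_of_mem_sphere, mul_one, Real.norm_eq_abs]
  have h2 : ‖p - σ x‖ ≤ 1 + M :=
    (norm_sub_le _ _).trans (add_le_add (mem_ball_zero_iff.1 hp).le (hM _ (mem_range_self x)))
  linarith [le_max_right 1 (2 * (1 + M))]
end

section
/- Let p : [0, 2π] → ℂ be a continuous map, and for each t ∈ [0, 2π] let L_t = {p(t) + s·e^{it} : s ∈ ℝ} be the line through p(t) making angle t with the x-axis. Then the union ⋃_{t ∈ [0,2π]} L_t contains some point of the set K = {2πin : n ∈ ℤ}; that is, there exist t ∈ [0, 2π], s ∈ ℝ, and an integer n with p(t) + s·e^{it} = 2πin. -/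
open Real

/-- A real continuous function on `[0, 2π]` agrees somewhere with an integer multiple of
`2π cos`. -/
lemma exists_eq_int_mul_cos (f : ℝ → ℝ) (hf : ContinuousOn f (Set.Icc 0 (2 * π))) :
    ∃ t ∈ Set.Icc (0 : ℝ) (2 * π), ∃ n : ℤ, f t = 2 * π * n * cos t := by
  have hpi := pi_pos
  have hsub : Set.Icc 0 (π / 2) ⊆ Set.Icc 0 (2 * π) :=
    Set.Icc_subset_Icc_right (by linarith)
  have hcont (n : ℤ) : ContinuousOn (fun t ↦ f t - 2 * π * n * cos t) (Set.Icc 0 (π / 2)) :=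
    (hf.mono hsub).sub (by fun_prop)
  rcases le_total 0 (f (π / 2)) with h | h
  · obtain ⟨n, hn⟩ := exists_int_gt (f 0 / (2 * π))
    rw [div_lt_iff₀ (by positivity)] at hn
    obtain ⟨t, ht, hft⟩ := intermediate_value_Icc (by positivity) (hcont n)
      (show (0 : ℝ) ∈ _ by simp only [cos_zero, cos_pi_div_two]; constructor <;> linarith)
    exact ⟨t, hsub ht, n, sub_eq_zero.mp hft⟩
  · obtain ⟨n, hn⟩ := exists_int_lt (f 0 / (2 * π))
    rw [lt_div_iff₀ (by positivity)] at hn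
    obtain ⟨t, ht, hft⟩ := intermediate_value_Icc' (by positivity) (hcont n)
      (show (0 : ℝ) ∈ _ by simp only [cos_zero, cos_pi_div_two]; constructor <;> linarith)
    exact ⟨t, hsub ht, n, sub_eq_zero.mp hft⟩

/-- If `p : [0,2π] → ℂ` is continuous and `L_t` is the line through `p(t)` making angle `t` with
the `x`-axis, then `⋃_{t ∈ [0,2π]} L_t` meets the kernel `K = {2πin : n ∈ ℤ}` of the complex
exponential. -/
theorem line_family_meets_kernel (p : ℝ → ℂ) (hp : ContinuousOn p (Set.Icc 0 (2 * π))) :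
    ∃ t ∈ Set.Icc (0 : ℝ) (2 * π), ∃ s : ℝ, ∃ n : ℤ,
      p t + (s : ℂ) * Complex.exp ((t : ℂ) * Complex.I) =
        2 * (π : ℂ) * Complex.I * (n : ℂ) := by
  have him : ContinuousOn (fun t ↦ (p t).im) (Set.Icc 0 (2 * π)) :=
    Complex.continuous_im.comp_continuousOn hp
  have hre : ContinuousOn (fun t ↦ (p t).re) (Set.Icc 0 (2 * π)) :=
    Complex.continuous_re.comp_continuousOn hp
  obtain ⟨t, ht, n, h⟩ := exists_eq_int_mul_cos
    (fun t ↦ (p t).im * cos t - (p t).re * sin t)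
    ((him.mul continuous_cos.continuousOn).sub (hre.mul continuous_sin.continuousOn))
  refine ⟨t, ht, (2 * π * n - (p t).im) * sin t - (p t).re * cos t, n, ?_⟩
  have hsq := sin_sq_add_cos_sq t
  rw [Complex.exp_mul_I, ← Complex.ofReal_cos, ← Complex.ofReal_sin]
  apply Complex.ext
  · simp [-Complex.ofReal_cos, -Complex.ofReal_sin]
    linear_combination (-(p t).re) * hsq - sin t * h
  · simp [-Complex.ofReal_cos, -Complex.ofReal_sin]
    linear_combination (2 * π * n - (p t).im) * hsq + cos t * h
end

section
/- Let σ : ℝP(ℂ) → ℂ \ {0} be a continuous unoriented Kakeya line configuration in the multiplicative group ℂ* = ℂ \ {0}. Then the identity element 1 belongs to the underlying space |σ|; that is, there exist a real line L through the origin in ℂ and v ∈ L with σ(L)·exp(v) = 1. -/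
open LinearAlgebra.Projectivization

/-- The quotient topology on the projectivization of a topological vector space. -/
noncomputable instance Projectivization.instTopologicalSpace {K V : Type*} [DivisionRing K]
    [AddCommGroup V] [Module K V] [TopologicalSpace V] :
    TopologicalSpace (Projectivization K V) :=
  instTopologicalSpaceQuotient

theorem Projectivization.continuous_mk' {K V : Type*} [DivisionRing K] [AddCommGroup V]
    [Module K V] [TopologicalSpace V] : Continuous (Projectivization.mk' K (V := V)) :=
  continuous_quotient_mk'

/-- A nowhere vanishing path in `ℂ` has a continuous logarithm. -/
theorem unitInterval.exists_continuousMap_exp_eq {f : unitInterval → ℂ} (hf : Continuous f)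
    (hf0 : ∀ s, f s ≠ 0) : ∃ Γ : C(unitInterval, ℂ), ∀ s, Complex.exp (Γ s) = f s := by
  obtain ⟨Γ, hΓ, -⟩ := Complex.isCoveringMap_exp.exists_path_lifts
    ⟨fun s ↦ ⟨f s, hf0 s⟩, hf.subtype_mk hf0⟩ (Complex.log (f 0))
    (Subtype.ext (Complex.exp_log (hf0 0)).symm)
  exact ⟨Γ, fun s ↦ congrArg Subtype.val (congrFun hΓ s)⟩

/-- Some vertical translate by a period of `exp` of a path in `ℂ` meets, at some time `s`,
the real line through the origin with argument `π * s`. -/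
theorem unitInterval.exists_add_int_mul_two_pi_mul_I_eq_smul_exp (Γ : C(unitInterval, ℂ)) :
    ∃ (s : unitInterval) (k : ℤ) (r : ℝ), Γ s + k * (2 * Real.pi * Complex.I) =
      r • Complex.exp ((Real.pi * s : ℝ) * Complex.I) := by
  obtain ⟨k, hk⟩ := exists_int_gt (|(Γ 0).im| + |(Γ 1).im|)
  have hk0 : |(Γ 0).im| + |(Γ 1).im| < k * (2 * Real.pi) := by
    nlinarith [Real.pi_gt_three, abs_nonneg (Γ 0).im, abs_nonneg (Γ 1).im]
  let h (s : unitInterval) : ℝ := ((Γ s).im + k * (2 * Real.pi)) * Real.cos (Real.pi * s)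
    - (Γ s).re * Real.sin (Real.pi * s)
  have hh : Continuous h := by fun_prop
  have h0 : 0 ≤ h 0 := by
    simp only [h, Set.Icc.coe_zero, mul_zero, Real.cos_zero, Real.sin_zero]
    linarith [neg_abs_le (Γ 0).im, abs_nonneg (Γ 1).im]
  have h1 : h 1 ≤ 0 := by
    simp only [h, Set.Icc.coe_one, mul_one, Real.cos_pi, Real.sin_pi]
    linarith [neg_abs_le (Γ 1).im, abs_nonneg (Γ 0).im]
  obtain ⟨s, hs⟩ := mem_range_of_exists_le_of_exists_ge hh ⟨1, h1⟩ ⟨0, h0⟩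
  simp only [h] at hs
  have hcs := Real.sin_sq_add_cos_sq (Real.pi * s)
  refine ⟨s, k, (Γ s).re * Real.cos (Real.pi * s)
    + ((Γ s).im + k * (2 * Real.pi)) * Real.sin (Real.pi * s), ?_⟩
  apply Complex.ext
  · rw [Complex.smul_re, Complex.exp_ofReal_mul_I_re]
    simp only [Complex.add_re, Complex.mul_re, Complex.mul_im, Complex.intCast_re,
      Complex.intCast_im, Complex.I_re, Complex.I_im, Complex.re_ofNat, Complex.im_ofNat,
      Complex.ofReal_re, Complex.ofReal_im, smul_eq_mul]
    linear_combination (-(Γ s).re) * hcs - Real.sin (Real.pi * s) * hs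
  · rw [Complex.smul_im, Complex.exp_ofReal_mul_I_im]
    simp only [Complex.add_im, Complex.mul_re, Complex.mul_im, Complex.intCast_re,
      Complex.intCast_im, Complex.I_re, Complex.I_im, Complex.re_ofNat, Complex.im_ofNat,
      Complex.ofReal_re, Complex.ofReal_im, smul_eq_mul]
    linear_combination (-((Γ s).im + k * (2 * Real.pi))) * hcs + Real.cos (Real.pi * s) * hs

/-- The underlying space of a continuous unoriented Kakeya line configuration in the Lie group
`ℂ* = ℂ \ {0}` contains the identity element `1`. -/
theorem one_mem_underlying_space_units_complex
    (σ : ℙ ℝ ℂ → ℂ) (hσ : Continuous σ) (hσ0 : ∀ L : ℙ ℝ ℂ, σ L ≠ 0) :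
    ∃ L : ℙ ℝ ℂ, ∃ v ∈ L.submodule, σ L * Complex.exp v = 1 := by
  let u (s : unitInterval) : {z : ℂ // z ≠ 0} :=
    ⟨Complex.exp ((Real.pi * s : ℝ) * Complex.I), Complex.exp_ne_zero _⟩
  have hu : Continuous u := by fun_prop
  obtain ⟨Γ, hΓ⟩ := unitInterval.exists_continuousMap_exp_eq
    (hσ.comp (Projectivization.continuous_mk'.comp hu)) fun s ↦ hσ0 _
  obtain ⟨s, k, r, hr⟩ := unitInterval.exists_add_int_mul_two_pi_mul_I_eq_smul_exp Γ
  refine ⟨Projectivization.mk' ℝ (u s), -(Γ s + k * (2 * Real.pi * Complex.I)), ?_, ?_⟩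
  · rw [hr, Projectivization.mk'_eq_mk, Projectivization.submodule_mk]
    exact neg_mem (Submodule.smul_mem _ _ (Submodule.mem_span_singleton_self _))
  · have h : Complex.exp (Γ s) = σ (Projectivization.mk' ℝ (u s)) := hΓ s
    rw [← h, ← Complex.exp_add, neg_add, add_neg_cancel_left, Complex.exp_neg,
      Complex.exp_int_mul_two_pi_mul_I, inv_one]
end

section
/- Let σ : ℝP(ℂ) → ℂ \ {0} be a continuous unoriented Kakeya line configuration in the multiplicative group ℂ* = ℂ \ {0}. Then its underlying space is all of ℂ*; that is, for every w ∈ ℂ with w ≠ 0 there exist a real line L through the origin in ℂ and v ∈ L with σ(L)·exp(v) = w. -/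
open LinearAlgebra.Projectivization

/-- A path in `ℂ \ {0}` admits a continuous logarithm. -/
theorem exists_continuousMap_exp_eq (γ : C(unitInterval, ℂ)) (hγ : ∀ t, γ t ≠ 0) :
    ∃ g : C(unitInterval, ℂ), ∀ t, Complex.exp (g t) = γ t := by
  let γ' : C(unitInterval, {z : ℂ // z ≠ 0}) := ⟨fun t ↦ ⟨γ t, hγ t⟩, γ.continuous.subtype_mk _⟩
  obtain ⟨g, hg, -⟩ := Complex.isCoveringMap_exp.exists_path_lifts γ' (Complex.log (γ 0))
    (Subtype.ext (Complex.exp_log (hγ 0)).symm)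
  exact ⟨g, fun t ↦ congrArg Subtype.val (congrFun hg t)⟩

/-- A complex number `z` with `z * conj u` real lies on the real line spanned by `u ≠ 0`. -/
theorem mem_span_singleton_of_im_mul_conj_eq_zero {z u : ℂ} (hu : u ≠ 0)
    (h : (z * starRingEnd ℂ u).im = 0) : z ∈ Submodule.span ℝ {u} := by
  refine Submodule.mem_span_singleton.2
    ⟨(z * starRingEnd ℂ u).re / Complex.normSq u, ?_⟩
  have hu' : (Complex.normSq u : ℂ) ≠ 0 := by simpa using hu
  have hre : ((z * starRingEnd ℂ u).re : ℂ) = z * starRingEnd ℂ u :=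
    Complex.ext (by simp) (by simp only [Complex.ofReal_im, h])
  rw [Complex.real_smul, Complex.ofReal_div, hre, div_mul_eq_mul_div, div_eq_iff hu', mul_assoc,
    mul_comm _ u, Complex.mul_conj]

/-- The underlying space of a continuous unoriented Kakeya line configuration in the Lie group
`ℂ* = ℂ \ {0}` is all of `ℂ*`. -/
theorem underlying_space_eq_units_complex
    (σ : ℙ ℝ ℂ → ℂ) (hσ : Continuous σ) (hσ0 : ∀ L : ℙ ℝ ℂ, σ L ≠ 0) :
    ∀ w : ℂ, w ≠ 0 → ∃ L : ℙ ℝ ℂ, ∃ v ∈ L.submodule, σ L * Complex.exp v = w := by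
  intro w hw
  let u : unitInterval → ℂ := fun t ↦ Complex.I * Complex.exp ((Real.pi * t : ℝ) * Complex.I)
  have hu : ∀ t, u t ≠ 0 := fun t ↦ mul_ne_zero Complex.I_ne_zero (Complex.exp_ne_zero _)
  have hu_cont : Continuous u := by fun_prop
  have hu_zero : u 0 = Complex.I := by simp [u]
  have hu_one : u 1 = -Complex.I := by simp [u]
  let ℓ : unitInterval → ℙ ℝ ℂ := fun t ↦ .mk ℝ (u t) (hu t)
  have hℓ_cont : Continuous ℓ := continuous_quotient_mk'.comp (hu_cont.subtype_mk hu)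
  have hℓ : ℓ 0 = ℓ 1 := by
    refine (Projectivization.mk_eq_mk_iff' ℝ _ _ _ _).2 ⟨-1, ?_⟩
    simp [hu_zero, hu_one]
  obtain ⟨g, hg⟩ := exists_continuousMap_exp_eq
    ⟨fun t ↦ w / σ (ℓ t), continuous_const.div (hσ.comp hℓ_cont) fun t ↦ hσ0 _⟩
    fun t ↦ div_ne_zero hw (hσ0 _)
  replace hg : ∀ t, Complex.exp (g t) = w / σ (ℓ t) := hg
  have hre : (g 0).re = (g 1).re := by
    rw [← Real.exp_eq_exp, ← Complex.norm_exp, ← Complex.norm_exp, hg, hg, hℓ]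
  let F : unitInterval → ℝ := fun t ↦ (g t * starRingEnd ℂ (u t)).im
  have hF_cont : Continuous F :=
    Complex.continuous_im.comp (g.continuous.mul (Complex.continuous_conj.comp hu_cont))
  have hF_zero : F 0 = -(g 0).re := by simp [F, hu_zero]
  have hF_one : F 1 = (g 0).re := by simp [F, hu_one, hre]
  obtain ⟨t, ht⟩ : ∃ t, F t = 0 := by
    rcases le_total (g 0).re 0 with h | h
    · exact mem_range_of_exists_le_of_exists_ge hF_cont ⟨1, by linarith⟩ ⟨0, by linarith⟩
    · exact mem_range_of_exists_le_of_exists_ge hF_cont ⟨0, by linarith⟩ ⟨1, by linarith⟩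
  refine ⟨ℓ t, g t, ?_, by rw [hg, mul_div_cancel₀ _ (hσ0 _)]⟩
  rw [Projectivization.submodule_mk]
  exact mem_span_singleton_of_im_mul_conj_eq_zero (hu t) ht
end

section
/- Let n ≥ 1, let T^n = (ℝ/ℤ)^n be the n-dimensional torus with quotient homomorphism π : ℝ^n → T^n, and let σ : ℝP^{n-1} → T^n be a continuous unoriented Kakeya line configuration in T^n. Then its underlying space is all of T^n; that is, ⋃_{L ∈ ℝP^{n-1}} (σ(L) + π(L)) = T^n. -/
open LinearAlgebra.Projectivization

theorem Polynomial.exists_isRoot_of_odd_natDegree {p : Polynomial ℝ} (hp : Odd p.natDegree) :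
    ∃ x, p.IsRoot x := by
  wlog hl : 0 ≤ p.leadingCoeff generalizing p
  · obtain ⟨x, hx⟩ := this (p := -p) (by simpa using hp) (by simp; linarith)
    exact ⟨x, by simpa using hx⟩
  have hd : 0 < p.degree := Polynomial.natDegree_pos_iff_degree_pos.mp hp.pos
  have h1 := p.tendsto_atTop_of_leadingCoeff_nonneg hd hl
  have hc : (p.comp (-Polynomial.X)).natDegree = p.natDegree := by
    simp [Polynomial.natDegree_comp]
  have h2 := (p.comp (-Polynomial.X)).tendsto_atBot_of_leadingCoeff_nonpos
    (Polynomial.natDegree_pos_iff_degree_pos.mp (hc ▸ hp.pos)) (by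
      rw [Polynomial.leadingCoeff_comp (by simp)]
      simpa [hp.neg_one_pow] using hl)
  obtain ⟨a, ha⟩ := (h1.eventually_ge_atTop 0).exists
  obtain ⟨b, hb⟩ := (h2.eventually_le_atBot 0).exists
  obtain ⟨x, hx⟩ := mem_range_of_exists_le_of_exists_ge p.continuous
    ⟨-b, by simpa using hb⟩ ⟨a, ha⟩
  exact ⟨x, hx⟩

/-- A commuting family of real endomorphisms has a common eigenvector in every invariant subspace
of odd dimension. -/
theorem Module.End.exists_common_eigenvector_of_odd_finrank {ι V : Type*} [AddCommGroup V]
    [Module ℝ V] [FiniteDimensional ℝ V] (T : ι → Module.End ℝ V)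
    (hT : ∀ i j, T i * T j = T j * T i) (W : Submodule ℝ V)
    (hW : ∀ i, ∀ w ∈ W, T i w ∈ W) (hodd : Odd (Module.finrank ℝ W)) :
    ∃ w ∈ W, w ≠ 0 ∧ ∃ χ : ι → ℝ, ∀ i, T i w = χ i • w := by
  induction hd : Module.finrank ℝ W using Nat.strong_induction_on generalizing W with
  | _ d ih =>
  have : Nontrivial W := Module.nontrivial_of_finrank_pos (R := ℝ) hodd.pos
  by_cases hs : ∀ i, ∃ c : ℝ, ∀ w ∈ W, T i w = c • w
  · choose χ hχ using hs
    obtain ⟨w, hw⟩ := exists_ne (0 : W)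
    exact ⟨w, w.2, by simpa using hw, χ, fun i ↦ hχ i w w.2⟩
  push Not at hs
  obtain ⟨i, hi⟩ := hs
  obtain ⟨c, hc⟩ := Polynomial.exists_isRoot_of_odd_natDegree
    (p := ((T i).restrict (hW i)).charpoly) (by rwa [LinearMap.charpoly_natDegree])
  have he := ((Module.End.hasEigenvalue_iff_isRoot_charpoly _ c).2 hc).exists_hasEigenvector
  obtain ⟨u, hu⟩ := he
  have hu1 : T i u = c • (u : V) := congrArg Subtype.val hu.apply_eq_smul
  set g : V →ₗ[ℝ] V := T i - c • LinearMap.id with hg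
  have hcomm : ∀ j x, T j (g x) = g (T j x) := fun j x ↦ by
    simpa [hg] using congrArg (fun f : Module.End ℝ V ↦ f x) (hT j i)
  have hsum := (g.domRestrict W).finrank_range_add_finrank_ker
  have hR : LinearMap.range (g.domRestrict W) = W.map g := by
    ext x; simp
  have hK : Module.finrank ℝ (LinearMap.ker (g.domRestrict W)) =
      Module.finrank ℝ ((LinearMap.ker (g.domRestrict W)).map W.subtype) :=
    (LinearEquiv.finrank_eq (Submodule.equivMapOfInjective _ W.injective_subtype _))
  have hKpos : 0 < Module.finrank ℝ (LinearMap.ker (g.domRestrict W)) := by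
    have : Nontrivial (LinearMap.ker (g.domRestrict W)) :=
      ⟨⟨u, by simp [hg, hu1]⟩, 0, fun h ↦ hu.2 (congrArg Subtype.val h)⟩
    exact Module.finrank_pos
  have hRpos : 0 < Module.finrank ℝ (W.map g) := by
    obtain ⟨w, hw, hne⟩ := hi c
    have : Nontrivial (W.map g) :=
      ⟨⟨g w, w, hw, rfl⟩, 0, fun h ↦ hne (sub_eq_zero.1 (by simpa [hg] using h))⟩
    exact Module.finrank_pos
  rw [hR] at hsum
  rcases Nat.even_or_odd (Module.finrank ℝ (W.map g)) with hev | hod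
  · have hko : Odd (Module.finrank ℝ (LinearMap.ker (g.domRestrict W))) := by
      by_contra h
      rw [Nat.not_odd_iff_even] at h
      exact (Nat.not_odd_iff_even.2 (hev.add h)) (hsum ▸ hodd)
    obtain ⟨w, hw, h⟩ := ih _ (by omega) ((LinearMap.ker (g.domRestrict W)).map W.subtype)
      (by
        rintro j _ ⟨x, hx, rfl⟩
        refine ⟨⟨T j x, hW j _ x.2⟩, ?_, rfl⟩
        have hx' : g x = 0 := by simpa using hx
        simp [← hcomm, hx']) (hK ▸ hko) hK.symm
    obtain ⟨x, -, rfl⟩ := hw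
    exact ⟨_, x.2, h⟩
  · obtain ⟨w, hw, h⟩ := ih _ (by omega) (W.map g)
      (by
        rintro j _ ⟨x, hx, rfl⟩
        exact ⟨T j x, hW j x hx, (hcomm j x).symm⟩) hod rfl
    obtain ⟨x, hx, rfl⟩ := hw
    exact ⟨_, by simpa [hg] using W.sub_mem (hW i x hx) (W.smul_mem c hx), h⟩

section MvPolynomialPerturbation

open MvPolynomial

/-- The product obtained from the monomial `X ^ c` by replacing each factor `X i ^ D` by `f i`. -/
noncomputable def MvPolynomial.replacePow {ι R : Type*} [Fintype ι] [CommRing R] (D : ℕ)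
    (f : ι → MvPolynomial ι R) (c : ι →₀ ℕ) : MvPolynomial ι R :=
  ∏ i, X i ^ (c i % D) * f i ^ (c i / D)

namespace MvPolynomial
variable {ι R S : Type*} [Fintype ι] [CommRing R] [CommRing S] {D : ℕ}

theorem map_replacePow (φ : R →+* S) (f : ι → MvPolynomial ι R) (c : ι →₀ ℕ) :
    map φ (replacePow D f c) = replacePow D (fun i ↦ map φ (f i)) c := by
  simp [replacePow, map_prod]

theorem replacePow_X_pow (c : ι →₀ ℕ) :
    replacePow D (fun i ↦ (X i ^ D : MvPolynomial ι R)) c = monomial c 1 := by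
  classical
  simp only [replacePow, ← pow_mul, ← pow_add, Nat.mod_add_div]
  rw [monomial_eq, Finsupp.prod_fintype _ _ (by simp)]
  simp

theorem mul_replacePow (hD : 0 < D) (f : ι → MvPolynomial ι R) (i : ι) (c : ι →₀ ℕ) :
    f i * replacePow D f c = replacePow D f (c + Finsupp.single i D) := by
  classical
  simp only [replacePow]
  rw [← Finset.mul_prod_erase _ _ (Finset.mem_univ i),
    ← Finset.mul_prod_erase (a := i) _ _ (Finset.mem_univ i)]
  have : ∀ j ∈ Finset.univ.erase i, (c + Finsupp.single i D) j = c j := fun j hj ↦ by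
    simp [Finsupp.single_eq_of_ne (Finset.ne_of_mem_erase hj)]
  rw [Finset.prod_congr rfl (g := fun j ↦ X j ^ (c j % D) * f j ^ (c j / D))
    (s₁ := Finset.univ.erase i) (f := fun j ↦ X j ^ ((c + Finsupp.single i D) j % D) *
      f j ^ ((c + Finsupp.single i D) j / D)) (fun j hj ↦ by rw [this j hj])]
  simp only [Finsupp.add_apply, Finsupp.single_eq_same, Nat.add_mod_right, Nat.add_div_right _ hD]
  ring

theorem totalDegree_replacePow_le [Nontrivial R] {f : ι → MvPolynomial ι R}
    (hf : ∀ i, (f i).totalDegree ≤ D) (c : ι →₀ ℕ) :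
    (replacePow D f c).totalDegree ≤ c.degree := by
  rw [Finsupp.degree_eq_sum]
  refine (totalDegree_finsetProd _ _).trans (Finset.sum_le_sum fun i _ ↦ ?_)
  calc _ ≤ c i % D + c i / D * D := by
        refine (totalDegree_mul _ _).trans (add_le_add (totalDegree_X_pow _ _).le ?_)
        exact (totalDegree_pow _ _).trans (Nat.mul_le_mul_left _ (hf i))
    _ = c i := by rw [mul_comm, Nat.mod_add_div]

theorem coeff_replacePow_of_degree_lt [Nontrivial R] {f : ι → MvPolynomial ι R}
    (hf : ∀ i, (f i).totalDegree ≤ D) {a c : ι →₀ ℕ} (h : c.degree < a.degree) :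
    coeff a (replacePow D f c) = 0 :=
  coeff_eq_zero_of_totalDegree_lt (lt_of_le_of_lt (totalDegree_replacePow_le hf c) h)

/-- The linear endomorphism sending the monomial `X ^ c` to `replacePow D f c`. -/
noncomputable def replacePowLinear (D : ℕ) (f : ι → MvPolynomial ι R) :
    MvPolynomial ι R →ₗ[R] MvPolynomial ι R :=
  (basisMonomials ι R).constr R (replacePow D f)

@[simp]
theorem replacePowLinear_monomial (f : ι → MvPolynomial ι R) (c : ι →₀ ℕ) (r : R) :
    replacePowLinear D f (monomial c r) = r • replacePow D f c := by
  have : monomial c r = r • basisMonomials ι R c := by simp [smul_monomial]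
  rw [this, map_smul, replacePowLinear, Module.Basis.constr_basis]

theorem mul_replacePowLinear (hD : 0 < D) (f : ι → MvPolynomial ι R) (i : ι)
    (p : MvPolynomial ι R) :
    f i * replacePowLinear D f p = replacePowLinear D f (X i ^ D * p) := by
  induction p using MvPolynomial.induction_on' with
  | monomial c a =>
    rw [X_pow_eq_monomial, monomial_mul, replacePowLinear_monomial, replacePowLinear_monomial,
      mul_smul_comm, mul_replacePow hD, one_mul, add_comm]
  | add p q hp hq => simp only [map_add, mul_add, hp, hq]

instance (m : ℕ) : Finite {c : ι →₀ ℕ // c.degree ≤ m} := Finsupp.finite_of_degree_le m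

noncomputable instance (m : ℕ) : Fintype {c : ι →₀ ℕ // c.degree ≤ m} := Fintype.ofFinite _

/-- The matrix of `replacePowLinear D f` truncated to the monomials of degree at most `m`. -/
noncomputable def replacePowMatrix (D : ℕ) (f : ι → MvPolynomial ι R) (m : ℕ) :
    Matrix {c : ι →₀ ℕ // c.degree ≤ m} {c : ι →₀ ℕ // c.degree ≤ m} R :=
  .of fun a b ↦ coeff a.1 (replacePow D f b.1)

section Det

variable [DecidableEq ι]

/-- The determinant of `replacePowMatrix D f m`. -/
noncomputable def replacePowDet (D : ℕ) (f : ι → MvPolynomial ι R) (m : ℕ) : R :=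
  (replacePowMatrix D f m).det

theorem map_replacePowDet (φ : R →+* S) (f : ι → MvPolynomial ι R) (m : ℕ) :
    φ (replacePowDet D f m) = replacePowDet D (fun i ↦ map φ (f i)) m := by
  rw [replacePowDet, RingHom.map_det, replacePowDet]
  congr 1
  ext a b
  simp [replacePowMatrix, ← map_replacePow, coeff_map]

theorem replacePowDet_X_pow (m : ℕ) :
    replacePowDet D (fun i ↦ (X i ^ D : MvPolynomial ι R)) m = 1 := by
  rw [replacePowDet, ← Matrix.det_one (n := {c : ι →₀ ℕ // c.degree ≤ m})]
  congr 1
  ext a b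
  simp [replacePowMatrix, replacePow_X_pow, coeff_monomial, Matrix.one_apply, Subtype.ext_iff, eq_comm]

theorem bijective_replacePowLinear {K : Type*} [Field K] {f : ι → MvPolynomial ι K}
    (hf : ∀ i, (f i).totalDegree ≤ D) (hdet : ∀ m, replacePowDet D f m ≠ 0) :
    Function.Bijective (replacePowLinear D f) := by
  let M (m : ℕ) := replacePowMatrix D f m
  have hM (m : ℕ) : IsUnit (M m).det := isUnit_iff_ne_zero.2 (hdet m)
  refine ⟨(injective_iff_map_eq_zero _).2 fun p hp ↦ ?_, fun p ↦ ?_⟩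
  · have hsum : p = ∑ b : {c : ι →₀ ℕ // c.degree ≤ p.totalDegree},
        monomial b.1 (coeff b.1 p) := by
      ext a
      simp only [coeff_sum, coeff_monomial]
      by_cases ha : a.degree ≤ p.totalDegree
      · rw [Finset.sum_eq_single ⟨a, ha⟩] <;> simp +contextual [Subtype.ext_iff]
      · rw [Finset.sum_eq_zero, coeff_eq_zero_of_totalDegree_lt (not_le.1 ha)]
        rintro ⟨b, hb⟩ -
        refine if_neg ?_
        rintro rfl
        exact ha hb
    have h0 : (M p.totalDegree).mulVec (fun b ↦ coeff b.1 p) = 0 := by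
      ext a
      rw [hsum, map_sum] at hp
      simpa [M, replacePowMatrix, Matrix.mulVec, dotProduct, coeff_sum, mul_comm] using congrArg (coeff a.1) hp
    have h1 := Matrix.eq_zero_of_mulVec_eq_zero (hM _).ne_zero h0
    rw [hsum]
    exact Finset.sum_eq_zero fun b _ ↦ by rw [congrFun h1 b]; simp
  · suffices ∀ c, monomial c (1 : K) ∈ LinearMap.range (replacePowLinear D f) by
      have hp : p ∈ LinearMap.range (replacePowLinear D f) := by
        rw [p.as_sum]
        refine Submodule.sum_mem _ fun c _ ↦ ?_
        have := Submodule.smul_mem _ (coeff c p) (this c)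
        simpa [smul_monomial] using this
      exact hp
    intro c
    refine ⟨∑ b : {e : ι →₀ ℕ // e.degree ≤ c.degree},
      monomial b.1 ((M c.degree)⁻¹ b ⟨c, le_rfl⟩), ?_⟩
    ext a
    simp only [map_sum, replacePowLinear_monomial, coeff_sum, coeff_smul, coeff_monomial]
    by_cases ha : a.degree ≤ c.degree
    · have := congrFun (congrFun (Matrix.mul_nonsing_inv _ (hM c.degree)) ⟨a, ha⟩) ⟨c, le_rfl⟩
      simpa [Matrix.mul_apply, M, replacePowMatrix, Matrix.one_apply, mul_comm, eq_comm] using this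
    · rw [Finset.sum_eq_zero fun b _ ↦ by
        rw [coeff_replacePow_of_degree_lt hf (b.2.trans_lt (not_le.1 ha)), smul_zero]]
      rw [if_neg]
      rintro rfl
      exact ha le_rfl

theorem countable_not_bijective_replacePowLinear (h : ι → MvPolynomial ι ℝ)
    (hh : ∀ i, (h i).totalDegree ≤ D) :
    {ε : ℝ | ¬ Function.Bijective
      (replacePowLinear D fun i ↦ X i ^ D + C ε * h i)}.Countable := by
  let F : ι → MvPolynomial ι (Polynomial ℝ) := fun i ↦
    X i ^ D + C Polynomial.X * map Polynomial.C (h i)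
  have hF (ε : ℝ) (m : ℕ) : (replacePowDet D F m).eval ε =
      replacePowDet D (fun i ↦ X i ^ D + C ε * h i) m := by
    rw [← Polynomial.coe_evalRingHom, map_replacePowDet]
    congr 1
    ext1 i
    have : (Polynomial.evalRingHom ε).comp Polynomial.C = RingHom.id ℝ := by ext; simp
    simp [F, map_map, this, map_id]
  have hne (m : ℕ) : replacePowDet D F m ≠ 0 := fun h0 ↦ by
    have := hF 0 m
    simp [h0, replacePowDet_X_pow] at this
  refine (Set.countable_iUnion fun m ↦
    (Polynomial.finite_setOfPred_isRoot (hne m)).countable).mono fun ε hε ↦ ?_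
  by_contra hcon
  simp only [Set.mem_iUnion, Set.mem_ofPred_eq, not_exists, Polynomial.IsRoot.def] at hcon
  refine hε (bijective_replacePowLinear (fun i ↦ ?_) fun m ↦ hF ε m ▸ hcon m)
  refine (totalDegree_add _ _).trans (max_le (totalDegree_X_pow _ _).le ?_)
  refine (totalDegree_mul _ _).trans ?_
  simpa using hh i

end Det

/-- The coefficients of a polynomial at the monomials with all exponents less than `D`. -/
noncomputable def smallCoeff (K : Type*) [Field K] (ι : Type*) [Fintype ι] (D : ℕ) :
    MvPolynomial ι K →ₗ[K] ((ι → Fin D) → K) :=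
  LinearMap.pi fun a ↦ lcoeff K (Finsupp.equivFunOnFinite.symm fun i ↦ (a i : ℕ))

theorem smallCoeff_surjective (K : Type*) [Field K] (ι : Type*) [Fintype ι] (D : ℕ) :
    Function.Surjective (smallCoeff K ι D) := by
  classical
  intro v
  refine ⟨∑ a, monomial (Finsupp.equivFunOnFinite.symm fun i ↦ (a i : ℕ)) (v a), ?_⟩
  ext a
  have (x : ι → Fin D) : (fun i ↦ (x i : ℕ)) = (fun i ↦ (a i : ℕ)) ↔ x = a :=
    ⟨fun h ↦ _root_.funext fun i ↦ Fin.ext (congrFun h i), fun h ↦ h ▸ rfl⟩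
  simp [smallCoeff, coeff_monomial, this]

theorem mem_span_range_iff_smallCoeff {K : Type*} [Field K] (hD : 0 < D)
    {f : ι → MvPolynomial ι K} (e : MvPolynomial ι K ≃ₗ[K] MvPolynomial ι K)
    (he : ∀ p, e p = replacePowLinear D f p) (p : MvPolynomial ι K) :
    smallCoeff K ι D (e.symm p) = 0 ↔ p ∈ Ideal.span (Set.range f) := by
  classical
  constructor
  · intro h
    have hp : p = e (e.symm p) := by simp
    rw [hp, he]
    set q := e.symm p
    rw [q.as_sum, map_sum]
    refine Ideal.sum_mem _ fun c hc ↦ ?_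
    rw [replacePowLinear_monomial]
    refine Submodule.smul_of_tower_mem _ _ ?_
    have : ∃ i, D ≤ c i := by
      by_contra! hcon
      have := congrFun h fun i ↦ ⟨c i, hcon i⟩
      refine mem_support_iff.1 hc ?_
      simpa [smallCoeff] using this
    obtain ⟨i, hi⟩ := this
    refine Ideal.mem_of_dvd _ ?_ (Ideal.subset_span ⟨i, rfl⟩)
    exact ((dvd_pow_self _ (Nat.div_pos hi hD).ne').mul_left _).trans
      (Finset.dvd_prod_of_mem _ (Finset.mem_univ i))
  · intro h
    obtain ⟨g, rfl⟩ := Ideal.mem_span_range_iff_exists_fun.1 h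
    rw [map_sum, map_sum]
    refine Finset.sum_eq_zero fun i _ ↦ ?_
    have : e.symm (g i * f i) = X i ^ D * e.symm (g i) := by
      rw [LinearEquiv.symm_apply_eq, he, ← mul_replacePowLinear hD, ← he]
      simp [mul_comm]
    rw [this]
    ext a
    simp only [smallCoeff, LinearMap.pi_apply, lcoeff_apply, X_pow_eq_monomial,
      coeff_monomial_mul', Pi.zero_apply]
    rw [if_neg]
    intro hle
    have := hle i
    simp at this
    omega

/-- The quotient by polynomials `f i` obtained by a nondegenerate deformation of `X i ^ D` has a
basis indexed by the monomials with all exponents less than `D`. -/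
theorem nonempty_quotient_linearEquiv {K : Type*} [Field K] (hD : 0 < D)
    {f : ι → MvPolynomial ι K} (hf : Function.Bijective (replacePowLinear D f)) :
    Nonempty ((MvPolynomial ι K ⧸ Ideal.span (Set.range f)) ≃ₗ[K] ((ι → Fin D) → K)) := by
  let e := LinearEquiv.ofBijective _ hf
  let g := smallCoeff K ι D ∘ₗ e.symm.toLinearMap
  have hg : Function.Surjective g := (smallCoeff_surjective K ι D).comp e.symm.surjective
  have hk : (Ideal.span (Set.range f)).restrictScalars K = LinearMap.ker g := by
    ext p
    exact (mem_span_range_iff_smallCoeff hD e (fun _ ↦ rfl) p).symm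
  exact ⟨(Submodule.Quotient.restrictScalarsEquiv K _).symm ≪≫ₗ
    Submodule.quotEquivOfEq _ _ hk ≪≫ₗ g.quotKerEquivOfSurjective hg⟩
end MvPolynomial

namespace MvPolynomial

theorem mem_idealOfVars_iff_constantCoeff {ι R : Type*} [CommRing R] (p : MvPolynomial ι R) :
    p ∈ idealOfVars ι R ↔ constantCoeff p = 0 := by
  have := mem_pow_idealOfVars_iff' (σ := ι) (R := R) 1 p
  rw [pow_one] at this
  simp [this, Finsupp.degree_eq_zero_iff, constantCoeff_eq]

/-- An even-dimensional quotient of a real polynomial ring in which the origin is a reduced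
point has another real point. -/
theorem exists_ne_zero_eval_eq_zero_of_even_finrank {ι A : Type*} [Finite ι] [CommRing A]
    [Algebra ℝ A] [FiniteDimensional ℝ A] (hA : Even (Module.finrank ℝ A))
    (π : MvPolynomial ι ℝ →ₐ[ℝ] A) (hπ : Function.Surjective π)
    (hker : RingHom.ker π ≤ idealOfVars ι ℝ)
    (hX : ∀ i, π (X i) ∈ (idealOfVars ι ℝ).map π ^ 2) :
    ∃ x : ι → ℝ, x ≠ 0 ∧ ∀ p, π p = 0 → eval x p = 0 := by
  set m : Ideal A := (idealOfVars ι ℝ).map π with hmdef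
  have hm (p) : π p ∈ m ↔ p ∈ idealOfVars ι ℝ := by
    rw [← Ideal.mem_comap, hmdef, Ideal.comap_map_of_surjective' π hπ, sup_eq_left.2 hker]
  have hmodd : Odd (Module.finrank ℝ (m.restrictScalars ℝ)) := by
    have hq : Module.finrank ℝ (A ⧸ m.restrictScalars ℝ) = 1 := by
      refine _root_.finrank_eq_one (Submodule.Quotient.mk 1) ?_ fun a ↦ ?_
      · rw [Ne, Submodule.Quotient.mk_eq_zero, Submodule.restrictScalars_mem, ← map_one π, hm,
          mem_idealOfVars_iff_constantCoeff]
        simp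
      · obtain ⟨a, rfl⟩ := Submodule.Quotient.mk_surjective _ a
        obtain ⟨p, rfl⟩ := hπ a
        refine ⟨constantCoeff p, ?_⟩
        rw [← Submodule.Quotient.mk_smul, Submodule.Quotient.eq, Submodule.restrictScalars_mem,
          ← map_one π, ← map_smul, ← map_sub, hm, mem_idealOfVars_iff_constantCoeff]
        simp [constantCoeff_smul]
    have := (m.restrictScalars ℝ).finrank_quotient_add_finrank
    rw [hq] at this
    rw [← this, add_comm, Nat.even_add_one, Nat.not_even_iff_odd] at hA
    exact hA
  have hidem : IsIdempotentElem m := by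
    refine le_antisymm Ideal.mul_le_left ?_
    rw [← pow_two]
    nth_rw 1 [hmdef]
    rw [Ideal.map_le_iff_le_comap, Ideal.span_le]
    rintro _ ⟨i, rfl⟩
    exact hX i
  obtain ⟨u, hu, hmu⟩ := (Ideal.isIdempotentElem_iff_of_fg m
    (Ideal.FG.map (idealOfVars_fg ι ℝ) (π : MvPolynomial ι ℝ →+* A))).1 hidem
  obtain ⟨w, hw, hw0, χ, hχ⟩ := Module.End.exists_common_eigenvector_of_odd_finrank
    (fun i ↦ LinearMap.mulLeft ℝ (π (X i))) (fun i j ↦ by ext; simp [mul_left_comm])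
    (m.restrictScalars ℝ) (fun i w hw ↦ m.mul_mem_left _ hw) hmodd
  have hev (p : MvPolynomial ι ℝ) : π p * w = eval χ p • w := by
    induction p using MvPolynomial.induction_on with
    | C a => rw [← algebraMap_eq, AlgHom.commutes, Algebra.smul_def]; simp
    | add p q hp hq => simp [add_mul, add_smul, hp, hq]
    | mul_X p i hp =>
      have := hχ i
      simp only [LinearMap.mulLeft_apply] at this
      rw [map_mul, mul_assoc, this, mul_smul_comm, hp, smul_smul]
      simp [mul_comm]
  refine ⟨χ, ?_, fun p hp ↦ ?_⟩
  · rintro rfl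
    obtain ⟨p, rfl⟩ := hπ u
    have hp : p ∈ idealOfVars ι ℝ := (hm p).1 (by rw [hmu]; exact Ideal.mem_span_singleton_self _)
    have hw' : w ∈ Ideal.span {π p} := by rw [← Ideal.submodule_span_eq, ← hmu]; exact hw
    obtain ⟨a, rfl⟩ := Ideal.mem_span_singleton.1 hw'
    have := hev p
    rw [← mul_assoc, hu.eq, eval_zero, (mem_idealOfVars_iff_constantCoeff p).1 hp,
      zero_smul] at this
    exact hw0 this
  · have := hev p
    rw [hp, zero_mul, eq_comm, smul_eq_zero] at this
    exact this.resolve_right hw0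

/-- A real polynomial system whose solution algebra is a deformation of that of `X i ^ D`, with
`D` even, and which has a simple zero at the origin, has another real zero. -/
theorem exists_ne_zero_eval_eq_zero {ι : Type*} [Fintype ι] [Nonempty ι] {D : ℕ}
    (hD : Even D) (hD0 : 0 < D) {f : ι → MvPolynomial ι ℝ}
    (hf : Function.Bijective (replacePowLinear D f))
    (h0 : ∀ i, f i ∈ idealOfVars ι ℝ)
    (hX : ∀ i, ∃ r : ℝ, X i + r • f i ∈ idealOfVars ι ℝ ^ 2) :
    ∃ x : ι → ℝ, x ≠ 0 ∧ ∀ i, eval x (f i) = 0 := by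
  obtain ⟨e⟩ := nonempty_quotient_linearEquiv hD0 hf
  have : FiniteDimensional ℝ (MvPolynomial ι ℝ ⧸ Ideal.span (Set.range f)) :=
    Module.Finite.equiv e.symm
  have hA : Even (Module.finrank ℝ (MvPolynomial ι ℝ ⧸ Ideal.span (Set.range f))) := by
    classical
    rw [e.finrank_eq]
    simpa using hD.pow_of_ne_zero (Fintype.card_ne_zero (α := ι))
  have hπf (i) : Ideal.Quotient.mkₐ ℝ (Ideal.span (Set.range f)) (f i) = 0 :=
    Ideal.Quotient.eq_zero_iff_mem.2 (Ideal.subset_span ⟨i, rfl⟩)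
  obtain ⟨x, hx, h⟩ := exists_ne_zero_eval_eq_zero_of_even_finrank hA
    (Ideal.Quotient.mkₐ ℝ (Ideal.span (Set.range f))) (Ideal.Quotient.mkₐ_surjective _ _)
    (by
      refine (Ideal.Quotient.mkₐ_ker ℝ (Ideal.span (Set.range f))).le.trans (Ideal.span_le.2 ?_)
      rintro _ ⟨i, rfl⟩
      exact h0 i)
    (fun i ↦ by
      obtain ⟨r, hr⟩ := hX i
      have := Ideal.mem_map_of_mem (Ideal.Quotient.mkₐ ℝ (Ideal.span (Set.range f))) hr
      rwa [Ideal.map_pow, map_add, map_smul, hπf, smul_zero, add_zero] at this)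
  exact ⟨x, hx, fun i ↦ h _ (hπf i)⟩

end MvPolynomial

section SphereApproximation

variable {ι : Type*} [Fintype ι]

theorem MvPolynomial.IsHomogeneous.eval_smul_eq {F : MvPolynomial ι ℝ} {k : ℕ}
    (hF : F.IsHomogeneous k) (r : ℝ) (x : ι → ℝ) : eval (r • x) F = r ^ k * eval x F := by
  rw [eval_eq', eval_eq', Finset.mul_sum]
  refine Finset.sum_congr rfl fun c hc ↦ ?_
  have hk : ∑ i, c i = k := by
    rw [← Finsupp.degree_eq_sum, Finsupp.degree_eq_weight_one]
    exact hF (mem_support_iff.1 hc)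
  simp only [Pi.smul_apply, smul_eq_mul, mul_pow, Finset.prod_mul_distrib,
    Finset.prod_pow_eq_pow_sum, hk]
  ring

theorem MvPolynomial.IsHomogeneous.exists_raise {F : MvPolynomial ι ℝ} {k : ℕ}
    (hF : F.IsHomogeneous k) (e : ℕ) :
    ∃ G : MvPolynomial ι ℝ, G.IsHomogeneous (k + 2 * e) ∧
      ∀ x : ι → ℝ, ∑ i, x i ^ 2 = 1 → eval x G = eval x F := by
  refine ⟨F * (∑ i, X i ^ 2) ^ e, hF.mul (IsHomogeneous.pow (.sum _ _ _ fun i _ ↦ ?_) e), ?_⟩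
  · exact isHomogeneous_X_pow i 2
  · intro x hx
    simp [hx]

/-- On the unit sphere, every polynomial is the sum of a homogeneous polynomial of even degree and
one of odd degree. -/
theorem MvPolynomial.exists_homogeneous_even_add_odd (p : MvPolynomial ι ℝ) :
    ∃ (d : ℕ) (F G : MvPolynomial ι ℝ), F.IsHomogeneous (2 * d) ∧ G.IsHomogeneous (2 * d + 1) ∧
      ∀ x : ι → ℝ, ∑ i, x i ^ 2 = 1 → eval x p = eval x F + eval x G := by
  induction p using MvPolynomial.induction_on with
  | C a =>
    exact ⟨0, C a, 0, isHomogeneous_C _ _, isHomogeneous_zero _ _ _, by simp⟩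
  | add p q hp hq =>
    obtain ⟨d, F, G, hF, hG, h⟩ := hp
    obtain ⟨d', F', G', hF', hG', h'⟩ := hq
    obtain ⟨F₁, hF₁, e₁⟩ := hF.exists_raise d'
    obtain ⟨G₁, hG₁, e₂⟩ := hG.exists_raise d'
    obtain ⟨F₂, hF₂, e₃⟩ := hF'.exists_raise d
    obtain ⟨G₂, hG₂, e₄⟩ := hG'.exists_raise d
    refine ⟨d + d', F₁ + F₂, G₁ + G₂, .add (by convert! hF₁ using 1; ring)
      (by convert! hF₂ using 1; ring), .add (by convert! hG₁ using 1; ring)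
      (by convert! hG₂ using 1; ring), fun x hx ↦ ?_⟩
    simp only [map_add, h x hx, h' x hx, e₁ x hx, e₂ x hx, e₃ x hx, e₄ x hx]
    ring
  | mul_X p i hp =>
    obtain ⟨d, F, G, hF, hG, h⟩ := hp
    obtain ⟨F₁, hF₁, e₁⟩ := hF.exists_raise 1
    refine ⟨d + 1, G * X i, F₁ * X i, hG.mul (isHomogeneous_X ℝ i),
      hF₁.mul (isHomogeneous_X ℝ i), fun x hx ↦ ?_⟩
    simp only [map_mul, h x hx, e₁ x hx]
    ring

theorem EuclideanSpace.sum_sq_eq_one_of_mem_sphere {x : EuclideanSpace ℝ ι}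
    (hx : x ∈ Metric.sphere 0 1) : ∑ i, x i ^ 2 = 1 := by
  rw [← EuclideanSpace.real_norm_sq_eq, mem_sphere_zero_iff_norm.1 hx, one_pow]

/-- An even continuous function on the unit sphere is a uniform limit of homogeneous polynomials of
even degree. -/
theorem exists_homogeneous_near_of_even {v : Metric.sphere (0 : EuclideanSpace ℝ ι) 1 → ℝ}
    (hv : Continuous v) (heven : ∀ x, v (-x) = v x) {η : ℝ} (hη : 0 < η) :
    ∃ (d : ℕ) (F : MvPolynomial ι ℝ), F.IsHomogeneous (2 * d) ∧
      ∀ x : Metric.sphere (0 : EuclideanSpace ℝ ι) 1,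
        |eval (x : EuclideanSpace ℝ ι) F - v x| < η := by
  let coord (i : ι) : C(Metric.sphere (0 : EuclideanSpace ℝ ι) 1, ℝ) :=
    ⟨fun x ↦ (x : EuclideanSpace ℝ ι) i, by fun_prop⟩
  have hcoord (p : MvPolynomial ι ℝ) (x : Metric.sphere (0 : EuclideanSpace ℝ ι) 1) :
      aeval coord p x = eval (x : EuclideanSpace ℝ ι) p := by
    induction p using MvPolynomial.induction_on with
    | C a => simp [← algebraMap_eq]
    | add p q hp hq => simp [hp, hq]
    | mul_X p i hp => simp [hp, coord]
  have hsep : (aeval coord : MvPolynomial ι ℝ →ₐ[ℝ] _).range.SeparatesPoints := by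
    intro x y hxy
    have : ∃ i, (x : EuclideanSpace ℝ ι) i ≠ (y : EuclideanSpace ℝ ι) i := by
      by_contra! h
      exact hxy (Subtype.ext (PiLp.ext h))
    obtain ⟨i, hi⟩ := this
    exact ⟨coord i, ⟨coord i, ⟨X i, by simp⟩, rfl⟩, hi⟩
  obtain ⟨⟨_, p, rfl⟩, hp⟩ := ContinuousMap.exists_mem_subalgebra_near_continuous_of_separatesPoints
    _ hsep v hv η hη
  obtain ⟨d, F, G, hF, hG, h⟩ := p.exists_homogeneous_even_add_odd
  refine ⟨d, F, hF, fun x ↦ ?_⟩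
  have key (x : Metric.sphere (0 : EuclideanSpace ℝ ι) 1) :
      |eval (x : EuclideanSpace ℝ ι) F + eval (x : EuclideanSpace ℝ ι) G - v x| < η := by
    have := hp x
    rw [← h _ (EuclideanSpace.sum_sq_eq_one_of_mem_sphere x.2), ← hcoord]
    simpa using this
  have h1 := key x
  have h2 := key (-x)
  have hn : ((-x : Metric.sphere (0 : EuclideanSpace ℝ ι) 1) : EuclideanSpace ℝ ι).ofLp =
      (-1 : ℝ) • (x : EuclideanSpace ℝ ι).ofLp := by simp
  rw [hn, heven, hF.eval_smul_eq, hG.eval_smul_eq] at h2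
  have hpow : (-1 : ℝ) ^ (2 * d) = 1 := by simp
  rw [pow_succ, hpow] at h2
  rw [abs_lt] at h1 h2 ⊢
  constructor <;> linarith [h1.1, h1.2, h2.1, h2.2]

end SphereApproximation

section EvenTangentField

variable {ι : Type*} [Fintype ι]

theorem exists_homogeneous_family_near_of_even
    {v : Metric.sphere (0 : EuclideanSpace ℝ ι) 1 → EuclideanSpace ℝ ι}
    (hv : Continuous v) (heven : ∀ x, v (-x) = v x) {η : ℝ} (hη : 0 < η) :
    ∃ (d : ℕ) (F : ι → MvPolynomial ι ℝ), 0 < d ∧ (∀ i, (F i).IsHomogeneous (2 * d)) ∧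
      ∀ i, ∀ x : Metric.sphere (0 : EuclideanSpace ℝ ι) 1,
        |eval (x : EuclideanSpace ℝ ι) (F i) - v x i| < η := by
  have h (i : ι) := exists_homogeneous_near_of_even (v := fun x ↦ v x i) (by fun_prop)
    (fun x ↦ by rw [heven]) hη
  choose d F hF hFv using h
  choose G hG hGF using fun i ↦ (hF i).exists_raise (∑ j, d j + 1 - d i)
  refine ⟨∑ j, d j + 1, G, Nat.succ_pos _, fun i ↦ ?_, fun i x ↦ ?_⟩
  · have := Finset.single_le_sum (f := d) (fun _ _ ↦ Nat.zero_le _) (Finset.mem_univ i)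
    convert! hG i using 1
    omega
  · rw [hGF i _ (EuclideanSpace.sum_sq_eq_one_of_mem_sphere x.2)]
    exact hFv i x

/-- A homogeneous polynomial self-map of even degree has, after an arbitrarily small perturbation,
a real eigenvector. -/
theorem exists_eigenvector_perturbation [Nonempty ι] {d : ℕ} (hd : 0 < d)
    {F : ι → MvPolynomial ι ℝ} (hF : ∀ i, (F i).IsHomogeneous (2 * d)) {δ₀ : ℝ} (hδ₀ : 0 < δ₀) :
    ∃ δ, 0 < δ ∧ δ < δ₀ ∧ ∃ (u : Metric.sphere (0 : EuclideanSpace ℝ ι) 1) (c : ℝ),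
      ∀ i, eval (u : EuclideanSpace ℝ ι) (F i) + δ * (u : EuclideanSpace ℝ ι) i ^ (2 * d) =
        c * (u : EuclideanSpace ℝ ι) i := by
  classical
  have hdeg : ∀ i, (F i - X i).totalDegree ≤ 2 * d := fun i ↦ by
    refine (totalDegree_sub _ _).trans (max_le (hF i).totalDegree_le ?_)
    rw [totalDegree_X]
    omega
  obtain ⟨ε, hε, hδε⟩ := ((countable_not_bijective_replacePowLinear _ hdeg).dense_compl
    ℝ).exists_gt δ₀⁻¹
  have hε0 : 0 < ε := (inv_pos.2 hδ₀).trans hδε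
  have hεb := not_not.1 hε
  have hXm (i : ι) : (X i : MvPolynomial ι ℝ) ∈ idealOfVars ι ℝ := Ideal.subset_span ⟨i, rfl⟩
  have hXp (i : ι) : (X i ^ (2 * d) : MvPolynomial ι ℝ) ∈ idealOfVars ι ℝ ^ 2 :=
    Ideal.pow_le_pow_right (by omega) (Ideal.pow_mem_pow (hXm i) _)
  have hFm (i : ι) : F i ∈ idealOfVars ι ℝ ^ 2 := by
    rw [mem_pow_idealOfVars_iff]
    intro c hc
    have := hF i (mem_support_iff.1 hc)
    rw [Finsupp.degree_eq_weight_one]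
    change 2 ≤ Finsupp.weight 1 c
    omega
  have hle : idealOfVars ι ℝ ^ 2 ≤ idealOfVars ι ℝ := Ideal.pow_le_self two_ne_zero
  obtain ⟨x, hx, hfx⟩ := exists_ne_zero_eval_eq_zero (even_two_mul d) (by omega) hεb
    (fun i ↦ Ideal.add_mem _ (hle (hXp i))
      (Ideal.mul_mem_left _ _ (Ideal.sub_mem _ (hle (hFm i)) (hXm i))))
    (fun i ↦ ⟨ε⁻¹, by
      have : X i + ε⁻¹ • (X i ^ (2 * d) + C ε * (F i - X i)) =
          C ε⁻¹ * X i ^ (2 * d) + F i := by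
        have hc : (C ε⁻¹ * C ε : MvPolynomial ι ℝ) = 1 := by
          rw [← C_mul, inv_mul_cancel₀ hε0.ne', C_1]
        rw [smul_eq_C_mul]
        linear_combination (F i - X i) * hc
      rw [this]
      exact Ideal.add_mem _ (Ideal.mul_mem_left _ _ (hXp i)) (hFm i)⟩)
  set y : EuclideanSpace ℝ ι := WithLp.toLp 2 x with hy
  have hr : 0 < ‖y‖ := norm_pos_iff.2 (by simpa [hy] using hx)
  have hxu : x = ‖y‖ • (‖y‖⁻¹ • y).ofLp := by
    rw [← WithLp.ofLp_smul, smul_inv_smul₀ hr.ne']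
  refine ⟨ε⁻¹, inv_pos.2 hε0, inv_lt_of_inv_lt₀ hδ₀ hδε,
    ⟨‖y‖⁻¹ • y, by simp [norm_smul, hr.ne']⟩, ‖y‖ / ‖y‖ ^ (2 * d), fun i ↦ ?_⟩
  have h1 := hfx i
  rw [hxu] at h1
  set u := (‖y‖⁻¹ • y).ofLp with hu
  simp only [map_add, map_mul, map_sub, map_pow, eval_X, eval_C, (hF i).eval_smul_eq,
    Pi.smul_apply, smul_eq_mul, mul_pow] at h1
  have hrd : ‖y‖ ^ (2 * d) ≠ 0 := (pow_pos hr _).ne'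
  field_simp
  linear_combination h1

theorem EuclideanSpace.norm_le_of_forall_abs_le (x : EuclideanSpace ℝ ι) {k : ℝ} (hk : 0 ≤ k)
    (h : ∀ i, |x i| ≤ k) : ‖x‖ ≤ (Fintype.card ι + 1) * k := by
  refine le_of_sq_le_sq ?_ (by positivity)
  rw [EuclideanSpace.real_norm_sq_eq]
  calc ∑ i, x i ^ 2 ≤ ∑ _i : ι, k ^ 2 :=
        Finset.sum_le_sum fun i _ ↦ sq_le_sq' (neg_le_of_abs_le (h i)) (le_of_abs_le (h i))
    _ = Fintype.card ι * k ^ 2 := by simp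
    _ ≤ ((Fintype.card ι + 1) * k) ^ 2 := by
        have : (0 : ℝ) ≤ Fintype.card ι := Nat.cast_nonneg _
        nlinarith [mul_nonneg this (sq_nonneg k),
          mul_nonneg (sq_nonneg (Fintype.card ι : ℝ)) (sq_nonneg k), sq_nonneg k]

/-- An even continuous vector-valued map on the unit sphere is radial at some point. -/
theorem exists_eq_smul_of_even [Nonempty ι]
    {v : Metric.sphere (0 : EuclideanSpace ℝ ι) 1 → EuclideanSpace ℝ ι}
    (hv : Continuous v) (heven : ∀ x, v (-x) = v x) :
    ∃ (u : Metric.sphere (0 : EuclideanSpace ℝ ι) 1) (c : ℝ),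
      v u = c • (u : EuclideanSpace ℝ ι) := by
  by_contra! hcon
  let φ (u : Metric.sphere (0 : EuclideanSpace ℝ ι) 1) : ℝ :=
    ‖v u - inner ℝ (u : EuclideanSpace ℝ ι) (v u) • (u : EuclideanSpace ℝ ι)‖
  have hφ : Continuous φ := by fun_prop
  have : Nonempty (Metric.sphere (0 : EuclideanSpace ℝ ι) 1) :=
    (NormedSpace.sphere_nonempty.2 zero_le_one).to_subtype
  obtain ⟨u₀, -, hu₀⟩ := isCompact_univ.exists_isMinOn Set.univ_nonempty hφ.continuousOn
  have hm : 0 < φ u₀ := norm_pos_iff.2 (sub_ne_zero.2 (hcon u₀ _))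
  have hN : (0 : ℝ) < Fintype.card ι + 1 := by positivity
  set η := φ u₀ / (8 * (Fintype.card ι + 1)) with hη
  have hη0 : 0 < η := by positivity
  obtain ⟨d, F, hd, hF, hFv⟩ := exists_homogeneous_family_near_of_even hv heven hη0
  obtain ⟨δ, hδ, hδη, u, c, hc⟩ := exists_eigenvector_perturbation hd hF hη0
  have hsub : ‖v u - c • (u : EuclideanSpace ℝ ι)‖ ≤ (Fintype.card ι + 1) * (2 * η) := by
    refine EuclideanSpace.norm_le_of_forall_abs_le _ (by positivity) fun i ↦ ?_
    have h1 := hFv i u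
    have hui : |(u : EuclideanSpace ℝ ι) i| ≤ 1 := by
      have := PiLp.norm_apply_le (u : EuclideanSpace ℝ ι) i
      rwa [norm_eq_of_mem_sphere, Real.norm_eq_abs] at this
    have h2 : |(u : EuclideanSpace ℝ ι) i ^ (2 * d)| ≤ 1 := by
      rw [abs_pow]
      exact pow_le_one₀ (abs_nonneg _) hui
    have h3 : |δ * (u : EuclideanSpace ℝ ι) i ^ (2 * d)| ≤ η := by
      rw [abs_mul, abs_of_pos hδ]
      exact (mul_le_of_le_one_right hδ.le h2).trans hδη.le
    simp only [PiLp.sub_apply, PiLp.smul_apply, smul_eq_mul, ← hc i]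
    rw [abs_lt] at h1
    rw [abs_le] at h3 ⊢
    constructor <;> linarith [h1.1, h1.2, h3.1, h3.2]
  have hproj : φ u ≤ 2 * ‖v u - c • (u : EuclideanSpace ℝ ι)‖ := by
    have hu1 : ‖(u : EuclideanSpace ℝ ι)‖ = 1 := norm_eq_of_mem_sphere u
    set z := v u - c • (u : EuclideanSpace ℝ ι) with hz
    have : v u - inner ℝ (u : EuclideanSpace ℝ ι) (v u) • (u : EuclideanSpace ℝ ι) =
        z - inner ℝ (u : EuclideanSpace ℝ ι) z • (u : EuclideanSpace ℝ ι) := by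
      rw [hz, inner_sub_right, inner_smul_right, real_inner_self_eq_norm_sq, hu1, sub_smul]
      simp
    calc φ u = ‖z - inner ℝ (u : EuclideanSpace ℝ ι) z • (u : EuclideanSpace ℝ ι)‖ := by
          rw [← this]
      _ ≤ ‖z‖ + ‖inner ℝ (u : EuclideanSpace ℝ ι) z • (u : EuclideanSpace ℝ ι)‖ := norm_sub_le _ _
      _ ≤ 2 * ‖z‖ := by
          rw [norm_smul, hu1, mul_one, two_mul]
          gcongr
          simpa [hu1] using norm_inner_le_norm (𝕜 := ℝ) (u : EuclideanSpace ℝ ι) z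
  have hmin : φ u₀ ≤ φ u := hu₀ (Set.mem_univ u)
  have hηm : (Fintype.card ι + 1) * (2 * η) = φ u₀ / 4 := by
    rw [hη]
    field_simp
    norm_num
  linarith

end EvenTangentField

end MvPolynomialPerturbation

section Lifting

theorem AddCircle.exists_continuous_lift {A : Type*} [TopologicalSpace A] [SimplyConnectedSpace A]
    [LocallyPathConnectedSpace A] {f : A → AddCircle (1 : ℝ)} (hf : Continuous f) :
    ∃ g : A → ℝ, Continuous g ∧ ∀ a, (g a : AddCircle (1 : ℝ)) = f a := by
  obtain ⟨a₀⟩ : Nonempty A := inferInstance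
  obtain ⟨e₀, he⟩ := QuotientAddGroup.mk_surjective (f a₀)
  obtain ⟨F, ⟨-, hF⟩, -⟩ :=
    (AddCircle.isCoveringMap_coe (1 : ℝ)).existsUnique_continuousMap_lifts ⟨f, hf⟩ a₀ e₀ he
  exact ⟨F, F.continuous, congr_fun hF⟩

theorem IsPreconnected.eq_of_coe_addCircle_eq_zero {A : Type*} [TopologicalSpace A] {s : Set A}
    (hs : IsPreconnected s) {h : A → ℝ} (hh : ContinuousOn h s)
    (h0 : ∀ a ∈ s, (h a : AddCircle (1 : ℝ)) = 0) {a b : A} (ha : a ∈ s) (hb : b ∈ s) :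
    h a = h b :=
  hs.constant_of_mapsTo (T := (AddSubgroup.zmultiples (1 : ℝ) : Set ℝ))
    ⟨inferInstanceAs (DiscreteTopology (AddSubgroup.zmultiples (1 : ℝ)))⟩ hh
    (fun x hx ↦ (QuotientAddGroup.eq_zero_iff (h x)).1 (h0 x hx)) ha hb

variable {E : Type*} [NormedAddCommGroup E] [InnerProductSpace ℝ E]

/-- On a sphere of dimension at least two, an even circle-valued map has an even real lift. -/
theorem exists_even_continuous_lift {n : ℕ} [Fact (Module.finrank ℝ E = n + 1)] (hn : 1 < n)
    {f : Metric.sphere (0 : E) 1 → AddCircle (1 : ℝ)} (hf : Continuous f)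
    (heven : ∀ x, f (-x) = f x) :
    ∃ g : Metric.sphere (0 : E) 1 → ℝ, Continuous g ∧ (∀ x, g (-x) = g x) ∧
      ∀ x, (g x : AddCircle (1 : ℝ)) = f x := by
  have : Nontrivial E := Module.nontrivial_of_finrank_pos (R := ℝ) (by
    rw [Fact.out (p := Module.finrank ℝ E = n + 1)]; exact n.succ_pos)
  obtain ⟨N⟩ : Nonempty (Metric.sphere (0 : E) 1) :=
    (NormedSpace.sphere_nonempty.2 zero_le_one).to_subtype
  have hN : ‖(N : E)‖ = 1 := norm_eq_of_mem_sphere N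
  have hN0 : (N : E) ≠ 0 := ne_zero_of_mem_unit_sphere N
  have hneg (x : Metric.sphere (0 : E) 1) : -x ≠ x := fun h ↦
    ne_neg_of_mem_unit_sphere ℝ x h.symm
  set S := stereographic hN with hS
  have hsource (x : Metric.sphere (0 : E) 1) : x ∈ S.source ↔ x ≠ N := by
    rw [hS, stereographic_source]
    rfl
  have hsymm (w : (ℝ ∙ (N : E))ᗮ) : S.symm w ∈ S.source := S.map_target (by simp [hS])
  obtain ⟨g₀, hg₀, hg₀f⟩ := AddCircle.exists_continuous_lift
    (f := fun w ↦ f (S.symm w)) (hf.comp (continuous_stereoInvFun hN))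
  have hlift {x : Metric.sphere (0 : E) 1} (hx : x ≠ N) : (g₀ (S x) : AddCircle (1 : ℝ)) = f x := by
    rw [hg₀f, S.left_inv ((hsource x).2 hx)]
  have hcont : ContinuousOn (fun x ↦ g₀ (S x)) S.source := hg₀.comp_continuousOn S.continuousOn
  have hSN : S (-N) = 0 := stereographic_apply_neg N
  have hsymm_ne {w : (ℝ ∙ (N : E))ᗮ} (hw : w ≠ 0) : -S.symm w ∈ S.source := by
    rw [hsource]
    intro h
    apply hw
    rw [← S.right_inv (x := w) (by simp [hS]), ← neg_neg (S.symm w), h, hSN]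
  have hconn : IsConnected ({0}ᶜ : Set (ℝ ∙ (N : E))ᗮ) := by
    refine isConnected_compl_singleton_of_one_lt_rank ?_ 0
    have := Module.finite_of_finrank_pos (R := ℝ) (M := E) (by
      rw [Fact.out (p := Module.finrank ℝ E = n + 1)]; exact n.succ_pos)
    rw [← Module.finrank_eq_rank, Submodule.finrank_orthogonal_span_singleton (n := n) hN0]
    exact_mod_cast hn
  let h (w : (ℝ ∙ (N : E))ᗮ) : ℝ := g₀ (S (-S.symm w)) - g₀ (S (S.symm w))
  have hh : ContinuousOn h {0}ᶜ := by
    have hsc : Continuous S.symm := continuous_stereoInvFun hN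
    exact (hcont.comp (hsc.neg).continuousOn fun w hw ↦ hsymm_ne hw).sub
      (hcont.comp hsc.continuousOn fun w _ ↦ hsymm w)
  have hh0 : ∀ w ∈ ({0}ᶜ : Set (ℝ ∙ (N : E))ᗮ), (h w : AddCircle (1 : ℝ)) = 0 := fun w hw ↦ by
    rw [AddCircle.coe_sub, hlift ((hsource _).1 (hsymm_ne hw)),
      hlift ((hsource _).1 (hsymm w)), heven, sub_self]
  have hSne {x : Metric.sphere (0 : E) 1} (hx : x ≠ N) (hx' : -x ≠ N) :
      S x ∈ ({0}ᶜ : Set (ℝ ∙ (N : E))ᗮ) := fun h0 ↦ by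
    rw [Set.mem_singleton_iff, ← hSN] at h0
    have := S.injOn ((hsource _).2 hx) ((hsource _).2 (hneg N)) h0
    exact hx' (by rw [this, neg_neg])
  have heq {x : Metric.sphere (0 : E) 1} (hx : x ≠ N) (hx' : -x ≠ N) :
      g₀ (S (-x)) = g₀ (S x) := by
    have := hconn.isPreconnected.eq_of_coe_addCircle_eq_zero hh hh0 (hSne hx hx')
      (hSne hx' (by rwa [neg_neg]))
    simp only [h, S.left_inv ((hsource _).2 hx), S.left_inv ((hsource _).2 hx'), neg_neg] at this
    linarith
  classical
  let g (x : Metric.sphere (0 : E) 1) : ℝ := if x = N then g₀ (S (-x)) else g₀ (S x)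
  have hg1 {x : Metric.sphere (0 : E) 1} (hx : x ≠ N) : g x = g₀ (S x) := if_neg hx
  have hg2 {x : Metric.sphere (0 : E) 1} (hx : -x ≠ N) : g x = g₀ (S (-x)) := by
    by_cases hxN : x = N
    · exact if_pos hxN
    · rw [hg1 hxN, heq hxN hx]
  have hcases (x : Metric.sphere (0 : E) 1) : x ≠ N ∨ -x ≠ N := by
    by_contra! hc
    exact hneg x (hc.2.trans hc.1.symm)
  have hopen : IsOpen {x : Metric.sphere (0 : E) 1 | x ≠ N} := isOpen_ne
  refine ⟨g, continuous_iff_continuousAt.2 fun x ↦ ?_, fun x ↦ ?_, fun x ↦ ?_⟩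
  · rcases hcases x with hx | hx
    · refine (hcont.continuousAt (S.open_source.mem_nhds ((hsource x).2 hx))).congr ?_
      filter_upwards [hopen.mem_nhds hx] with z hz using (hg1 hz).symm
    · refine ((hcont.continuousAt (S.open_source.mem_nhds ((hsource _).2 hx))).comp
        (f := fun x ↦ -x) continuous_neg.continuousAt).congr ?_
      filter_upwards [(hopen.preimage continuous_neg).mem_nhds hx] with z hz using (hg2 hz).symm
  · rcases hcases x with hx | hx
    · rw [hg1 hx, hg2 (by rwa [neg_neg]), neg_neg]
    · rw [hg1 hx, hg2 hx]
  · rcases hcases x with hx | hx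
    · rw [hg1 hx, hlift hx]
    · rw [hg2 hx, hlift hx, heven]

end Lifting

section Kakeya

/-- A planar curve `g` with `g (θ + π) - g θ` constant is radial at some angle. -/
theorem exists_radial_angle {g : ℝ → ℝ × ℝ} (hg : Continuous g) {c : ℝ × ℝ}
    (hc : ∀ θ, g (θ + Real.pi) - g θ = c) :
    ∃ θ r : ℝ, g θ = (r * Real.cos θ, r * Real.sin θ) := by
  let φ (θ : ℝ) : ℝ := Real.cos θ * (g θ).2 - Real.sin θ * (g θ).1
  have hφ : Continuous φ := by fun_prop
  let α : ℝ := (⟨c.1, c.2⟩ : ℂ).arg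
  have hα : Real.cos α * c.2 - Real.sin α * c.1 = 0 := by
    have h1 := Complex.norm_mul_cos_arg ⟨c.1, c.2⟩
    have h2 := Complex.norm_mul_sin_arg ⟨c.1, c.2⟩
    linear_combination Real.sin α * h1 - Real.cos α * h2
  have hanti : φ (α + Real.pi) = -φ α := by
    have h1 : (g (α + Real.pi)).1 = (g α).1 + c.1 := by rw [← hc α, Prod.fst_sub]; ring
    have h2 : (g (α + Real.pi)).2 = (g α).2 + c.2 := by rw [← hc α, Prod.snd_sub]; ring
    simp only [φ, Real.cos_add_pi, Real.sin_add_pi, h1, h2]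
    linear_combination -hα
  obtain ⟨θ, hθ⟩ : ∃ θ, φ θ = 0 := by
    rcases le_total (φ α) 0 with h | h
    · exact mem_range_of_exists_le_of_exists_ge hφ ⟨α, h⟩ ⟨α + Real.pi, by linarith⟩
    · exact mem_range_of_exists_le_of_exists_ge hφ ⟨α + Real.pi, by linarith⟩ ⟨α, h⟩
  refine ⟨θ, Real.cos θ * (g θ).1 + Real.sin θ * (g θ).2, Prod.ext ?_ ?_⟩
  · simp only [φ] at hθ
    linear_combination -Real.sin θ * hθ - (g θ).1 * Real.sin_sq_add_cos_sq θ
  · simp only [φ] at hθ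
    linear_combination Real.cos θ * hθ - (g θ).2 * Real.sin_sq_add_cos_sq θ

/-- An even continuous map from the unit sphere to the torus sends some point `u` into the
one-parameter subgroup generated by `u`. -/
theorem exists_eq_coe_smul_of_even {n : ℕ} (hn : 1 ≤ n)
    {f : Metric.sphere (0 : EuclideanSpace ℝ (Fin n)) 1 → Fin n → AddCircle (1 : ℝ)}
    (hf : Continuous f) (heven : ∀ x, f (-x) = f x) :
    ∃ (u : Metric.sphere (0 : EuclideanSpace ℝ (Fin n)) 1) (c : ℝ), ∀ i,
      f u i = ((c * (u : EuclideanSpace ℝ (Fin n)) i : ℝ) : AddCircle (1 : ℝ)) := by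
  obtain rfl | rfl | hn : n = 1 ∨ n = 2 ∨ 3 ≤ n := by omega
  · obtain ⟨u⟩ : Nonempty (Metric.sphere (0 : EuclideanSpace ℝ (Fin 1)) 1) :=
      (NormedSpace.sphere_nonempty.2 zero_le_one).to_subtype
    obtain ⟨t, ht⟩ := QuotientAddGroup.mk_surjective (f u 0)
    have hu : (u : EuclideanSpace ℝ (Fin 1)) 0 ≠ 0 := fun h ↦
      ne_zero_of_mem_unit_sphere u (by ext i; rwa [Subsingleton.elim i 0])
    refine ⟨u, t / (u : EuclideanSpace ℝ (Fin 1)) 0, fun i ↦ ?_⟩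
    rw [Subsingleton.elim i 0, div_mul_cancel₀ _ hu, ← ht]
  · let p (θ : ℝ) : Metric.sphere (0 : EuclideanSpace ℝ (Fin 2)) 1 :=
      ⟨!₂[Real.cos θ, Real.sin θ], by simp [EuclideanSpace.norm_eq]⟩
    have hp : Continuous p := Continuous.subtype_mk (by fun_prop) _
    have hpi (θ : ℝ) : f (p (θ + Real.pi)) = f (p θ) := by
      rw [← heven (p θ)]
      congr 1
      ext i
      fin_cases i <;> simp [p]
    obtain ⟨g₀, hg₀, hgf₀⟩ := AddCircle.exists_continuous_lift
      (f := fun θ ↦ f (p θ) 0) (by fun_prop)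
    obtain ⟨g₁, hg₁, hgf₁⟩ := AddCircle.exists_continuous_lift
      (f := fun θ ↦ f (p θ) 1) (by fun_prop)
    obtain ⟨θ, r, h⟩ := exists_radial_angle (g := fun θ ↦ (g₀ θ, g₁ θ)) (by fun_prop)
      (c := (g₀ (0 + Real.pi) - g₀ 0, g₁ (0 + Real.pi) - g₁ 0)) fun θ ↦ Prod.ext
        (isPreconnected_univ.eq_of_coe_addCircle_eq_zero (h := fun θ ↦ g₀ (θ + Real.pi) - g₀ θ)
          (by fun_prop) (fun a _ ↦ by rw [AddCircle.coe_sub, hgf₀, hgf₀, hpi, sub_self])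
          (Set.mem_univ _) (Set.mem_univ _))
        (isPreconnected_univ.eq_of_coe_addCircle_eq_zero (h := fun θ ↦ g₁ (θ + Real.pi) - g₁ θ)
          (by fun_prop) (fun a _ ↦ by rw [AddCircle.coe_sub, hgf₁, hgf₁, hpi, sub_self])
          (Set.mem_univ _) (Set.mem_univ _))
    refine ⟨p θ, r, Fin.forall_fin_two.2 ⟨?_, ?_⟩⟩
    · rw [← hgf₀, show g₀ θ = _ from congr_arg Prod.fst h]
      simp [p]
    · rw [← hgf₁, show g₁ θ = _ from congr_arg Prod.snd h]
      simp [p]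
  · obtain ⟨m, rfl⟩ : ∃ m, n = m + 1 := ⟨n - 1, by omega⟩
    have : Fact (Module.finrank ℝ (EuclideanSpace ℝ (Fin (m + 1))) = m + 1) := ⟨by simp⟩
    choose g hg hge hgf using fun i ↦ exists_even_continuous_lift (n := m) (by omega)
      (f := fun x ↦ f x i) (by fun_prop) (fun x ↦ by rw [heven])
    obtain ⟨u, c, h⟩ := exists_eq_smul_of_even (v := fun x ↦ WithLp.toLp 2 fun i ↦ g i x)
      (by fun_prop) (fun x ↦ by simp only [hge])
    refine ⟨u, c, fun i ↦ ?_⟩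
    rw [← hgf i u]
    exact congr_arg _ (congr_arg (fun x : EuclideanSpace ℝ (Fin (m + 1)) ↦ x i) h)

theorem Projectivization.continuous_mk_sphere {n : ℕ} :
    Continuous fun x : Metric.sphere (0 : EuclideanSpace ℝ (Fin n)) 1 ↦
      Projectivization.mk ℝ (x : EuclideanSpace ℝ (Fin n)) (ne_zero_of_mem_unit_sphere x) :=
  continuous_quotient_mk'.comp (Continuous.subtype_mk continuous_subtype_val _)

end Kakeya

/-- The underlying space of a continuous unoriented Kakeya line configuration in the `n`-torus
`T^n = (ℝ/ℤ)^n` is all of `T^n`.  Here `π : ℝ^n → T^n` is the coordinatewise quotient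
homomorphism. -/
theorem torus_underlying_space_eq_univ (n : ℕ) (hn : 1 ≤ n)
    (π : EuclideanSpace ℝ (Fin n) → (Fin n → AddCircle (1 : ℝ)))
    (hπ : ∀ (x : EuclideanSpace ℝ (Fin n)) (i : Fin n), π x i = (x i : AddCircle (1 : ℝ)))
    (σ : ℙ ℝ (EuclideanSpace ℝ (Fin n)) → (Fin n → AddCircle (1 : ℝ)))
    (hσ : Continuous σ) :
    (⋃ L : ℙ ℝ (EuclideanSpace ℝ (Fin n)),
        {y : Fin n → AddCircle (1 : ℝ) | ∃ x ∈ L.submodule, y = σ L + π x}) = Set.univ := by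
  refine Set.eq_univ_of_forall fun y ↦ ?_
  obtain ⟨u, c, hu⟩ := exists_eq_coe_smul_of_even hn
    (f := fun x ↦ y - σ (Projectivization.mk ℝ x (ne_zero_of_mem_unit_sphere x)))
    (continuous_const.sub (hσ.comp Projectivization.continuous_mk_sphere)) fun x ↦ by
      congr 2
      exact (Projectivization.mk_eq_mk_iff' _ _ _ _ _).2 ⟨-1, by simp⟩
  refine Set.mem_iUnion.2 ⟨Projectivization.mk ℝ u (ne_zero_of_mem_unit_sphere u),
    c • (u : EuclideanSpace ℝ (Fin n)), ?_, ?_⟩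
  · rw [Projectivization.submodule_mk]
    exact Submodule.smul_mem _ _ (Submodule.mem_span_singleton_self _)
  · funext i
    rw [Pi.add_apply, hπ, PiLp.smul_apply, smul_eq_mul, ← hu i, Pi.sub_apply, add_sub_cancel]
end

section
/- Let k, m ≥ 0 with k + m ≥ 1, let G = ℝ^k × (ℝ/ℤ)^m be a connected abelian Lie group with quotient homomorphism π : ℝ^{k+m} → G (the identity on the first k coordinates and the quotient map ℝ → ℝ/ℤ on the last m coordinates), and let σ : ℝP^{k+m-1} → G be a continuous unoriented Kakeya line configuration in G. Then its underlying space is all of G; that is, ⋃_{L ∈ ℝP^{k+m-1}} (σ(L) + π(L)) = G. -/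
open LinearAlgebra.Projectivization

theorem exists_algHom_real_of_odd_finrank {A : Type*} [CommRing A] [Algebra ℝ A]
    [FiniteDimensional ℝ A] :
    ∀ (d : ℕ) (M : Type*) [AddCommGroup M] [Module ℝ M] [Module A M] [IsScalarTower ℝ A M]
      [FiniteDimensional ℝ M], Module.finrank ℝ M = d → Odd d →
      ∃ φ : A →ₐ[ℝ] ℝ, ∀ a ∈ Module.annihilator A M, φ a = 0 := by
  intro d
  induction d using Nat.strong_induction_on with
  | _ d ih =>
  intro M _ _ _ _ _ hd hodd
  have : Nontrivial M := Module.nontrivial_of_finrank_pos (R := ℝ) (by rw [hd]; exact hodd.pos)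
  have : IsArtinian A M := isArtinian_of_tower ℝ inferInstance
  obtain ⟨N, hN⟩ := IsAtomic.exists_atom (Submodule A M)
  have hs : IsSimpleModule A N := isSimpleModule_iff_isAtom.mpr hN
  obtain ⟨I, hI, ⟨e⟩⟩ := isSimpleModule_iff_quot_maximal.mp hs
  let : Field (A ⧸ I) := Ideal.Quotient.field I
  have hann : ∀ a ∈ Module.annihilator A M, Ideal.Quotient.mk I a = 0 := by
    intro a ha
    have h1 : a • e.symm (Ideal.Quotient.mk I 1) = 0 := by
      apply Subtype.ext
      exact Module.mem_annihilator.mp ha _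
    rw [← map_smul] at h1
    have h2 := (LinearEquiv.map_eq_zero_iff _).mp h1
    rw [← h2, Algebra.smul_def]
    simp
  rcases Real.nonempty_algEquiv_or (A ⧸ I) with ⟨⟨f⟩⟩ | ⟨⟨f⟩⟩
  · refine ⟨f.toAlgHom.comp (Ideal.Quotient.mkₐ ℝ I), fun a ha => ?_⟩
    simp [hann a ha]
  · have hN2 : Module.finrank ℝ N = 2 := by
      rw [(e.restrictScalars ℝ).finrank_eq, f.toLinearEquiv.finrank_eq,
        Complex.finrank_real_complex]
    have hq := Submodule.finrank_quotient_add_finrank (N.restrictScalars ℝ)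
    have hN2' : Module.finrank ℝ (N.restrictScalars ℝ) = 2 := hN2
    have hq' : Module.finrank ℝ (M ⧸ N) + 2 = d := by
      rw [← hd, ← hq, hN2']; rfl
    have hfin : FiniteDimensional ℝ (M ⧸ N) :=
      inferInstanceAs (FiniteDimensional ℝ (M ⧸ (N.restrictScalars ℝ)))
    obtain ⟨φ, hφ⟩ := ih (d - 2) (by omega) (M ⧸ N) (by omega) (by
      rcases hodd with ⟨r, hr⟩
      exact ⟨r - 1, by omega⟩)
    refine ⟨φ, fun a ha => hφ a ?_⟩
    rw [Module.mem_annihilator] at ha ⊢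
    intro m
    obtain ⟨m, rfl⟩ := Submodule.Quotient.mk_surjective N m
    rw [← Submodule.Quotient.mk_smul, ha, Submodule.Quotient.mk_zero]

theorem MvPolynomial.exists_basis_of_det_ne_zero {σ K : Type*} [Finite σ] [DecidableEq σ] [Field K]
    (b : (σ →₀ ℕ) → MvPolynomial σ K) (hb : ∀ γ, (b γ).totalDegree ≤ γ.degree)
    (hdet : ∀ e : ℕ, (Matrix.of fun γ δ : (Finsupp.finite_of_degree_le (σ := σ) e).toFinset =>
      (b γ).coeff δ).det ≠ 0) :
    ∃ B : Module.Basis (σ →₀ ℕ) K (MvPolynomial σ K), ∀ γ, B γ = b γ := by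
  classical
  have hexp : ∀ (e : ℕ) (γ : σ →₀ ℕ), γ.degree ≤ e →
      b γ = ∑ δ : (Finsupp.finite_of_degree_le (σ := σ) e).toFinset,
        MvPolynomial.monomial (δ : σ →₀ ℕ) ((b γ).coeff δ) := by
    intro e γ hγ
    conv_lhs => rw [MvPolynomial.as_sum (b γ)]
    rw [Finset.sum_coe_sort (Finsupp.finite_of_degree_le (σ := σ) e).toFinset
      (fun δ => MvPolynomial.monomial δ ((b γ).coeff δ))]
    refine Finset.sum_subset ?_ ?_
    · intro δ hδ
      have := (MvPolynomial.le_totalDegree hδ).trans ((hb γ).trans hγ)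
      simp only [Set.Finite.mem_toFinset, Set.mem_ofPred_eq]
      exact this
    · intro δ _ hδ
      rw [MvPolynomial.notMem_support_iff.mp hδ, map_zero]
  have hli : LinearIndependent K b := by
    rw [linearIndependent_iff]
    intro l hl
    by_contra hne
    obtain ⟨γ₀, hγ₀⟩ := Finsupp.ne_iff.mp hne
    set e := l.support.sup Finsupp.degree with he
    have hsub : l.support ⊆ (Finsupp.finite_of_degree_le (σ := σ) e).toFinset := by
      intro γ hγ
      simpa using Finset.le_sup (f := Finsupp.degree) hγ
    have hz : Matrix.vecMul (fun γ : (Finsupp.finite_of_degree_le (σ := σ) e).toFinset => l γ)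
        (Matrix.of fun γ δ : (Finsupp.finite_of_degree_le (σ := σ) e).toFinset =>
          (b γ).coeff δ) = 0 := by
      funext δ
      have h1 := congrArg (MvPolynomial.coeff (δ : σ →₀ ℕ)) hl
      rw [Finsupp.linearCombination_apply, Finsupp.sum_of_support_subset _ hsub _ (by simp),
        MvPolynomial.coeff_sum, ← Finset.sum_coe_sort] at h1
      simpa [Matrix.vecMul, dotProduct] using h1
    have h0 := Matrix.eq_zero_of_vecMul_eq_zero (hdet e) hz
    have := congrFun h0 ⟨γ₀, hsub (by simpa using hγ₀)⟩
    exact hγ₀ (by simpa using this)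
  have hsp : ⊤ ≤ Submodule.span K (Set.range b) := by
    intro p _
    rw [MvPolynomial.as_sum p]
    refine Submodule.sum_mem _ fun δ₀ _ => ?_
    rw [← mul_one (MvPolynomial.coeff δ₀ p), ← smul_eq_mul, ← MvPolynomial.smul_monomial]
    refine Submodule.smul_mem _ _ ?_
    set e := δ₀.degree
    set M := (Matrix.of fun γ δ : (Finsupp.finite_of_degree_le (σ := σ) e).toFinset =>
          (b γ).coeff δ) with hM
    let d₀ : (Finsupp.finite_of_degree_le (σ := σ) e).toFinset := ⟨δ₀, by simp [e]⟩
    have hinv : M⁻¹ * M = 1 := Matrix.nonsing_inv_mul _ (isUnit_iff_ne_zero.mpr (hdet e))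
    have : MvPolynomial.monomial δ₀ (1 : K) = ∑ γ, M⁻¹ d₀ γ • b γ := by
      calc MvPolynomial.monomial δ₀ (1 : K)
          = ∑ δ : (Finsupp.finite_of_degree_le (σ := σ) e).toFinset,
              MvPolynomial.monomial (δ : σ →₀ ℕ) ((1 : Matrix _ _ K) d₀ δ) := by
            rw [Finset.sum_eq_single d₀]
            · simp [d₀]
            · intro δ _ hδ
              rw [Matrix.one_apply_ne (Ne.symm hδ), map_zero]
            · simp
        _ = ∑ δ : (Finsupp.finite_of_degree_le (σ := σ) e).toFinset, ∑ γ,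
              MvPolynomial.monomial (δ : σ →₀ ℕ) (M⁻¹ d₀ γ * M γ δ) := by
            refine Finset.sum_congr rfl fun δ _ => ?_
            rw [← map_sum, ← hinv, Matrix.mul_apply]
        _ = _ := by
            rw [Finset.sum_comm]
            refine Finset.sum_congr rfl fun γ _ => ?_
            rw [hexp e γ ((Finsupp.finite_of_degree_le e).mem_toFinset.mp γ.2), Finset.smul_sum]
            simp [hM, MvPolynomial.smul_monomial]
    rw [this]
    exact Submodule.sum_mem _ fun γ _ => Submodule.smul_mem _ _ (Submodule.subset_span ⟨_, rfl⟩)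
  exact ⟨Module.Basis.mk hli hsp, fun γ => by simp⟩

open Polynomial in
theorem MvPolynomial.exists_countable_forall_exists_basis {σ : Type*} [Finite σ]
    (B : (σ →₀ ℕ) → MvPolynomial σ ℝ[X]) (hB : ∀ γ, (B γ).totalDegree ≤ γ.degree)
    (hB0 : ∀ γ, MvPolynomial.map (Polynomial.evalRingHom 0) (B γ) = MvPolynomial.monomial γ 1) :
    ∃ Z : Set ℝ, Z.Countable ∧ ∀ s ∉ Z, ∃ b : Module.Basis (σ →₀ ℕ) ℝ (MvPolynomial σ ℝ),
      ∀ γ, b γ = MvPolynomial.map (Polynomial.evalRingHom s) (B γ) := by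
  classical
  set N : ∀ e : ℕ, Matrix (Finsupp.finite_of_degree_le (σ := σ) e).toFinset
    (Finsupp.finite_of_degree_le (σ := σ) e).toFinset ℝ[X] :=
    fun e => Matrix.of fun γ δ => (B γ).coeff δ with hN
  have hmap : ∀ e s, (N e).det.eval s = (Matrix.of fun γ δ :
      (Finsupp.finite_of_degree_le (σ := σ) e).toFinset =>
      (MvPolynomial.map (Polynomial.evalRingHom s) (B γ)).coeff δ).det := by
    intro e s
    rw [← Polynomial.coe_evalRingHom, RingHom.map_det]
    congr 1
  have hne : ∀ e, (N e).det ≠ 0 := by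
    intro e h
    have h1 := hmap e 0
    rw [h, Polynomial.eval_zero] at h1
    have : (Matrix.of fun γ δ : (Finsupp.finite_of_degree_le (σ := σ) e).toFinset =>
      (MvPolynomial.map (Polynomial.evalRingHom 0) (B γ)).coeff δ) = 1 := by
      ext γ δ
      rw [Matrix.of_apply, hB0, MvPolynomial.coeff_monomial, Matrix.one_apply]
      simp only [Subtype.ext_iff]
    rw [this, Matrix.det_one] at h1
    exact zero_ne_one h1
  refine ⟨⋃ e, {s | (N e).det.IsRoot s}, Set.countable_iUnion fun e =>
    (Polynomial.finite_setOfPred_isRoot (hne e)).countable, fun s hs => ?_⟩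
  refine MvPolynomial.exists_basis_of_det_ne_zero _ (fun γ => ?_) fun e => ?_
  · refine le_trans ?_ (hB γ)
    exact Finset.sup_mono (MvPolynomial.support_map_subset _ _)
  · rw [← hmap]
    exact fun h => hs (Set.mem_iUnion.mpr ⟨e, h⟩)

theorem MvPolynomial.finrank_quotient_span_of_basis {σ K : Type*} [Fintype σ] [Field K]
    {D : ℕ} (hD : 0 < D) (q : σ → MvPolynomial σ K)
    (b : Module.Basis (σ →₀ ℕ) K (MvPolynomial σ K))
    (hb : ∀ γ, b γ = ∏ i, (MvPolynomial.X i ^ (γ i % D) * q i ^ (γ i / D))) :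
    FiniteDimensional K (MvPolynomial σ K ⧸ Ideal.span (Set.range q)) ∧
    Module.finrank K (MvPolynomial σ K ⧸ Ideal.span (Set.range q)) = D ^ Fintype.card σ := by
  classical
  let T : MvPolynomial σ K →ₗ[K] ((σ → Fin D) → K) :=
    { toFun := fun p α => b.repr p (Finsupp.equivFunOnFinite.symm fun i => (α i : ℕ))
      map_add' := fun p r => by ext; simp
      map_smul' := fun c p => by ext; simp }
  have hTb : ∀ γ α, T (b γ) α =
      if γ = Finsupp.equivFunOnFinite.symm (fun i => (α i : ℕ)) then 1 else 0 := by
    intro γ α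
    simp [T, Finsupp.single_apply]
  have hsurj : Function.Surjective T := by
    intro v
    refine ⟨∑ α, v α • b (Finsupp.equivFunOnFinite.symm fun i => (α i : ℕ)), ?_⟩
    ext β
    rw [map_sum, Finset.sum_apply, Finset.sum_eq_single β]
    · rw [map_smul, Pi.smul_apply, hTb]; simp
    · intro α _ hα
      rw [map_smul, Pi.smul_apply, hTb, if_neg, smul_zero]
      intro h
      apply hα
      funext i
      exact Fin.ext (congrFun (Finsupp.equivFunOnFinite.symm.injective h) i)
    · simp
  have hmul : ∀ j γ, b γ * q j = b (γ + Finsupp.single j D) := by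
    intro j γ
    rw [hb, hb, ← Finset.mul_prod_erase _ _ (Finset.mem_univ j),
      ← Finset.mul_prod_erase _ _ (Finset.mem_univ j)]
    have : ∀ i ∈ Finset.univ.erase j, (γ + Finsupp.single j D) i = γ i := by
      intro i hi
      simp [(Finset.ne_of_mem_erase hi).symm]
    rw [Finset.prod_congr rfl fun i hi => by rw [← this i hi]]
    simp [Nat.add_div_right _ hD, pow_succ]
    ring
  have hker : (Ideal.span (Set.range q)).restrictScalars K = LinearMap.ker T := by
    apply le_antisymm
    · intro p hp
      rw [Submodule.restrictScalars_mem] at hp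
      refine Submodule.span_induction (p := fun p _ => ∀ r, r * p ∈ LinearMap.ker T) ?_ ?_ ?_ ?_ hp 1
        |> fun h => by simpa using h
      · rintro _ ⟨j, rfl⟩ r
        have h2 : ∀ r, (T ∘ₗ LinearMap.mulRight K (q j)) r = 0 := by
          have : T ∘ₗ LinearMap.mulRight K (q j) = 0 := by
            refine b.ext fun γ => ?_
            ext α
            rw [LinearMap.comp_apply, LinearMap.mulRight_apply, hmul, hTb, if_neg]
            · simp
            · intro h
              have h3 := DFunLike.congr_fun h j
              simp at h3
              have := (α j).2
              omega
          intro r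
          rw [this, LinearMap.zero_apply]
        exact h2 r
      · simp
      · intro x y _ _ hx hy r
        rw [mul_add]
        exact Submodule.add_mem _ (hx r) (hy r)
      · intro a x _ hx r
        rw [smul_eq_mul, ← mul_assoc]
        exact hx _
    · intro p hp
      rw [Submodule.restrictScalars_mem, ← b.linearCombination_repr p,
        Finsupp.linearCombination_apply]
      refine Submodule.sum_mem _ fun γ _ => ?_
      by_cases hγ : ∀ i, γ i < D
      · have h1 := congrFun (LinearMap.mem_ker.mp hp) (fun i => ⟨γ i, hγ i⟩)
        have h2 : b.repr p γ = 0 := by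
          refine Eq.trans ?_ h1
          simp only [T, LinearMap.coe_mk, AddHom.coe_mk]
          congr 1
          ext i; simp
        simp [h2]
      · push Not at hγ
        obtain ⟨j, hj⟩ := hγ
        have : γ = (γ - Finsupp.single j D) + Finsupp.single j D := by
          rw [tsub_add_cancel_of_le]
          simpa using hj
        have hmem : b γ ∈ Ideal.span (Set.range q) := by
          rw [this, ← hmul]
          exact Ideal.mul_mem_left _ _ (Ideal.subset_span ⟨j, rfl⟩)
        simp only [Algebra.smul_def]
        exact Ideal.mul_mem_left _ _ hmem
  let E : (MvPolynomial σ K ⧸ Ideal.span (Set.range q)) ≃ₗ[K] ((σ → Fin D) → K) :=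
    (Submodule.Quotient.restrictScalarsEquiv K (Ideal.span (Set.range q))).symm ≪≫ₗ
      Submodule.quotEquivOfEq _ _ hker ≪≫ₗ T.quotKerEquivOfSurjective hsurj
  refine ⟨E.symm.finiteDimensional, ?_⟩
  rw [E.finrank_eq, Module.finrank_fintype_fun_eq_card]
  simp

theorem MvPolynomial.exists_finrank_quotient_perturbation {σ : Type*} [Fintype σ] {D : ℕ}
    (hD : 0 < D) (G : σ → MvPolynomial σ ℝ) (hG : ∀ i, (G i).totalDegree ≤ D) (r : ℝ) :
    ∃ s > r, FiniteDimensional ℝ (MvPolynomial σ ℝ ⧸ Ideal.span (Set.range fun i =>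
        MvPolynomial.X i ^ D + MvPolynomial.C s * G i)) ∧
      Module.finrank ℝ (MvPolynomial σ ℝ ⧸ Ideal.span (Set.range fun i =>
        MvPolynomial.X i ^ D + MvPolynomial.C s * G i)) = D ^ Fintype.card σ := by
  let Q : σ → MvPolynomial σ (Polynomial ℝ) := fun i => MvPolynomial.X i ^ D +
    MvPolynomial.C Polynomial.X * MvPolynomial.map Polynomial.C (G i)
  have hQ : ∀ i, (Q i).totalDegree ≤ D := by
    intro i
    refine (MvPolynomial.totalDegree_add _ _).trans (max_le (by simp) ?_)
    refine (MvPolynomial.totalDegree_mul _ _).trans ?_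
    rw [MvPolynomial.totalDegree_C, zero_add]
    exact (Finset.sup_mono (MvPolynomial.support_map_subset _ _)).trans (hG i)
  have hQs : ∀ s i, MvPolynomial.map (Polynomial.evalRingHom s) (Q i) =
      MvPolynomial.X i ^ D + MvPolynomial.C s * G i := by
    intro s i
    have : (Polynomial.evalRingHom s).comp Polynomial.C = RingHom.id ℝ := by ext; simp
    simp only [Q, map_add, map_mul, map_pow, MvPolynomial.map_X, MvPolynomial.map_C,
      MvPolynomial.map_map, this, MvPolynomial.map_id, Polynomial.coe_evalRingHom,
      Polynomial.eval_X]
  obtain ⟨Z, hZ, hbasis⟩ := MvPolynomial.exists_countable_forall_exists_basis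
    (fun γ => ∏ i, (MvPolynomial.X i ^ (γ i % D) * Q i ^ (γ i / D)))
    (fun γ => by
      refine (MvPolynomial.totalDegree_finsetProd _ _).trans ?_
      rw [Finsupp.degree_eq_sum]
      refine Finset.sum_le_sum fun i _ => ?_
      refine (MvPolynomial.totalDegree_mul _ _).trans ?_
      rw [MvPolynomial.totalDegree_X_pow]
      calc γ i % D + (Q i ^ (γ i / D)).totalDegree
          ≤ γ i % D + γ i / D * D := by
            gcongr
            exact (MvPolynomial.totalDegree_pow _ _).trans (by gcongr; exact hQ i)
        _ = γ i := Nat.mod_add_div' _ _)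
    (fun γ => by
      simp only [map_prod, map_mul, map_pow, hQs, MvPolynomial.map_X, map_zero, zero_mul,
        add_zero, ← pow_mul, ← pow_add, Nat.mod_add_div]
      rw [MvPolynomial.monomial_eq, map_one, one_mul, Finsupp.prod_fintype _ _ (by simp)])
  obtain ⟨s, hs, hsr⟩ : ∃ s ∉ Z, r < s := by
    by_contra! h
    have : Set.Ioi r ⊆ Z := fun s hs => by
      by_contra hsZ
      exact absurd hs (not_lt.mpr (h s hsZ))
    have hle := Cardinal.le_aleph0_iff_set_countable.mpr (hZ.mono this)
    rw [Cardinal.mk_Ioi_real] at hle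
    exact absurd hle (not_le.mpr Cardinal.aleph0_lt_continuum)
  obtain ⟨b, hb⟩ := hbasis s hs
  exact ⟨s, hsr, MvPolynomial.finrank_quotient_span_of_basis hD _ b fun γ => by
    rw [hb]; simp only [map_prod, map_mul, map_pow, hQs, MvPolynomial.map_X]⟩

theorem MvPolynomial.exists_ne_zero_eval_add_eq {σ : Type*} [Fintype σ] [Nonempty σ] {D : ℕ}
    (hD : 0 < D) (hDe : Even D) (F : σ → MvPolynomial σ ℝ) (hF : ∀ i, (F i).IsHomogeneous D)
    {ε : ℝ} (hε : 0 < ε) :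
    ∃ c, 0 < c ∧ c < ε ∧ ∃ x : σ → ℝ, x ≠ 0 ∧
      ∀ i, MvPolynomial.eval x (F i) + c * x i ^ D = x i := by
  have hD2 : 2 ≤ D := by rcases hDe with ⟨k, hk⟩; omega
  obtain ⟨s, hs, hfin, hrank⟩ := MvPolynomial.exists_finrank_quotient_perturbation hD
    (fun i => F i - MvPolynomial.X i) (fun i => by
      refine (MvPolynomial.totalDegree_sub _ _).trans (max_le (hF i).totalDegree_le ?_)
      rw [MvPolynomial.totalDegree_X]; omega) ε⁻¹
  have hs0 : 0 < s := (inv_pos.mpr hε).trans hs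
  set q : σ → MvPolynomial σ ℝ := fun i =>
    MvPolynomial.X i ^ D + MvPolynomial.C s * (F i - MvPolynomial.X i) with hq
  set J := Ideal.span (Set.range q)
  have hF0 : ∀ i, MvPolynomial.constantCoeff (F i) = 0 := fun i =>
    (hF i).coeff_eq_zero (by simpa using hD.ne)
  have hJ0 : ∀ a ∈ J, MvPolynomial.aeval (0 : σ → ℝ) a = 0 := by
    intro a ha
    have : J ≤ RingHom.ker (MvPolynomial.aeval (R := ℝ) (0 : σ → ℝ)) := by
      rw [Ideal.span_le]
      rintro _ ⟨i, rfl⟩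
      simp [hq, hF0, hD.ne']
    exact this ha
  let ev : (MvPolynomial σ ℝ ⧸ J) →ₐ[ℝ] ℝ := Ideal.Quotient.liftₐ J (MvPolynomial.aeval 0) hJ0
  have hevmk : ∀ p, ev (Ideal.Quotient.mk J p) = MvPolynomial.aeval (0 : σ → ℝ) p := fun p => rfl
  set m := RingHom.ker ev with hm
  have hX : ∀ i, Ideal.Quotient.mk J (MvPolynomial.X i) ∈ m := by
    intro i
    rw [hm, RingHom.mem_ker, hevmk]; simp
  have hvars : (MvPolynomial.idealOfVars σ ℝ).map (Ideal.Quotient.mk J) ≤ m := by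
    rw [Ideal.map_le_iff_le_comap, Ideal.span_le]
    rintro _ ⟨i, rfl⟩
    exact hX i
  have hvars' : m ≤ (MvPolynomial.idealOfVars σ ℝ).map (Ideal.Quotient.mk J) := by
    intro a ha
    obtain ⟨p, rfl⟩ := Ideal.Quotient.mk_surjective a
    refine Ideal.mem_map_of_mem _ ?_
    rw [hm, RingHom.mem_ker, hevmk, MvPolynomial.aeval_zero] at ha
    rw [← pow_one (MvPolynomial.idealOfVars σ ℝ), MvPolynomial.mem_pow_idealOfVars_iff']
    intro d hd
    rw [(Finsupp.degree_eq_zero_iff d).mp (Nat.lt_one_iff.mp hd)]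
    exact ha
  have hsq : ∀ p : MvPolynomial σ ℝ, p.IsHomogeneous D → Ideal.Quotient.mk J p ∈ m ^ 2 := by
    intro p hp
    have : p ∈ MvPolynomial.idealOfVars σ ℝ ^ 2 := by
      rw [MvPolynomial.mem_pow_idealOfVars_iff]
      intro x hx
      exact hD2.trans_eq (hp.degree_eq_sum_deg_support hx)
    have h2 := Ideal.mem_map_of_mem (Ideal.Quotient.mk J) this
    rw [Ideal.map_pow] at h2
    exact Ideal.pow_right_mono hvars 2 h2
  have hXsq : ∀ i, Ideal.Quotient.mk J (MvPolynomial.X i) ∈ m ^ 2 := by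
    intro i
    have h1 : MvPolynomial.X i = (F i + MvPolynomial.C s⁻¹ * MvPolynomial.X i ^ D)
        - MvPolynomial.C s⁻¹ * q i := by
      have : (MvPolynomial.C s⁻¹ : MvPolynomial σ ℝ) * MvPolynomial.C s = 1 := by
        rw [← map_mul, inv_mul_cancel₀ hs0.ne', map_one]
      rw [hq]
      linear_combination (F i - MvPolynomial.X i) * this
    rw [h1, map_sub, Ideal.Quotient.eq_zero_iff_mem.mpr
      (Ideal.mul_mem_left J (MvPolynomial.C s⁻¹) (Ideal.subset_span ⟨i, rfl⟩)), sub_zero]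
    refine hsq _ ((hF i).add ?_)
    have := (MvPolynomial.isHomogeneous_C σ s⁻¹).mul (MvPolynomial.isHomogeneous_X_pow (R := ℝ) i D)
    rwa [zero_add] at this
  have hidem : IsIdempotentElem m := by
    refine le_antisymm Ideal.mul_le_left ?_
    rw [← sq m]
    refine hvars'.trans ?_
    rw [Ideal.map_le_iff_le_comap, Ideal.span_le]
    rintro _ ⟨i, rfl⟩
    exact hXsq i
  have : IsArtinianRing (MvPolynomial σ ℝ ⧸ J) := isArtinian_of_tower ℝ inferInstance
  obtain ⟨e, he, hme⟩ := (Ideal.isIdempotentElem_iff_of_fg m (IsNoetherian.noetherian m)).mp hidem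
  have hodd : Odd (Module.finrank ℝ m) := by
    have h1 := LinearMap.finrank_range_add_finrank_ker ev.toLinearMap
    have hsurj : Function.Surjective ev := fun r => ⟨algebraMap ℝ _ r, by simp⟩
    rw [LinearMap.range_eq_top.mpr hsurj, finrank_top, Module.finrank_self, hrank] at h1
    have h2 : Even (D ^ Fintype.card σ) := hDe.pow_of_ne_zero Fintype.card_ne_zero
    rw [← h1] at h2
    have h3 : Module.finrank ℝ m = Module.finrank ℝ (LinearMap.ker ev.toLinearMap) := rfl
    rw [h3]
    rw [Nat.even_add] at h2
    simpa using h2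
  have hmfin : FiniteDimensional ℝ m :=
    inferInstanceAs (FiniteDimensional ℝ (LinearMap.ker ev.toLinearMap))
  obtain ⟨φ, hφ⟩ := exists_algHom_real_of_odd_finrank (A := MvPolynomial σ ℝ ⧸ J) _ m rfl hodd
  have hφe : φ e = 1 := by
    have : φ (1 - e) = 0 := by
      refine hφ _ (Module.mem_annihilator.mpr ?_)
      rintro ⟨a, ha⟩
      rw [hme] at ha
      obtain ⟨b, rfl⟩ := Ideal.mem_span_singleton'.mp ha
      apply Subtype.ext
      change (1 - e) * (b * e) = 0
      linear_combination (-b) * he.eq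
    rw [map_sub, map_one] at this
    linarith
  let x : σ → ℝ := fun i => φ (Ideal.Quotient.mk J (MvPolynomial.X i))
  have hφx : ∀ p, φ (Ideal.Quotient.mk J p) = MvPolynomial.aeval x p := by
    intro p
    have : φ.comp (Ideal.Quotient.mkₐ ℝ J) = MvPolynomial.aeval x := by
      ext i; simp [x]
    exact DFunLike.congr_fun this p
  refine ⟨s⁻¹, inv_pos.mpr hs0, inv_lt_of_inv_lt₀ hε hs, x, ?_, fun i => ?_⟩
  · intro hx
    obtain ⟨p, rfl⟩ := Ideal.Quotient.mk_surjective e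
    have : Ideal.Quotient.mk J p ∈ m := by rw [hme]; exact Ideal.mem_span_singleton_self _
    rw [hm, RingHom.mem_ker, hevmk, ← hx, ← hφx, hφe] at this
    exact one_ne_zero this
  · have h1 := hφx (q i)
    rw [Ideal.Quotient.eq_zero_iff_mem.mpr (show q i ∈ J from Ideal.subset_span ⟨i, rfl⟩), map_zero] at h1
    simp only [hq, map_add, map_mul, map_sub, map_pow, MvPolynomial.aeval_X,
      MvPolynomial.aeval_C, Algebra.algebraMap_self, RingHom.id_apply] at h1
    have h2 : MvPolynomial.aeval x (F i) = MvPolynomial.eval x (F i) :=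
      DFunLike.congr_fun (MvPolynomial.coe_aeval_eq_eval x) (F i)
    rw [h2] at h1
    field_simp
    linarith

theorem MvPolynomial.IsHomogeneous.eval_smul {σ R : Type*} [Fintype σ] [CommSemiring R] {n : ℕ}
    {p : MvPolynomial σ R} (hp : p.IsHomogeneous n) (r : R) (x : σ → R) :
    MvPolynomial.eval (r • x) p = r ^ n * MvPolynomial.eval x p := by
  rw [MvPolynomial.eval_eq', MvPolynomial.eval_eq', Finset.mul_sum]
  refine Finset.sum_congr rfl fun d hd => ?_
  have hn : ∑ i, d i = n := by
    rw [← Finsupp.degree_eq_sum]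
    exact (hp.degree_eq_sum_deg_support hd).symm
  simp only [Pi.smul_apply, smul_eq_mul, mul_pow, Finset.prod_mul_distrib,
    Finset.prod_pow_eq_pow_sum, hn]
  ring

theorem Finset.sum_range_two_mul_one_add_neg_one_pow (a : ℕ → ℝ) (m : ℕ) :
    ∑ i ∈ Finset.range (2 * m), (1 + (-1) ^ i) * a i = 2 * ∑ j ∈ Finset.range m, a (2 * j) := by
  induction m with
  | zero => simp
  | succ m ih =>
    rw [show 2 * (m + 1) = 2 * m + 1 + 1 by ring, Finset.sum_range_succ, Finset.sum_range_succ,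
      ih, Finset.sum_range_succ, pow_succ, pow_mul]
    norm_num
    ring

theorem MvPolynomial.exists_isHomogeneous_eval_eq_on_sphere {ι : Type*} [Fintype ι]
    (p : MvPolynomial ι ℝ) {d : ℕ} (hd : p.totalDegree ≤ d) :
    ∃ H : MvPolynomial ι ℝ, H.IsHomogeneous (2 * d) ∧ ∀ x : ι → ℝ, ∑ i, x i ^ 2 = 1 →
      MvPolynomial.eval x H =
        (MvPolynomial.eval x p + MvPolynomial.eval (-x) p) / 2 := by
  refine ⟨∑ j ∈ Finset.range (d + 1), (∑ i, MvPolynomial.X i ^ 2) ^ (d - j) *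
    MvPolynomial.homogeneousComponent (2 * j) p, ?_, fun x hx => ?_⟩
  · refine MvPolynomial.IsHomogeneous.sum _ _ _ fun j hj => ?_
    have h1 : (∑ i : ι, MvPolynomial.X (R := ℝ) i ^ 2).IsHomogeneous 2 :=
      MvPolynomial.IsHomogeneous.sum _ _ _ fun i _ => MvPolynomial.isHomogeneous_X_pow i 2
    have h2 := (h1.pow (d - j)).mul (MvPolynomial.homogeneousComponent_isHomogeneous (2 * j) p)
    have h3 : 2 * (d - j) + 2 * j = 2 * d := by
      have := Finset.mem_range.mp hj
      omega
    rwa [h3] at h2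
  · have hsum : ∀ y : ι → ℝ, MvPolynomial.eval y p = ∑ i ∈ Finset.range (2 * (d + 1)),
        MvPolynomial.eval y (MvPolynomial.homogeneousComponent i p) := by
      intro y
      conv_lhs => rw [← MvPolynomial.sum_homogeneousComponent p]
      rw [map_sum]
      refine Finset.sum_subset (Finset.range_mono (by omega)) fun i _ hi => ?_
      rw [MvPolynomial.homogeneousComponent_eq_zero _ _ (by simpa using hi), map_zero]
    have hneg : ∀ i, MvPolynomial.eval (-x) (MvPolynomial.homogeneousComponent i p) =
        (-1) ^ i * MvPolynomial.eval x (MvPolynomial.homogeneousComponent i p) := by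
      intro i
      rw [← (MvPolynomial.homogeneousComponent_isHomogeneous i p).eval_smul, neg_one_smul]
    rw [hsum x, hsum (-x), ← Finset.sum_add_distrib]
    simp only [hneg, ← one_add_mul]
    rw [Finset.sum_range_two_mul_one_add_neg_one_pow
      (fun i => MvPolynomial.eval x (MvPolynomial.homogeneousComponent i p))]
    simp [hx]

theorem MvPolynomial.exists_eval_near_on_sphere {ι : Type*} [Fintype ι]
    (g : EuclideanSpace ℝ ι → ℝ) (hg : ContinuousOn g (Metric.sphere 0 1)) {ε : ℝ} (hε : 0 < ε) :
    ∃ p : MvPolynomial ι ℝ, ∀ x ∈ Metric.sphere (0 : EuclideanSpace ℝ ι) 1,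
      |MvPolynomial.eval x p - g x| < ε := by
  let coord : ι → C(Metric.sphere (0 : EuclideanSpace ℝ ι) 1, ℝ) := fun i =>
    ⟨fun x => x.1 i, by fun_prop⟩
  have heval : ∀ p (x : Metric.sphere (0 : EuclideanSpace ℝ ι) 1),
      (MvPolynomial.aeval coord p) x = MvPolynomial.eval (x : EuclideanSpace ℝ ι) p := by
    intro p x
    have : (ContinuousMap.evalAlgHom ℝ ℝ x).comp (MvPolynomial.aeval coord) =
        MvPolynomial.aeval (x : EuclideanSpace ℝ ι) := by
      ext i; simp [coord]
    exact DFunLike.congr_fun this p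
  obtain ⟨⟨_, p, rfl⟩, hq⟩ := ContinuousMap.exists_mem_subalgebra_near_continuous_of_separatesPoints
    (MvPolynomial.aeval coord : MvPolynomial ι ℝ →ₐ[ℝ] _).range (fun x y hxy => by
      have : ∃ i, x.1 i ≠ y.1 i := by
        by_contra! h
        exact hxy (Subtype.ext (PiLp.ext h))
      obtain ⟨i, hi⟩ := this
      exact ⟨coord i, ⟨coord i, ⟨MvPolynomial.X i, by simp⟩, rfl⟩, hi⟩)
    _ hg.domRestrict ε hε
  refine ⟨p, fun x hx => ?_⟩
  have h1 := hq ⟨x, hx⟩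
  rw [← heval p ⟨x, hx⟩]
  exact h1

theorem EuclideanSpace.exists_approx_eq_smul_of_even {ι : Type*} [Fintype ι] [Nonempty ι]
    (f : EuclideanSpace ℝ ι → EuclideanSpace ℝ ι)
    (hf : ContinuousOn f (Metric.sphere 0 1))
    (heven : ∀ x ∈ Metric.sphere (0 : EuclideanSpace ℝ ι) 1, f (-x) = f x)
    {ε : ℝ} (hε : 0 < ε) :
    ∃ u ∈ Metric.sphere (0 : EuclideanSpace ℝ ι) 1, ∃ a : ℝ, ∀ i, |f u i - a * u i| ≤ 2 * ε := by
  choose p hp using fun i => MvPolynomial.exists_eval_near_on_sphere (fun x => f x i)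
    ((by fun_prop : Continuous fun v : EuclideanSpace ℝ ι => v i).comp_continuousOn hf) hε
  set d := (Finset.univ.sup fun i => (p i).totalDegree) + 1
  choose H hH hHe using fun i => MvPolynomial.exists_isHomogeneous_eval_eq_on_sphere (p i)
    (d := d) ((Finset.le_sup (f := fun i => (p i).totalDegree) (Finset.mem_univ i)).trans
      (Nat.le_succ _))
  have hHf : ∀ x ∈ Metric.sphere (0 : EuclideanSpace ℝ ι) 1, ∀ i,
      |MvPolynomial.eval x (H i) - f x i| ≤ ε := by
    intro x hx i
    have hx' : ∑ i, x i ^ 2 = 1 := by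
      rw [← EuclideanSpace.real_norm_sq_eq, mem_sphere_zero_iff_norm.mp hx, one_pow]
    have h1 := abs_lt.mp (hp i x hx)
    have h2 := abs_lt.mp (hp i (-x) (by simpa using hx))
    rw [heven x hx] at h2
    have h3 : MvPolynomial.eval (-x).ofLp (p i) = MvPolynomial.eval (-x.ofLp) (p i) := rfl
    rw [h3] at h2
    rw [hHe i x hx', abs_le]
    constructor <;> linarith [h1.1, h1.2, h2.1, h2.2]
  obtain ⟨c, hc, hcε, x, hx, hxe⟩ := MvPolynomial.exists_ne_zero_eval_add_eq
    (D := 2 * d) (by omega) (even_two_mul d) H hH hε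
  set y : EuclideanSpace ℝ ι := WithLp.toLp 2 x with hy
  have hy0 : y ≠ 0 := by simpa [hy] using hx
  have hr : 0 < ‖y‖ := norm_pos_iff.mpr hy0
  set u : EuclideanSpace ℝ ι := ‖y‖⁻¹ • y with hu
  have hu1 : u ∈ Metric.sphere (0 : EuclideanSpace ℝ ι) 1 := by
    rw [mem_sphere_zero_iff_norm, hu, norm_smul, norm_inv, norm_norm, inv_mul_cancel₀ hr.ne']
  have hxu : x = ‖y‖ • u.ofLp := by
    rw [hu, WithLp.ofLp_smul, smul_inv_smul₀ hr.ne']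
  refine ⟨u, hu1, ‖y‖ / ‖y‖ ^ (2 * d), fun i => ?_⟩
  have h1 := hxe i
  have h2 : x i = ‖y‖ * u i := congrFun hxu i
  have h3 : MvPolynomial.eval x (H i) = ‖y‖ ^ (2 * d) * MvPolynomial.eval u.ofLp (H i) := by
    rw [← (hH i).eval_smul, ← hxu]
  rw [h3, h2, mul_pow] at h1
  have h4 : ‖y‖ / ‖y‖ ^ (2 * d) * u i = MvPolynomial.eval u.ofLp (H i) + c * u i ^ (2 * d) := by
    have : ‖y‖ ^ (2 * d) ≠ 0 := (pow_pos hr _).ne'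
    rw [div_mul_eq_mul_div, ← h1]
    field_simp
  have h5 : |u i| ≤ 1 := by
    have := PiLp.norm_apply_le u i
    rwa [mem_sphere_zero_iff_norm.mp hu1] at this
  have h6 : |c * u i ^ (2 * d)| ≤ ε := by
    rw [abs_mul, abs_pow, abs_of_pos hc]
    calc c * |u i| ^ (2 * d) ≤ c * 1 := by
          gcongr
          exact pow_le_one₀ (abs_nonneg _) h5
      _ ≤ ε := by linarith
  have h7 := hHf u hu1 i
  rw [h4]
  rw [abs_le] at h6 h7 ⊢
  constructor <;> linarith [h6.1, h6.2, h7.1, h7.2]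

/-- A continuous even map from the unit sphere of `ℝⁿ` to `ℝⁿ` sends some point to a multiple of
itself. -/
theorem EuclideanSpace.exists_eq_smul_of_even {ι : Type*} [Fintype ι] [Nonempty ι]
    (f : EuclideanSpace ℝ ι → EuclideanSpace ℝ ι)
    (hf : ContinuousOn f (Metric.sphere 0 1))
    (heven : ∀ x ∈ Metric.sphere (0 : EuclideanSpace ℝ ι) 1, f (-x) = f x) :
    ∃ u ∈ Metric.sphere (0 : EuclideanSpace ℝ ι) 1, ∃ a : ℝ, f u = a • u := by
  let Φ : EuclideanSpace ℝ ι → ℝ := fun x => ∑ i, |f x i - (∑ k, x k * f x k) * x i|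
  have hfi : ∀ i, ContinuousOn (fun x => f x i) (Metric.sphere 0 1) := fun i =>
    (by fun_prop : Continuous fun v : EuclideanSpace ℝ ι => v i).comp_continuousOn hf
  have hΦ : ContinuousOn Φ (Metric.sphere 0 1) := by
    refine continuousOn_finsetSum _ fun i _ => ContinuousOn.abs ?_
    refine (hfi i).sub (ContinuousOn.mul ?_ (by fun_prop))
    exact continuousOn_finsetSum _ fun k _ => ContinuousOn.mul (by fun_prop) (hfi k)
  obtain ⟨u, hu, hmin⟩ := (isCompact_sphere (0 : EuclideanSpace ℝ ι) 1).exists_isMinOn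
    (NormedSpace.sphere_nonempty.mpr zero_le_one) hΦ
  set N : ℝ := ((Fintype.card ι : ℕ) : ℝ) with hN
  have hN0 : 0 < N := by simp [hN, Fintype.card_pos]
  have hle : ∀ ε > 0, Φ u ≤ N * (2 * ε + N * (2 * ε)) := by
    intro ε hε
    obtain ⟨v, hv, a, ha⟩ := EuclideanSpace.exists_approx_eq_smul_of_even f hf heven hε
    refine (hmin hv).trans ?_
    have hv1 : ∑ i, v i * v i = 1 := by
      have : ∑ i, v i ^ 2 = 1 := by
        rw [← EuclideanSpace.real_norm_sq_eq, mem_sphere_zero_iff_norm.mp hv, one_pow]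
      simpa [sq] using this
    have hvi : ∀ i, |v i| ≤ 1 := fun i => by
      have := PiLp.norm_apply_le v i
      rwa [mem_sphere_zero_iff_norm.mp hv] at this
    have hs : ∑ k, v k * f v k = ∑ k, v k * (f v k - a * v k) + a := by
      have : ∑ k, v k * (f v k - a * v k) = ∑ k, v k * f v k - a * ∑ k, v k * v k := by
        rw [Finset.mul_sum, ← Finset.sum_sub_distrib]
        exact Finset.sum_congr rfl fun k _ => by ring
      rw [this, hv1]; ring
    have hs2 : |∑ k, v k * (f v k - a * v k)| ≤ N * (2 * ε) := by
      refine (Finset.abs_sum_le_sum_abs _ _).trans ?_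
      refine (Finset.sum_le_card_nsmul _ _ (2 * ε) fun k _ => ?_).trans (by simp [hN])
      rw [abs_mul]
      calc |v k| * |f v k - a * v k| ≤ 1 * (2 * ε) := by
            gcongr
            · exact hvi k
            · exact ha k
        _ = 2 * ε := one_mul _
    refine (Finset.sum_le_card_nsmul _ _ (2 * ε + N * (2 * ε)) fun i _ => ?_).trans
      (by rw [nsmul_eq_mul, Finset.card_univ])
    rw [hs, show f v i - (∑ k, v k * (f v k - a * v k) + a) * v i =
      (f v i - a * v i) - (∑ k, v k * (f v k - a * v k)) * v i by ring]
    refine (abs_sub _ _).trans (add_le_add (ha i) ?_)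
    rw [abs_mul]
    calc _ ≤ N * (2 * ε) * 1 := by
          gcongr
          exact hvi i
      _ = _ := mul_one _
  have hzero : Φ u ≤ 0 := by
    refine le_of_forall_pos_le_add fun δ hδ => ?_
    have := hle (δ / (N * (2 + 2 * N))) (by positivity)
    refine this.trans (le_of_eq ?_)
    field_simp
    ring
  refine ⟨u, hu, ∑ k, u k * f u k, PiLp.ext fun i => ?_⟩
  have h0 := (Finset.sum_eq_zero_iff_of_nonneg fun i _ => abs_nonneg _).mp
    (le_antisymm hzero (Finset.sum_nonneg fun i _ => abs_nonneg _)) i (Finset.mem_univ i)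
  simpa [sub_eq_zero] using h0

/-- The quotient homomorphism `ℝ^{k+m} → ℝ^k × (ℝ/ℤ)^m`. -/
def EuclideanSpace.toProdAddCircle (k m : ℕ) :
    EuclideanSpace ℝ (Fin (k + m)) →+ (Fin k → ℝ) × (Fin m → AddCircle (1 : ℝ)) where
  toFun x := (fun i => x (Fin.castAdd m i), fun j => (x (Fin.natAdd k j) : AddCircle (1 : ℝ)))
  map_zero' := rfl
  map_add' _ _ := rfl

namespace EuclideanSpace

theorem toProdAddCircle_apply (k m : ℕ) (x : EuclideanSpace ℝ (Fin (k + m))) :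
    toProdAddCircle k m x =
      (fun i => x (Fin.castAdd m i), fun j => (x (Fin.natAdd k j) : AddCircle (1 : ℝ))) :=
  rfl

theorem toProdAddCircle_surjective (k m : ℕ) : Function.Surjective (toProdAddCircle k m) := by
  rintro ⟨a, b⟩
  choose c hc using fun j => QuotientAddGroup.mk_surjective (b j)
  refine ⟨WithLp.toLp 2 (Fin.append a c), Prod.ext (funext fun i => ?_) (funext fun j => ?_)⟩
  · simp [toProdAddCircle_apply]
  · simpa [toProdAddCircle_apply] using hc j

theorem exists_lift_toProdAddCircle {k m : ℕ} {A : Type*} [TopologicalSpace A]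
    (H : C(unitInterval × A, (Fin k → ℝ) × (Fin m → AddCircle (1 : ℝ))))
    {c : (Fin k → ℝ) × (Fin m → AddCircle (1 : ℝ))} (hc : ∀ a, H (0, a) = c) :
    ∃ f : A → EuclideanSpace ℝ (Fin (k + m)), Continuous f ∧
      ∀ a, toProdAddCircle k m (f a) = H (1, a) := by
  have key : ∀ j : Fin m, ∃ g : A → ℝ, Continuous g ∧
      ∀ a, (g a : AddCircle (1 : ℝ)) = (H (1, a)).2 j := by
    intro j
    obtain ⟨r, hr⟩ := QuotientAddGroup.mk_surjective (c.2 j)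
    have cov := AddCircle.isCoveringMap_coe (1 : ℝ)
    let Hj : C(unitInterval × A, AddCircle (1 : ℝ)) := ⟨fun x => (H x).2 j, by fun_prop⟩
    have h0 : ∀ a, Hj (0, a) = ((ContinuousMap.const A r) a : AddCircle (1 : ℝ)) := fun a => by
      change (H (0, a)).2 j = (r : AddCircle (1 : ℝ))
      rw [hc a]; exact hr.symm
    refine ⟨fun a => cov.liftHomotopy Hj (ContinuousMap.const A r) h0 (1, a), by fun_prop,
      fun a => ?_⟩
    exact congrFun (cov.liftHomotopy_lifts Hj (ContinuousMap.const A r) h0) (1, a)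
  choose g hg hgH using key
  refine ⟨fun a => WithLp.toLp 2 (Fin.append (H (1, a)).1 fun j => g j a), ?_, fun a => ?_⟩
  · refine (PiLp.continuous_toLp 2 _).comp (continuous_pi fun i => ?_)
    refine Fin.addCases (fun i => ?_) (fun j => ?_) i
    · simp only [Fin.append_left]; fun_prop
    · simpa only [Fin.append_right] using hg j
  · refine Prod.ext (funext fun i => ?_) (funext fun j => ?_)
    · simp [toProdAddCircle_apply]
    · simpa [toProdAddCircle_apply] using hgH j a

theorem eq_of_toProdAddCircle_eq_zero {k m : ℕ} {A : Type*} [TopologicalSpace A]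
    [PreconnectedSpace A] {z : A → EuclideanSpace ℝ (Fin (k + m))} (hz : Continuous z)
    (h : ∀ a, toProdAddCircle k m (z a) = 0) (a b : A) : z a = z b := by
  refine PiLp.ext fun i => ?_
  refine Fin.addCases (fun i => ?_) (fun j => ?_) i
  · exact (congrFun (congrArg Prod.fst (h a)) i).trans
      (congrFun (congrArg Prod.fst (h b)) i).symm
  · have h0 : ∀ a, ((z a (Fin.natAdd k j) : ℝ) : AddCircle (1 : ℝ)) = 0 := fun a =>
      congrFun (congrArg Prod.snd (h a)) j
    have := (AddCircle.isCoveringMap_coe (1 : ℝ)).eq_of_comp_eq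
      (g₁ := fun a => z a (Fin.natAdd k j)) (g₂ := fun _ => z b (Fin.natAdd k j))
      (by fun_prop) (by fun_prop) (funext fun a => (h0 a).trans (h0 b).symm) b rfl
    exact congrFun this a

variable {k m : ℕ}
  {τ : EuclideanSpace ℝ (Fin (k + m)) → (Fin k → ℝ) × (Fin m → AddCircle (1 : ℝ))}

theorem exists_eq_toProdAddCircle_smul_of_three_le (hn : 3 ≤ k + m) (hτ : ContinuousOn τ {0}ᶜ)
    (heven : ∀ x, τ (-x) = τ x) : ∃ x ≠ 0, ∃ t : ℝ, τ x = toProdAddCircle k m (t • x) := by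
  let i₀ : Fin (k + m) := ⟨0, by omega⟩
  let A : Set (EuclideanSpace ℝ (Fin (k + m))) := {x | x ≠ 0 ∧ 0 ≤ x i₀}
  have hne : ∀ (t : unitInterval) (a : A),
      (1 - t : ℝ) • EuclideanSpace.single i₀ (1 : ℝ) + (t : ℝ) • (a : EuclideanSpace ℝ _) ∈
        ({0}ᶜ : Set (EuclideanSpace ℝ (Fin (k + m)))) := by
    rintro t ⟨a, ha, ha₀⟩ h
    have h : (1 - t : ℝ) • EuclideanSpace.single i₀ (1 : ℝ) + (t : ℝ) • a = 0 := h
    have h1 : (1 - t : ℝ) + t * a i₀ = 0 := by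
      simpa using congrArg (fun v : EuclideanSpace ℝ (Fin (k + m)) => v i₀) h
    have h2 : (t : ℝ) = 1 := by
      have := mul_nonneg t.2.1 ha₀
      linarith [t.2.2]
    rw [h2] at h
    exact ha (by simpa using h)
  obtain ⟨f, hf, hfτ⟩ := exists_lift_toProdAddCircle
    (A := A) ⟨fun p => τ ((1 - p.1 : ℝ) • EuclideanSpace.single i₀ (1 : ℝ) +
      (p.1 : ℝ) • (p.2 : EuclideanSpace ℝ (Fin (k + m)))),
      hτ.comp_continuous (by fun_prop) fun p => hne p.1 p.2⟩
    (c := τ (EuclideanSpace.single i₀ 1)) (fun a => by simp)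
  have hfτ : ∀ a : A, toProdAddCircle k m (f a) = τ a := fun a => by simpa using hfτ a
  classical
  let f' : EuclideanSpace ℝ (Fin (k + m)) → EuclideanSpace ℝ (Fin (k + m)) :=
    fun x => if h : x ∈ A then f ⟨x, h⟩ else 0
  have hff' : ∀ a : A, f' a = f a := fun a => dif_pos a.2
  have hf'τ : ∀ a ∈ A, toProdAddCircle k m (f' a) = τ a := fun a ha => by
    rw [← hfτ ⟨a, ha⟩, ← hff']
  have hf' : ContinuousOn f' A := by
    rw [continuousOn_iff_continuous_domRestrict]
    convert hf using 1
    exact funext hff'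
  have hsymm : ∀ x, x ≠ 0 → x i₀ = 0 → f' (-x) = f' x := by
    intro x hx hx₀
    obtain ⟨i, hi⟩ : ∃ i, x i ≠ 0 := by
      by_contra! h
      exact hx (PiLp.ext h)
    obtain ⟨l, hl₀, hli⟩ : ∃ l, l ≠ i₀ ∧ l ≠ i := by
      obtain ⟨l, hl⟩ := Finset.exists_mem_notMem_of_card_lt_card
        (s := {i₀, i}) (t := (Finset.univ : Finset (Fin (k + m))))
        (lt_of_le_of_lt Finset.card_le_two (by rw [Finset.card_univ, Fintype.card_fin]; omega))
      simp only [Finset.mem_insert, Finset.mem_singleton, not_or] at hl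
      exact ⟨l, hl.2⟩
    let γ : ℝ → EuclideanSpace ℝ (Fin (k + m)) := fun θ =>
      Real.cos θ • x + Real.sin θ • EuclideanSpace.single l (1 : ℝ)
    have hγ : Continuous γ := by fun_prop
    have hγ0 : ∀ θ, γ θ ≠ 0 := by
      intro θ h
      have h1 : Real.cos θ = 0 := by
        simpa [γ, hli.symm, hi] using congrArg (fun v : EuclideanSpace ℝ (Fin (k + m)) => v i) h
      have h2 : Real.sin θ = 0 := by
        simpa [γ, h1] using congrArg (fun v : EuclideanSpace ℝ (Fin (k + m)) => v l) h
      have := Real.sin_sq_add_cos_sq θ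
      simp [h1, h2] at this
    have hγ₀ : ∀ θ, γ θ i₀ = 0 := fun θ => by simp [γ, hx₀, hl₀.symm]
    have hγA : ∀ θ, γ θ ∈ A := fun θ => ⟨hγ0 θ, (hγ₀ θ).ge⟩
    have hγA' : ∀ θ, -γ θ ∈ A := fun θ => ⟨neg_ne_zero.mpr (hγ0 θ), by simp [hγ₀ θ]⟩
    have hz := eq_of_toProdAddCircle_eq_zero (z := fun θ => f' (-γ θ) - f' (γ θ))
      ((hf'.comp_continuous hγ.neg hγA').sub (hf'.comp_continuous hγ hγA))
      (fun θ => by rw [map_sub, hf'τ _ (hγA' θ), hf'τ _ (hγA θ), heven, sub_self]) 0 Real.pi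
    simp only [γ, Real.cos_zero, Real.sin_zero, Real.cos_pi, Real.sin_pi, zero_smul, add_zero,
      one_smul, neg_smul, neg_neg] at hz
    refine PiLp.ext fun j => ?_
    have := congrArg (fun v : EuclideanSpace ℝ (Fin (k + m)) => v j) hz
    simp only [PiLp.sub_apply] at this
    linarith
  let F : EuclideanSpace ℝ (Fin (k + m)) → EuclideanSpace ℝ (Fin (k + m)) :=
    fun x => if 0 ≤ x i₀ then f' x else f' (-x)
  have hFneg : ∀ x, x ≠ 0 → x i₀ ≤ 0 → F x = f' (-x) := by
    intro x hx hx₀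
    by_cases h : 0 ≤ x i₀
    · rw [hsymm x hx (le_antisymm hx₀ h)]
      exact if_pos h
    · exact if_neg h
  have hFpos : ∀ x, 0 ≤ x i₀ → F x = f' x := fun x h => if_pos h
  have hne_sphere : ∀ x ∈ Metric.sphere (0 : EuclideanSpace ℝ (Fin (k + m))) 1, x ≠ 0 :=
    fun x hx => ne_zero_of_mem_unit_sphere ⟨x, hx⟩
  have hF : ContinuousOn F (Metric.sphere 0 1) := by
    have hcoord : Continuous fun x : EuclideanSpace ℝ (Fin (k + m)) => x i₀ := by fun_prop
    have h1 : ContinuousOn F (Metric.sphere 0 1 ∩ {x | 0 ≤ x i₀}) :=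
      (hf'.mono fun x hx => ⟨hne_sphere x hx.1, hx.2⟩).congr fun x hx => hFpos x hx.2
    have h2 : ContinuousOn F (Metric.sphere 0 1 ∩ {x | x i₀ ≤ 0}) := by
      refine ContinuousOn.congr (f := fun x => f' (-x)) ?_
        fun x hx => hFneg x (hne_sphere x hx.1) hx.2
      exact hf'.comp continuous_neg.continuousOn fun x hx =>
        ⟨neg_ne_zero.mpr (hne_sphere x hx.1), by simpa using hx.2⟩
    have h3 := h1.union_of_isClosed h2
      (Metric.isClosed_sphere.inter (isClosed_le continuous_const hcoord))
      (Metric.isClosed_sphere.inter (isClosed_le hcoord continuous_const))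
    refine h3.mono fun x hx => ?_
    rcases le_total 0 (x i₀) with h | h
    · exact Or.inl ⟨hx, h⟩
    · exact Or.inr ⟨hx, h⟩
  have : Nonempty (Fin (k + m)) := ⟨i₀⟩
  obtain ⟨u, hu, a, hua⟩ := exists_eq_smul_of_even F hF (by
    intro x hx
    rcases le_total 0 (x i₀) with h | h
    · rw [hFneg (-x) (neg_ne_zero.mpr (hne_sphere x hx)) (by simpa using h), neg_neg, hFpos x h]
    · rw [hFpos (-x) (by simpa using h), hFneg x (hne_sphere x hx) h])
  have hu0 := hne_sphere u hu
  refine ⟨u, hu0, a, ?_⟩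
  rw [← hua]
  rcases le_total 0 (u i₀) with h | h
  · rw [hFpos u h, hf'τ u ⟨hu0, h⟩]
  · rw [hFneg u hu0 h, hf'τ (-u) ⟨neg_ne_zero.mpr hu0, by simpa using h⟩, heven]

theorem exists_eq_toProdAddCircle_smul_of_eq_two (hn : k + m = 2) (hτ : ContinuousOn τ {0}ᶜ)
    (heven : ∀ x, τ (-x) = τ x) : ∃ x ≠ 0, ∃ t : ℝ, τ x = toProdAddCircle k m (t • x) := by
  let i₀ : Fin (k + m) := ⟨0, by omega⟩
  let i₁ : Fin (k + m) := ⟨1, by omega⟩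
  have hi : i₀ ≠ i₁ := by simp [i₀, i₁]
  have hcases : ∀ i, i = i₀ ∨ i = i₁ := by
    intro i
    simp only [Fin.ext_iff, i₀, i₁]
    omega
  let γ : ℝ → EuclideanSpace ℝ (Fin (k + m)) := fun θ =>
    Real.cos θ • EuclideanSpace.single i₀ (1 : ℝ) + Real.sin θ • EuclideanSpace.single i₁ (1 : ℝ)
  have hγ : Continuous γ := by fun_prop
  have hγ₀ : ∀ θ, γ θ i₀ = Real.cos θ := fun θ => by simp [γ, hi]
  have hγ₁ : ∀ θ, γ θ i₁ = Real.sin θ := fun θ => by simp [γ, hi.symm]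
  have hγ0 : ∀ θ, γ θ ≠ 0 := by
    intro θ h
    have h1 := hγ₀ θ
    have h2 := hγ₁ θ
    have h3 := Real.sin_sq_add_cos_sq θ
    rw [h] at h1 h2
    simp [← h1, ← h2] at h3
  have hγπ : ∀ θ, γ (θ + Real.pi) = -γ θ := fun θ => by
    simp only [γ, Real.cos_add_pi, Real.sin_add_pi]; module
  obtain ⟨g, hg, hgτ⟩ := exists_lift_toProdAddCircle (A := ℝ)
    ⟨fun p => τ (γ (p.1 * p.2)), hτ.comp_continuous (by fun_prop) fun p => hγ0 _⟩
    (c := τ (γ 0)) (fun a => by simp)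
  have hgτ : ∀ θ, toProdAddCircle k m (g θ) = τ (γ θ) := fun θ => by simpa using hgτ θ
  have hz := eq_of_toProdAddCircle_eq_zero (z := fun θ => g (θ + Real.pi) - g θ) (by fun_prop)
    (fun θ => by rw [map_sub, hgτ, hgτ, hγπ, heven, sub_self])
  obtain ⟨w, hw⟩ : ∃ w : ℂ, w = ⟨(g (0 + Real.pi) - g 0) i₀, (g (0 + Real.pi) - g 0) i₁⟩ := ⟨_, rfl⟩
  set α := w.arg
  have hα₀ : (g (α + Real.pi) - g α) i₀ = ‖w‖ * Real.cos α := by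
    rw [hz α 0, Complex.norm_mul_cos_arg, hw]
  have hα₁ : (g (α + Real.pi) - g α) i₁ = ‖w‖ * Real.sin α := by
    rw [hz α 0, Complex.norm_mul_sin_arg, hw]
  let φ : ℝ → ℝ := fun θ => g θ i₀ * Real.sin θ - g θ i₁ * Real.cos θ
  have hφ : Continuous φ := by fun_prop
  have hφπ : φ (α + Real.pi) = -φ α := by
    simp only [PiLp.sub_apply] at hα₀ hα₁
    simp only [φ, Real.cos_add_pi, Real.sin_add_pi]
    linear_combination (-Real.sin α) * hα₀ + Real.cos α * hα₁
  obtain ⟨θ, hθ⟩ : ∃ θ, φ θ = 0 := by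
    have h := mem_range_of_exists_le_of_exists_ge (c := 0) hφ
    rcases le_total 0 (φ α) with h0 | h0
    · exact h ⟨α + Real.pi, by linarith⟩ ⟨α, h0⟩
    · exact h ⟨α, h0⟩ ⟨α + Real.pi, by linarith⟩
  refine ⟨γ θ, hγ0 θ, g θ i₀ * Real.cos θ + g θ i₁ * Real.sin θ, ?_⟩
  rw [← hgτ]
  congr 1
  have hsc := Real.sin_sq_add_cos_sq θ
  simp only [φ] at hθ
  refine PiLp.ext fun i => ?_
  rcases hcases i with rfl | rfl
  · rw [PiLp.smul_apply, hγ₀, smul_eq_mul]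
    linear_combination Real.sin θ * hθ - g θ i₀ * hsc
  · rw [PiLp.smul_apply, hγ₁, smul_eq_mul]
    linear_combination (-Real.cos θ) * hθ - g θ i₁ * hsc

theorem exists_eq_toProdAddCircle_smul (hn : 1 ≤ k + m) (hτ : ContinuousOn τ {0}ᶜ)
    (heven : ∀ x, τ (-x) = τ x) : ∃ x ≠ 0, ∃ t : ℝ, τ x = toProdAddCircle k m (t • x) := by
  rcases lt_trichotomy (k + m) 2 with h | h | h
  · let i₀ : Fin (k + m) := ⟨0, hn⟩
    refine ⟨EuclideanSpace.single i₀ 1, by simp, ?_⟩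
    obtain ⟨v, hv⟩ := toProdAddCircle_surjective k m (τ (EuclideanSpace.single i₀ 1))
    refine ⟨v i₀, ?_⟩
    rw [← hv]
    congr 1
    refine PiLp.ext fun i => ?_
    obtain rfl : i = i₀ := by
      simp only [Fin.ext_iff, i₀]
      omega
    simp
  · exact exists_eq_toProdAddCircle_smul_of_eq_two h hτ heven
  · exact exists_eq_toProdAddCircle_smul_of_three_le h hτ heven

end EuclideanSpace

/-- The underlying space of a continuous unoriented Kakeya line configuration in the connected
abelian Lie group `G = ℝ^k × (ℝ/ℤ)^m` is all of `G`.  Here `π : ℝ^{k+m} → G` is the identity on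
the first `k` coordinates and the quotient map `ℝ → ℝ/ℤ` on the last `m` coordinates. -/
theorem abelian_lie_group_underlying_space_eq_univ (k m : ℕ) (hkm : 1 ≤ k + m)
    (π : EuclideanSpace ℝ (Fin (k + m)) → (Fin k → ℝ) × (Fin m → AddCircle (1 : ℝ)))
    (hπ : ∀ x : EuclideanSpace ℝ (Fin (k + m)),
      π x = (fun i => x (Fin.castAdd m i), fun j => (x (Fin.natAdd k j) : AddCircle (1 : ℝ))))
    (σ : ℙ ℝ (EuclideanSpace ℝ (Fin (k + m))) → (Fin k → ℝ) × (Fin m → AddCircle (1 : ℝ)))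
    (hσ : Continuous σ) :
    (⋃ L : ℙ ℝ (EuclideanSpace ℝ (Fin (k + m))),
        {y : (Fin k → ℝ) × (Fin m → AddCircle (1 : ℝ)) |
          ∃ x ∈ L.submodule, y = σ L + π x}) = Set.univ := by
  classical
  refine Set.eq_univ_of_forall fun y => ?_
  let τ : EuclideanSpace ℝ (Fin (k + m)) → (Fin k → ℝ) × (Fin m → AddCircle (1 : ℝ)) :=
    fun x => if h : x ≠ 0 then y - σ (Projectivization.mk ℝ x h) else 0
  have hτ : ∀ x (h : x ≠ 0), τ x = y - σ (Projectivization.mk ℝ x h) := fun x h => dif_pos h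
  obtain ⟨x, hx, t, hxt⟩ := EuclideanSpace.exists_eq_toProdAddCircle_smul (τ := τ) hkm
    (by
      rw [continuousOn_iff_continuous_domRestrict]
      have : Continuous fun x : {x : EuclideanSpace ℝ (Fin (k + m)) // x ≠ 0} =>
          y - σ (Projectivization.mk ℝ x.1 x.2) :=
        continuous_const.sub (hσ.comp continuous_quot_mk)
      exact this.congr fun x => (hτ x.1 x.2).symm)
    (by
      intro x
      by_cases hx : x = 0
      · simp [hx]
      · rw [hτ x hx, hτ (-x) (neg_ne_zero.mpr hx)]
        congr 2
        rw [Projectivization.mk_eq_mk_iff']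
        exact ⟨-1, by simp⟩)
  refine Set.mem_iUnion.mpr ⟨Projectivization.mk ℝ x hx, t • x, ?_, ?_⟩
  · rw [Projectivization.submodule_mk]
    exact Submodule.smul_mem _ _ (Submodule.mem_span_singleton_self x)
  · rw [hτ x hx] at hxt
    rw [hπ (t • x), add_comm, ← sub_eq_iff_eq_add]
    exact hxt
end

section
/- Let n ≥ 1, let T^{2n+1} = (ℝ/ℤ)^{2n+1} be the odd-dimensional torus with quotient homomorphism π : ℝ^{2n+1} → T^{2n+1}, and let σ : S^{2n} → T^{2n+1} be a continuous oriented Kakeya line configuration in T^{2n+1}. Then its underlying space is all of T^{2n+1}; that is, ⋃_{x ∈ S^{2n}} (σ(x) + π(ℝx)) = T^{2n+1}. -/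
section Lifting

variable {E : Type*} [NormedAddCommGroup E] [InnerProductSpace ℝ E]

/-- A continuous map from a sphere to the circle lifts to `ℝ` away from any given point. -/
theorem exists_lift_addCircle_compl_singleton (v : Metric.sphere (0 : E) 1)
    {f : Metric.sphere (0 : E) 1 → AddCircle (1 : ℝ)} (hf : Continuous f)
    {p : Metric.sphere (0 : E) 1} (hp : p ≠ v) {r : ℝ} (hr : (r : AddCircle (1 : ℝ)) = f p) :
    ∃ g : Metric.sphere (0 : E) 1 → ℝ, ContinuousOn g {v}ᶜ ∧ g p = r ∧
      ∀ x ≠ v, (g x : AddCircle (1 : ℝ)) = f x := by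
  set s := stereographic (norm_eq_of_mem_sphere v) with hs
  have hsymm : Continuous s.symm := by
    have := s.symm.continuousOn
    rwa [s.symm_source, hs, stereographic_target, continuousOn_univ] at this
  have hsource : s.source = {v}ᶜ := rfl
  obtain ⟨G, ⟨hG, hGf⟩, -⟩ := (AddCircle.isCoveringMap_coe (1 : ℝ)).existsUnique_continuousMap_lifts
    ⟨f ∘ s.symm, hf.comp hsymm⟩ (s p) r (by simp [s.left_inv (show p ∈ s.source from hp), hr])
  refine ⟨G ∘ s, G.continuous.comp_continuousOn (hsource ▸ s.continuousOn), hG, fun x hx ↦ ?_⟩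
  have := congrFun hGf (s x)
  simpa [s.left_inv (show x ∈ s.source from hx)] using this

/-- A sphere of dimension at least two minus a pair of antipodal points is connected. -/
theorem isConnected_sphere_compl_pair [FiniteDimensional ℝ E] (h : 2 < Module.finrank ℝ E)
    (v : Metric.sphere (0 : E) 1) :
    IsConnected ({v}ᶜ ∩ {-v}ᶜ : Set (Metric.sphere (0 : E) 1)) := by
  set s := stereographic (norm_eq_of_mem_sphere v) with hs
  have hsymm : Continuous s.symm := by
    have := s.symm.continuousOn
    rwa [s.symm_source, hs, stereographic_target, continuousOn_univ] at this
  have hrank : 1 < Module.rank ℝ (ℝ ∙ (v : E))ᗮ := by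
    have h1 := (ℝ ∙ (v : E)).finrank_add_finrank_orthogonal
    rw [finrank_span_singleton (ne_zero_of_mem_unit_sphere v)] at h1
    rw [← Module.finrank_eq_rank]
    exact_mod_cast (by omega : 1 < Module.finrank ℝ (ℝ ∙ (v : E))ᗮ)
  have hs0 : s (-v) = 0 := stereographic_apply_neg v
  have hnv : -v ∈ s.source := by
    change -v ≠ v
    intro h
    exact ne_neg_of_mem_unit_sphere ℝ v h.symm
  convert (isConnected_compl_singleton_of_one_lt_rank hrank 0).image s.symm
    hsymm.continuousOn using 1
  ext x
  constructor
  · rintro ⟨h1, h2⟩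
    refine ⟨s x, fun h0 ↦ h2 ?_, s.left_inv h1⟩
    exact s.injOn h1 hnv (h0.trans hs0.symm)
  · rintro ⟨y, hy, rfl⟩
    have hyt : y ∈ s.target := Set.mem_univ _
    refine ⟨s.map_target hyt, fun h0 ↦ hy ?_⟩
    rw [Set.mem_singleton_iff, ← hs0, ← Set.mem_singleton_iff.1 h0, s.right_inv hyt]

/-- A continuous map from a sphere of dimension at least two to the circle lifts to `ℝ`. -/
theorem exists_lift_addCircle_of_sphere [FiniteDimensional ℝ E] (h : 2 < Module.finrank ℝ E)
    {f : Metric.sphere (0 : E) 1 → AddCircle (1 : ℝ)} (hf : Continuous f) :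
    ∃ g : Metric.sphere (0 : E) 1 → ℝ, Continuous g ∧
      ∀ x, (g x : AddCircle (1 : ℝ)) = f x := by
  classical
  have : Nontrivial E := Module.nontrivial_of_finrank_pos (R := ℝ) (by omega)
  obtain ⟨v⟩ : Nonempty (Metric.sphere (0 : E) 1) :=
    (NormedSpace.sphere_nonempty.2 zero_le_one).to_subtype
  have hv : v ≠ -v := fun h ↦ ne_neg_of_mem_unit_sphere ℝ v h
  have hconn := isConnected_sphere_compl_pair h v
  obtain ⟨p, hp1, hp2⟩ := hconn.nonempty
  obtain ⟨r, hr⟩ := QuotientAddGroup.mk_surjective (f p)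
  obtain ⟨g, hg, hgp, hgf⟩ := exists_lift_addCircle_compl_singleton v hf hp1 hr
  obtain ⟨k, hk, hkp, hkf⟩ := exists_lift_addCircle_compl_singleton (-v) hf hp2 hr
  have heq : Set.EqOn g k ({v}ᶜ ∩ {-v}ᶜ) :=
    (AddCircle.isCoveringMap_coe (1 : ℝ)).eqOn_of_comp_eqOn hconn.isPreconnected
      (hg.mono Set.inter_subset_left) (hk.mono Set.inter_subset_right)
      (fun x hx ↦ (hgf x hx.1).trans (hkf x hx.2).symm) ⟨hp1, hp2⟩ (hgp.trans hkp.symm)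
  let F : Metric.sphere (0 : E) 1 → ℝ := fun x ↦ if x = v then k x else g x
  have hFg : Set.EqOn F g {v}ᶜ := fun x hx ↦ if_neg hx
  have hFk : Set.EqOn F k {-v}ᶜ := fun x hx ↦ by
    by_cases hxv : x = v
    · exact if_pos hxv
    · exact (hFg hxv).trans (heq ⟨hxv, hx⟩)
  refine ⟨F, continuous_iff_continuousAt.2 fun x ↦ ?_, fun x ↦ ?_⟩
  · by_cases hx : x = v
    · exact (hk.congr hFk).continuousAt
        (isOpen_compl_singleton.mem_nhds (by rw [hx]; exact hv))
    · exact (hg.congr hFg).continuousAt (isOpen_compl_singleton.mem_nhds hx)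
  · by_cases hx : x = v
    · rw [hFk (by rw [hx]; exact hv), hkf x (by rw [hx]; exact hv)]
    · rw [hFg hx, hgf x hx]

end Lifting

section HairyBall

open MeasureTheory Metric

variable {E : Type*} [NormedAddCommGroup E] [InnerProductSpace ℝ E]

/-- Bijectivity of a small Lipschitz perturbation of the identity of a complete space. -/
theorem LipschitzWith.bijective_id_add {E : Type*} [NormedAddCommGroup E] [CompleteSpace E]
    {K : NNReal} (hK : K < 1) {W : E → E} (hW : LipschitzWith K W) :
    Function.Bijective fun y ↦ y + W y := by
  have hc : ∀ z, ContractingWith K fun y ↦ z - W y := fun z ↦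
    ⟨hK, LipschitzWith.of_dist_le_mul fun a b ↦ by
      rw [dist_sub_left]
      exact hW.dist_le_mul a b⟩
  refine ⟨fun a b hab ↦ ?_, fun z ↦ ⟨(hc z).fixedPoint, ?_⟩⟩
  · have hab' : a + W a = b + W b := hab
    refine (hc (a + W a)).fixedPoint_unique' (x := a) (y := b) ?_ ?_
    · simp [Function.IsFixedPt]
    · simp [Function.IsFixedPt, hab']
  · have := (hc z).fixedPoint_isFixedPt
    simp only [Function.IsFixedPt] at this
    exact (sub_eq_iff_eq_add.1 this).symm

open Polynomial in
/-- `t ↦ det (1 + t A)` is recovered by Lagrange interpolation at the nodes `0, …, dim E`. -/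
theorem ContinuousLinearMap.det_one_add_smul_eq_sum [FiniteDimensional ℝ E] (A : E →L[ℝ] E)
    (t : ℝ) :
    (1 + t • A).det = ∑ i ∈ Finset.range (Module.finrank ℝ E + 1), (1 + (i : ℝ) • A).det *
      (Lagrange.basis (Finset.range (Module.finrank ℝ E + 1)) (fun i : ℕ ↦ (i : ℝ)) i).eval t := by
  classical
  let b := Module.finBasis ℝ E
  let M := LinearMap.toMatrix b b (A : E →ₗ[ℝ] E)
  let P : ℝ[X] := ((X : ℝ[X]) • M.map C + (1 : Matrix _ _ ℝ).map C).det
  have hP : ∀ s : ℝ, P.eval s = (1 + s • A).det := fun s ↦ by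
    rw [ContinuousLinearMap.det, ← LinearMap.det_toMatrix b, ← coe_evalRingHom,
      RingHom.map_det]
    congr 1
    ext i j
    by_cases hij : i = j <;>
      simp [M, hij, LinearMap.toMatrix_one, add_comm, mul_comm s]
  have hdeg : P.degree < (Finset.range (Module.finrank ℝ E + 1)).card := by
    refine lt_of_le_of_lt (natDegree_le_iff_degree_le.1 (natDegree_det_X_add_C_le M 1)) ?_
    rw [Fintype.card_fin, Finset.card_range]
    exact_mod_cast Nat.lt_succ_self _
  rw [← hP, Lagrange.eq_interpolate (v := fun i : ℕ ↦ (i : ℝ)) Nat.cast_injective.injOn hdeg]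
  simp [Lagrange.interpolate_apply, eval_finsetSum, hP]

open Polynomial in
/-- Parity of degrees: `c (1 + X²) ^ N` is not a square in `ℝ[X]` for `N` odd. -/
theorem Polynomial.sq_ne_C_mul_one_add_X_sq_pow (P : ℝ[X]) {c : ℝ} (hc : c ≠ 0) {N : ℕ}
    (hN : Odd N) : P ^ 2 ≠ C c * (1 + X ^ 2) ^ N := by
  intro h
  have hdeg : P.natDegree = N := by
    have := congrArg natDegree h
    rw [natDegree_pow, natDegree_C_mul hc, natDegree_pow,
      show (1 + X ^ 2 : ℝ[X]) = X ^ 2 + C 1 by simp [add_comm], natDegree_X_pow_add_C] at this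
    omega
  have hcomp : P.comp (-X) ^ 2 = P ^ 2 := by
    rw [← pow_comp, h]
    simp
  have h0 : P.eval 0 ^ 2 = c := by simpa using congrArg (eval 0) h
  have hlead : (P.comp (-X)).leadingCoeff = -P.leadingCoeff := by
    rw [leadingCoeff_comp (by simp), hdeg, leadingCoeff_neg, leadingCoeff_X, hN.neg_one_pow,
      mul_neg_one]
  have hP : P ≠ 0 := fun hP ↦ hc (by simpa [hP] using h0.symm)
  rcases sq_eq_sq_iff_eq_or_eq_neg.1 hcomp with h1 | h1
  · rw [h1] at hlead
    exact hP (leadingCoeff_eq_zero.1 (self_eq_neg.1 hlead))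
  · have := congrArg (eval 0) h1
    simp only [eval_comp, eval_neg, eval_X, neg_zero] at this
    rw [self_eq_neg.1 this] at h0
    exact hc (by simpa using h0.symm)

/-- Change of variables for the map `y ↦ y + t V(y)` on the closed unit ball. -/
theorem integral_det_eq_addHaar_image [FiniteDimensional ℝ E] [MeasurableSpace E] [BorelSpace E]
    (μ : Measure E) [μ.IsAddHaarMeasure] {V : E → E} (hV : ContDiff ℝ 1 V) {t : ℝ}
    (hinj : Function.Injective fun y ↦ y + t • V y)
    (hpos : ∀ y, 0 < (1 + t • fderiv ℝ V y).det) :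
    ∫ y in closedBall 0 1, (1 + t • fderiv ℝ V y).det ∂μ =
      (μ ((fun y ↦ y + t • V y) '' closedBall 0 1)).toReal := by
  have hcont : Continuous fun y ↦ (1 + t • fderiv ℝ V y).det :=
    ContinuousLinearMap.continuous_det.comp
      (continuous_const.add ((hV.continuous_fderiv one_ne_zero).const_smul t))
  have hd : ∀ y ∈ closedBall (0 : E) 1, HasFDerivWithinAt (fun y ↦ y + t • V y)
      (1 + t • fderiv ℝ V y) (closedBall 0 1) y := fun y _ ↦
    ((hasFDerivAt_id y).add
      ((hV.differentiable one_ne_zero y).hasFDerivAt.const_smul t)).hasFDerivWithinAt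
  rw [← lintegral_abs_det_fderiv_eq_addHaar_image μ measurableSet_closedBall hd hinj.injOn,
    integral_eq_lintegral_of_nonneg_ae (.of_forall fun y ↦ (hpos y).le)
      hcont.aestronglyMeasurable]
  simp_rw [abs_of_pos (hpos _)]

/-- Milnor's volume argument: in odd dimension there is no compactly supported `C¹` vector field
tangent to the spheres centred at the origin, of norm at most one, and of norm exactly one on a
thick shell. -/
theorem false_of_tangent_unit_on_shell [FiniteDimensional ℝ E] (hodd : Odd (Module.finrank ℝ E))
    {V : E → E} (hV : ContDiff ℝ 1 V) (hsupp : HasCompactSupport V)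
    (horth : ∀ y, inner ℝ y (V y) = 0) (hle : ∀ y, ‖V y‖ ≤ 1)
    (hone : ∀ y, 1 ≤ ‖y‖ → ‖y‖ ≤ 2 → ‖V y‖ = 1) : False := by
  let _ : MeasurableSpace E := borel E
  have : BorelSpace E := ⟨rfl⟩
  let μ : Measure E := Measure.addHaar
  obtain ⟨K, hK⟩ := hV.lipschitzWith_of_hasCompactSupport hsupp one_ne_zero
  have hcont : ∀ t : ℝ, Continuous fun y ↦ (1 + t • fderiv ℝ V y).det := fun t ↦
    ContinuousLinearMap.continuous_det.comp
      (continuous_const.add ((hV.continuous_fderiv one_ne_zero).const_smul t))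
  obtain ⟨ε, hε, hdet⟩ : ∃ ε > 0, ∀ A : E →L[ℝ] E, ‖A‖ < ε → 0 < (1 + A).det := by
    have hc : Continuous fun A : E →L[ℝ] E ↦ (1 + A).det :=
      ContinuousLinearMap.continuous_det.comp (continuous_const.add continuous_id)
    have h0 : 0 < (1 + (0 : E →L[ℝ] E)).det := by simp [ContinuousLinearMap.det]
    obtain ⟨ε, hε, h⟩ := Metric.eventually_nhds_iff.1 (hc.continuousAt.eventually (lt_mem_nhds h0))
    exact ⟨ε, hε, fun A hA ↦ h (by simpa using hA)⟩
  obtain ⟨δ, hδ, hδ1, hδK, hδε⟩ : ∃ δ : ℝ, 0 < δ ∧ δ ≤ 1 ∧ δ * K < 1 ∧ δ * K < ε := by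
    have hK0 : (0 : ℝ) < K + 1 := by positivity
    have hm : 0 < min 1 ε := by positivity
    have hlt : min 1 ε / (K + 1) * K < min 1 ε := by
      rw [div_mul_eq_mul_div, div_lt_iff₀ hK0]
      nlinarith
    refine ⟨min 1 ε / (K + 1), by positivity, ?_, hlt.trans_le (min_le_left _ _),
      hlt.trans_le (min_le_right _ _)⟩
    rw [div_le_one hK0]
    exact (min_le_left _ _).trans (by simp)
  set c : ℝ := (μ (ball 0 1)).toReal with hc
  have hcpos : 0 < c := ENNReal.toReal_pos (measure_ball_pos μ 0 one_pos).ne' measure_ball_lt_top.ne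
  set N := Module.finrank ℝ E with hN
  have hvol : ∀ t ∈ Set.Ioo 0 δ, ∫ y in closedBall 0 1, (1 + t • fderiv ℝ V y).det ∂μ =
      √(1 + t ^ 2) ^ N * c := by
    rintro t ⟨ht0, htδ⟩
    have htK : t * K ≤ δ * K := by gcongr
    have hlip : LipschitzWith (t.toNNReal * K) fun y ↦ t • V y := LipschitzWith.of_dist_le_mul
      fun a b ↦ by
        rw [dist_smul₀, NNReal.coe_mul, Real.coe_toNNReal t ht0.le, Real.norm_of_nonneg ht0.le,
          mul_assoc]
        gcongr
        exact hK.dist_le_mul a b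
    have hbij := hlip.bijective_id_add (by
      rw [← NNReal.coe_lt_coe, NNReal.coe_mul, Real.coe_toNNReal t ht0.le]
      exact htK.trans_lt hδK)
    have hnorm : ∀ y, ‖y + t • V y‖ ^ 2 = ‖y‖ ^ 2 + t ^ 2 * ‖V y‖ ^ 2 := fun y ↦ by
      rw [norm_add_sq_real, inner_smul_right, horth, norm_smul, Real.norm_of_nonneg ht0.le]
      ring
    have himage : (fun y ↦ y + t • V y) '' closedBall 0 1 = closedBall 0 (√(1 + t ^ 2)) := by
      have hmem : ∀ y, y ∈ closedBall (0 : E) 1 ↔ y + t • V y ∈ closedBall 0 (√(1 + t ^ 2)) := by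
        intro y
        have hVle : ‖V y‖ ^ 2 ≤ 1 := pow_le_one₀ (norm_nonneg _) (hle y)
        rw [mem_closedBall_zero_iff, mem_closedBall_zero_iff,
          Real.le_sqrt (norm_nonneg _) (by positivity), hnorm]
        constructor
        · intro h
          have : ‖y‖ ^ 2 ≤ 1 := pow_le_one₀ (norm_nonneg _) h
          nlinarith [sq_nonneg t]
        · intro h
          by_contra! hy
          by_cases h2 : ‖y‖ ≤ 2
          · rw [hone y hy.le h2] at h
            nlinarith
          · nlinarith [sq_nonneg (t * ‖V y‖)]
      ext z
      constructor
      · rintro ⟨y, hy, rfl⟩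
        exact (hmem y).1 hy
      · intro hz
        obtain ⟨y, rfl⟩ := hbij.2 z
        exact ⟨y, (hmem y).2 hz, rfl⟩
    rw [integral_det_eq_addHaar_image μ hV hbij.1, himage,
      Measure.addHaar_closedBall _ _ (Real.sqrt_nonneg _), ENNReal.toReal_mul,
      ENNReal.toReal_ofReal (by positivity)]
    intro y
    refine hdet _ ?_
    rw [norm_smul, Real.norm_of_nonneg ht0.le]
    refine lt_of_le_of_lt ?_ (htK.trans_lt hδε)
    gcongr
    exact norm_fderiv_le_of_lipschitz ℝ hK
  let P : Polynomial ℝ := ∑ i ∈ Finset.range (N + 1),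
    Polynomial.C (∫ y in closedBall 0 1, (1 + (i : ℝ) • fderiv ℝ V y).det ∂μ) *
      Lagrange.basis (Finset.range (N + 1)) (fun i : ℕ ↦ (i : ℝ)) i
  have hP : ∀ t : ℝ, P.eval t = ∫ y in closedBall 0 1, (1 + t • fderiv ℝ V y).det ∂μ := by
    intro t
    simp_rw [ContinuousLinearMap.det_one_add_smul_eq_sum _ t]
    rw [integral_finsetSum]
    · simp [P, hN, Polynomial.eval_finsetSum, integral_mul_const]
    · intro i _
      exact (((hcont i).mul_const _).continuousOn.integrableOn_compact
        (isCompact_closedBall 0 1))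
  refine P.sq_ne_C_mul_one_add_X_sq_pow (c := c ^ 2) (by positivity) hodd
    (Polynomial.eq_of_infinite_eval_eq _ _ ((Set.Ioo_infinite hδ).mono fun t ht ↦ ?_))
  have h1 : (0 : ℝ) ≤ 1 + t ^ 2 := by positivity
  simp only [Set.mem_ofPred_eq, Polynomial.eval_pow, Polynomial.eval_mul, Polynomial.eval_C,
    Polynomial.eval_add, Polynomial.eval_one, Polynomial.eval_X, hP, hvol t ht]
  rw [mul_pow, ← pow_mul, mul_comm N 2, pow_mul, Real.sq_sqrt h1, mul_comm]

/-- A continuous vector field tangent to the spheres centred at the origin and nonvanishing away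
from the origin can be replaced by a smooth one away from the ball of radius `1 / 2`. -/
theorem exists_contDiff_tangent_ne_zero [FiniteDimensional ℝ E] {u : E → E}
    (hu : ∀ y ≠ 0, ContinuousAt u y) (hne : ∀ y ≠ 0, u y ≠ 0)
    (horth : ∀ y, inner ℝ y (u y) = 0) :
    ∃ w : E → E, ContDiff ℝ 1 w ∧ (∀ y, inner ℝ y (w y) = 0) ∧ ∀ y, 1 / 2 < ‖y‖ → w y ≠ 0 := by
  obtain ⟨g, hg⟩ := exists_contMDiffMap_forall_mem_convex_of_local_const
    (modelWithCornersSelf ℝ E) (n := 1) (M := E) (F := E)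
    (t := fun y ↦ {w | 1 / 2 < ‖y‖ → 0 < inner ℝ w (u y)})
    (fun y a ha b hb r s hr hs hrs hy ↦ by
      have h1 := ha hy
      have h2 := hb hy
      rw [inner_add_left, real_inner_smul_left, real_inner_smul_left]
      rcases hr.eq_or_lt with rfl | hr
      · simp_all
      · positivity)
    (fun x ↦ by
      by_cases hx : x = 0
      · refine ⟨0, ?_⟩
        filter_upwards [ball_mem_nhds x (by norm_num : (0 : ℝ) < 1 / 2)] with y hy hy'
        rw [hx, mem_ball_zero_iff] at hy
        exact absurd hy' hy.le.not_gt
      · refine ⟨u x, ?_⟩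
        have hc : ContinuousAt (fun y ↦ (inner ℝ (u x) (u y) : ℝ)) x :=
          continuousAt_const.inner (hu x hx)
        filter_upwards [hc.eventually (lt_mem_nhds (real_inner_self_pos.2 (hne x hx)))]
          with y hy _ using hy)
  have hgd : ContDiff ℝ 1 g := g.contMDiff.contDiff
  refine ⟨fun y ↦ ‖y‖ ^ 2 • g y - inner ℝ y (g y) • y, ?_, fun y ↦ ?_, fun y hy h0 ↦ ?_⟩
  · exact ((contDiff_norm_sq ℝ).smul hgd).sub ((contDiff_id.inner ℝ hgd).smul contDiff_id)
  · rw [inner_sub_right, inner_smul_right, inner_smul_right, real_inner_self_eq_norm_sq]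
    ring
  · have h1 : (inner ℝ (‖y‖ ^ 2 • g y - inner ℝ y (g y) • y) (u y) : ℝ) = 0 := by
      rw [show ‖y‖ ^ 2 • g y - inner ℝ y (g y) • y = 0 from h0, inner_zero_left]
    rw [inner_sub_left, real_inner_smul_left, real_inner_smul_left, horth, mul_zero, sub_zero] at h1
    have h2 : 0 < (inner ℝ (g y) (u y) : ℝ) := hg y hy
    have h3 : 0 < ‖y‖ := by linarith
    have : 0 < ‖y‖ ^ 2 * (inner ℝ (g y) (u y) : ℝ) := by positivity
    exact this.ne' h1

/-- **Hairy ball theorem**: a continuous map from the unit sphere of an odd-dimensional Euclidean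
space `E` to `E` is somewhere radial. -/
theorem exists_eq_smul_of_continuous_sphere [FiniteDimensional ℝ E]
    (hodd : Odd (Module.finrank ℝ E)) {F : sphere (0 : E) 1 → E} (hF : Continuous F) :
    ∃ (x : sphere (0 : E) 1) (t : ℝ), F x = t • (x : E) := by
  classical
  by_contra! hcon
  let T : sphere (0 : E) 1 → E := fun x ↦ F x - inner ℝ (x : E) (F x) • (x : E)
  have hT : Continuous T := by fun_prop
  have hT0 : ∀ x, T x ≠ 0 := fun x h ↦ hcon x _ (sub_eq_zero.1 h)
  have hTorth : ∀ x : sphere (0 : E) 1, inner ℝ (x : E) (T x) = 0 := fun x ↦ by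
    rw [inner_sub_right, inner_smul_right, real_inner_self_eq_norm_sq, norm_eq_of_mem_sphere x]
    ring
  have hmem : ∀ y : E, y ≠ 0 → ‖y‖⁻¹ • y ∈ sphere (0 : E) 1 := fun y hy ↦ by
    rw [mem_sphere_zero_iff_norm]
    exact norm_smul_inv_norm (𝕜 := ℝ) hy
  let u : E → E := fun y ↦ if hy : y = 0 then 0 else T ⟨‖y‖⁻¹ • y, hmem y hy⟩
  obtain ⟨w, hw, hworth, hw0⟩ := exists_contDiff_tangent_ne_zero (u := u)
    (fun y hy ↦ by
      have hcont : ContinuousOn u {0}ᶜ := by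
        rw [continuousOn_iff_continuous_domRestrict]
        have : Continuous fun z : ({0}ᶜ : Set E) ↦ T ⟨‖(z : E)‖⁻¹ • (z : E), hmem z z.2⟩ := by
          refine hT.comp (Continuous.subtype_mk ?_ _)
          exact (continuous_subtype_val.norm.inv₀ fun z ↦ norm_ne_zero_iff.2 z.2).smul
            continuous_subtype_val
        refine this.congr fun z ↦ ?_
        have hz : (z : E) ≠ 0 := z.2
        change _ = u z
        simp only [u, dif_neg hz]
      exact hcont.continuousAt (isOpen_compl_singleton.mem_nhds hy))
    (fun y hy ↦ by simpa only [u, dif_neg hy] using hT0 _)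
    (fun y ↦ by
      by_cases hy : y = 0
      · simp [hy]
      · have := hTorth ⟨‖y‖⁻¹ • y, hmem y hy⟩
        rw [real_inner_smul_left] at this
        simpa only [u, dif_neg hy] using
          (mul_eq_zero.1 this).resolve_left (inv_ne_zero (norm_ne_zero_iff.2 hy)))
  let b₁ : ContDiffBump (0 : E) := ⟨5 / 8, 1, by norm_num, by norm_num⟩
  let b₂ : ContDiffBump (0 : E) := ⟨2, 3, by norm_num, by norm_num⟩
  let φ : E → ℝ := fun y ↦ (1 - b₁ y) * b₂ y
  have hφ : ContDiff ℝ 1 φ := (contDiff_const.sub b₁.contDiff).mul b₂.contDiff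
  have hφ0 : ∀ y, 0 ≤ φ y := fun y ↦ mul_nonneg (sub_nonneg.2 b₁.le_one) b₂.nonneg
  have hφ1 : ∀ y, φ y ≤ 1 := fun y ↦
    mul_le_one₀ (sub_le_self _ b₁.nonneg) b₂.nonneg b₂.le_one
  have hφz : ∀ y, ‖y‖ ≤ 5 / 8 → φ y = 0 := fun y hy ↦ by
    simp [φ, b₁.one_of_mem_closedBall (mem_closedBall_zero_iff.2 hy)]
  let V : E → E := fun y ↦ (φ y * ‖w y‖⁻¹) • w y
  have hnorm : ∀ y, ‖V y‖ = φ y := fun y ↦ by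
    rcases le_or_gt ‖y‖ (5 / 8) with hy | hy
    · simp [V, hφz y hy]
    · have : ‖w y‖ ≠ 0 := norm_ne_zero_iff.2 (hw0 y (by linarith))
      rw [norm_smul, norm_mul, norm_inv, norm_norm, mul_assoc, inv_mul_cancel₀ this, mul_one,
        Real.norm_of_nonneg (hφ0 y)]
  refine false_of_tangent_unit_on_shell hodd (V := V) ?_ ?_ (fun y ↦ ?_)
    (fun y ↦ (hnorm y).trans_le (hφ1 y)) (fun y h1 h2 ↦ ?_)
  · refine contDiff_iff_contDiffAt.2 fun y ↦ ?_
    rcases le_or_gt ‖y‖ (1 / 2) with hy | hy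
    · refine (contDiffAt_const (c := (0 : E))).congr_of_eventuallyEq ?_
      filter_upwards [isOpen_ball.mem_nhds
        (mem_ball_zero_iff.2 (by linarith) : y ∈ ball (0 : E) (5 / 8))] with z hz
      simp [V, hφz z (mem_ball_zero_iff.1 hz).le]
    · have hwy := hw0 y hy
      exact (hφ.contDiffAt.mul ((hw.contDiffAt.norm ℝ hwy).inv (norm_ne_zero_iff.2 hwy))).smul
        hw.contDiffAt
  · exact (b₂.hasCompactSupport.mul_left.mul_right).smul_right
  · rw [inner_smul_right, hworth, mul_zero]
  · rw [hnorm]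
    have e1 : b₁ y = 0 := b₁.zero_of_le_dist (by simpa using h1)
    have e2 : b₂ y = 1 := b₂.one_of_mem_closedBall (mem_closedBall_zero_iff.2 h2)
    simp [φ, e1, e2]

end HairyBall

/-- The underlying space of a continuous oriented Kakeya line configuration in the
odd-dimensional torus `T^{2n+1} = (ℝ/ℤ)^{2n+1}` is all of `T^{2n+1}`.  Here
`π : ℝ^{2n+1} → T^{2n+1}` is the coordinatewise quotient homomorphism. -/
theorem odd_torus_oriented_underlying_space_eq_univ (n : ℕ) (hn : 1 ≤ n)
    (π : EuclideanSpace ℝ (Fin (2 * n + 1)) → (Fin (2 * n + 1) → AddCircle (1 : ℝ)))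
    (hπ : ∀ (x : EuclideanSpace ℝ (Fin (2 * n + 1))) (i : Fin (2 * n + 1)),
      π x i = (x i : AddCircle (1 : ℝ)))
    (σ : Metric.sphere (0 : EuclideanSpace ℝ (Fin (2 * n + 1))) 1 →
      (Fin (2 * n + 1) → AddCircle (1 : ℝ)))
    (hσ : Continuous σ) :
    (⋃ x : Metric.sphere (0 : EuclideanSpace ℝ (Fin (2 * n + 1))) 1,
        {y : Fin (2 * n + 1) → AddCircle (1 : ℝ) |
          ∃ t : ℝ, y = σ x + π (t • (x : EuclideanSpace ℝ (Fin (2 * n + 1))))}) =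
      Set.univ := by
  have hlift : ∀ i, ∃ g : Metric.sphere (0 : EuclideanSpace ℝ (Fin (2 * n + 1))) 1 → ℝ,
      Continuous g ∧ ∀ x, (g x : AddCircle (1 : ℝ)) = σ x i := fun i ↦
    exists_lift_addCircle_of_sphere (by rw [finrank_euclideanSpace_fin]; omega)
      ((continuous_apply i).comp hσ)
  choose g hg hgσ using hlift
  refine Set.eq_univ_of_forall fun y ↦ ?_
  have hy : ∀ i, ∃ r : ℝ, (r : AddCircle (1 : ℝ)) = y i := fun i ↦
    QuotientAddGroup.mk_surjective (y i)
  choose r hr using hy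
  have hF : Continuous fun x ↦ (WithLp.toLp 2 fun i ↦ r i - g i x :
      EuclideanSpace ℝ (Fin (2 * n + 1))) :=
    (PiLp.continuous_toLp 2 _).comp (continuous_pi fun i ↦ continuous_const.sub (hg i))
  obtain ⟨x, t, hxt⟩ := exists_eq_smul_of_continuous_sphere
    (by rw [finrank_euclideanSpace_fin]; exact ⟨n, rfl⟩) hF
  refine Set.mem_iUnion.2 ⟨x, t, funext fun i ↦ ?_⟩
  rw [Pi.add_apply, hπ, ← hxt, ← hgσ, ← hr, ← AddCircle.coe_add]
  simp
end
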